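/- arXiv:2106.03354 — 2 statements merged into one kernel-verified Lean document; each statement's English description precedes it below -/
import Mathlib

section
/- Let d ≥ 1, let ρ be a probability density on ℝ^d with finite variance, fix x in the interior of the support of ρ with ρ continuous at x. Assume the growth condition ∫ ρ(y)·f²(y)/(1+‖y‖^{2d}) d^d y < ∞ and the local Hölder condition: there exist α_x > 0, K_x > 0, δ_x > 0 such that x' ∈ Ω and ‖x−x'‖ ≤ δ_x imply |f(x)−f(x')| ≤ K_x·‖x−x'‖^{α_x}. Define κ(x) = ∫ ρ(x+y)·(f(x+y)−f(x))/‖y‖^d d^d y (which is finite). If κ(x) ≠ 0, then the bias term B(x) = E[(Σ_{i=0}^n w_i(x)·(f(X_i)−f(x)))²] satisfies B(x) ~ (κ(x)/(V_d·ρ(x)·ln n))² as n → ∞, and moreover B(x) ~ (E[f̂(x)]−f(x))² as n → ∞. -/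
open MeasureTheory Filter

noncomputable section

/-- Euclidean space `ℝ^d`. -/
abbrev Euc (d : ℕ) : Type := EuclideanSpace ℝ (Fin d)

/-- The Hilbert kernel weight `w_i(x) = ‖x−x_i‖^{−d} / Σ_j ‖x−x_j‖^{−d}`
for sample points `xs : Fin (n+1) → ℝ^d`. -/
def hilbertWeight (d n : ℕ) (x : Euc d) (xs : Fin (n + 1) → Euc d) (i : Fin (n + 1)) : ℝ :=
  ‖x - xs i‖ ^ (-(d : ℝ)) / ∑ j : Fin (n + 1), ‖x - xs j‖ ^ (-(d : ℝ))

/-- The volume `V_d = π^{d/2}/Γ(d/2+1)` of the unit ball in `ℝ^d`. -/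
def unitBallVol (d : ℕ) : ℝ := Real.pi ^ ((d : ℝ) / 2) / Real.Gamma ((d : ℝ) / 2 + 1)

/-- The bias term `B(x) = E[(Σ_i w_i(x)·(f(X_i)−f(x)))²]` of the Hilbert kernel regression
estimator, expressed as an integral against the product density `∏ ρ(x_i)`. -/
def hilbertBias (d n : ℕ) (x : Euc d) (ρ f : Euc d → ℝ) : ℝ :=
  ∫ xs : Fin (n + 1) → Euc d,
    (∑ i : Fin (n + 1), hilbertWeight d n x xs i * (f (xs i) - f x)) ^ 2 *
      ∏ i : Fin (n + 1), ρ (xs i)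

/-- The expectation `E[f̂(x)] = E[Σ_i w_i(x)·f(X_i)]` of the Hilbert kernel regression
estimator (the `Y`-averages having been taken via the regression function `f`),
expressed as an integral against the product density `∏ ρ(x_i)`. -/
def hilbertEstExp (d n : ℕ) (x : Euc d) (ρ f : Euc d → ℝ) : ℝ :=
  ∫ xs : Fin (n + 1) → Euc d,
    (∑ i : Fin (n + 1), hilbertWeight d n x xs i * f (xs i)) *
      ∏ i : Fin (n + 1), ρ (xs i)


/-- scaling limit: `n (1 - φ(u / (n log n))) → L u`. -/
lemma aux_scale {φ : ℝ → ℝ} {L : ℝ}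
    (hφL : Tendsto (fun t => (1 - φ t) / (t * Real.log (1 / t))) (nhdsWithin 0 (Set.Ioi 0)) (nhds L))
    {u : ℝ} (hu : 0 < u) :
    Tendsto (fun n : ℕ => (n : ℝ) * (1 - φ (u / (n * Real.log n)))) atTop (nhds (L * u)) := by
  have hlog : Tendsto (fun n : ℕ => Real.log n) atTop atTop :=
    Real.tendsto_log_atTop.comp tendsto_natCast_atTop_atTop
  have hs : Tendsto (fun n : ℕ => (n : ℝ) * Real.log n) atTop atTop :=
    tendsto_natCast_atTop_atTop.atTop_mul_atTop₀ hlog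
  have hv : Tendsto (fun n : ℕ => u / ((n : ℝ) * Real.log n)) atTop (nhdsWithin 0 (Set.Ioi 0)) := by
    refine tendsto_nhdsWithin_iff.2 ⟨hs.const_div_atTop u, ?_⟩
    filter_upwards [hs.eventually_gt_atTop 0] with n hn
    exact div_pos hu hn
  have h1 := hφL.comp hv
  have hr : Tendsto (fun n : ℕ => Real.log (1 / (u / ((n : ℝ) * Real.log n))) / Real.log n) atTop
      (nhds 1) := by
    have hll : Tendsto (fun n : ℕ => Real.log (Real.log n) / Real.log n) atTop (nhds 0) :=
      (Real.isLittleO_log_id_atTop.tendsto_div_nhds_zero).comp hlog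
    have hlu : Tendsto (fun n : ℕ => Real.log u / Real.log n) atTop (nhds 0) :=
      hlog.const_div_atTop _
    have := (hll.const_add 1).sub hlu
    simp only [add_zero, sub_zero] at this
    refine this.congr' ?_
    filter_upwards [hlog.eventually_gt_atTop 0, eventually_gt_atTop 0] with n hn hn0
    have hn0' : (0 : ℝ) < n := by exact_mod_cast hn0
    rw [one_div_div, Real.log_div (by positivity) hu.ne', Real.log_mul hn0'.ne' hn.ne']
    field_simp
  have h2 := (h1.mul hr).mul_const u
  rw [mul_one] at h2
  refine h2.congr' ?_
  have hvl : ∀ᶠ n : ℕ in atTop, 1 < (n : ℝ) * Real.log n / u := by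
    exact (hs.atTop_div_const hu).eventually_gt_atTop 1
  filter_upwards [hlog.eventually_gt_atTop 0, eventually_gt_atTop 0, hvl] with n hn hn0 hn1
  have hn0' : (0 : ℝ) < n := by exact_mod_cast hn0
  have : 0 < Real.log ((n : ℝ) * Real.log n / u) := Real.log_pos hn1
  simp only [Function.comp, one_div_div]
  field_simp

lemma aux_pow_le {φ : ℝ} (h0 : 0 ≤ φ) (N : ℕ) {a : ℝ} (h : a ≤ N * (1 - φ)) :
    φ ^ N ≤ Real.exp (-a) := by
  have : φ ≤ Real.exp (-(1 - φ)) := by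
    have := Real.add_one_le_exp (-(1 - φ)); linarith
  calc φ ^ N ≤ (Real.exp (-(1 - φ))) ^ N := pow_le_pow_left₀ h0 this N
    _ = Real.exp (N * (-(1 - φ))) := by rw [← Real.exp_nat_mul]
    _ ≤ _ := Real.exp_le_exp.2 (by linarith)

/-- key bound -/
lemma aux_bound {φ : ℝ → ℝ} {L : ℝ} (hL : 0 < L)
    (hφL : Tendsto (fun t => (1 - φ t) / (t * Real.log (1 / t))) (nhdsWithin 0 (Set.Ioi 0)) (nhds L))
    (h0 : ∀ t, 0 < t → 0 ≤ φ t) :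
    ∀ᶠ n : ℕ in atTop, ∀ u : ℝ, 0 < u → u ≤ √n → ∀ N : ℕ, (n : ℝ) / 2 ≤ N →
      φ (u / (n * Real.log n)) ^ N ≤ Real.exp (-(L / 8 * u)) := by
  have hev := hφL.eventually (lt_mem_nhds (show L / 2 < L by linarith))
  rw [eventually_nhdsWithin_iff, Metric.eventually_nhds_iff] at hev
  obtain ⟨t0, ht0, hev⟩ := hev
  have hlog : Tendsto (fun n : ℕ => Real.log n) atTop atTop :=
    Real.tendsto_log_atTop.comp tendsto_natCast_atTop_atTop
  have hsq : Tendsto (fun n : ℕ => √(n:ℝ)) atTop atTop :=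
    Real.tendsto_sqrt_atTop.comp tendsto_natCast_atTop_atTop
  filter_upwards [hlog.eventually_ge_atTop 1, eventually_gt_atTop 1,
    hsq.eventually_gt_atTop (1 / t0)] with n hn hn1 hnt u hu hun N hN
  have hn0 : (1 : ℝ) < n := by exact_mod_cast hn1
  have hspos : 0 < √(n:ℝ) := Real.sqrt_pos.2 (by linarith)
  set v := u / (n * Real.log n) with hv
  have hvpos : 0 < v := by positivity
  have hvle : v ≤ 1 / √(n:ℝ) := by
    rw [hv, div_le_div_iff₀ (by positivity) hspos]
    have : √(n:ℝ) * √(n:ℝ) = n := Real.mul_self_sqrt (by linarith)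
    nlinarith
  have hvt : v < t0 := by
    refine lt_of_le_of_lt hvle ?_
    rw [div_lt_comm₀ hspos ht0]; exact hnt
  have h3 := hev (y := v) (by simpa [abs_of_pos hvpos] using hvt) hvpos
  have hlv : Real.log n / 2 ≤ Real.log (1 / v) := by
    rw [← Real.log_sqrt (by linarith)]
    apply Real.log_le_log hspos
    rw [le_div_comm₀ hspos hvpos]; exact hvle
  have hlvpos : 0 < Real.log (1 / v) := by linarith
  rw [lt_div_iff₀ (by positivity)] at h3
  apply aux_pow_le (h0 v hvpos)
  have e : L / 8 * u = (n : ℝ) / 2 * (L / 2 * (v * (Real.log n / 2))) := by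
    rw [hv]; field_simp; norm_num
  rw [e]
  refine mul_le_mul hN ?_ (by positivity) (by positivity)
  refine le_trans ?_ h3.le
  gcongr

lemma aux_small (L : ℝ) (hL : 0 < L) :
    ∀ᶠ n : ℕ in atTop, ((n : ℝ) * Real.log n) ^ 3 * Real.exp (-(L / 8 * √n)) ≤ 1 := by
  have hsq : Tendsto (fun n : ℕ => √(n:ℝ)) atTop atTop :=
    Real.tendsto_sqrt_atTop.comp tendsto_natCast_atTop_atTop
  have h := ((tendsto_rpow_mul_exp_neg_mul_atTop_nhds_zero 12 (L/8) (by linarith)).comp hsq)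
  filter_upwards [h.eventually (gt_mem_nhds (show (0:ℝ) < 1 by norm_num)),
    eventually_gt_atTop 0] with n hn hn0
  have hn0' : (1 : ℝ) ≤ n := by exact_mod_cast hn0
  refine le_trans ?_ hn.le
  simp only [Function.comp]
  rw [neg_mul]
  gcongr
  have e : (√(n:ℝ)) ^ (12:ℝ) = (n:ℝ) ^ 6 := by
    rw [show (12:ℝ) = ((12:ℕ):ℝ) by norm_num, Real.rpow_natCast,
      show (12:ℕ) = 2 * 6 by norm_num, pow_mul, Real.sq_sqrt (by linarith)]
  rw [e]
  have : (n:ℝ) * Real.log n ≤ (n:ℝ) ^ 2 := by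
    have := Real.log_le_self (x := n) (by linarith)
    nlinarith
  calc ((n:ℝ) * Real.log n) ^ 3 ≤ ((n:ℝ)^2) ^ 3 := by
        have := Real.log_nonneg hn0'
        gcongr
    _ = _ := by ring

/-- The main one-dimensional Laplace-type asymptotics. -/
lemma aux_laplace {φ h : ℝ → ℝ} {L k C M h0 : ℝ} {m : ℕ} (hL : 0 < L) (hk0 : 0 ≤ k) (hk1 : k ≤ 1)
    (hφL : Tendsto (fun t => (1 - φ t) / (t * Real.log (1 / t))) (nhdsWithin 0 (Set.Ioi 0)) (nhds L))
    (hφ0 : ∀ t, 0 < t → 0 ≤ φ t)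
    (hanti : AntitoneOn φ (Set.Ioi 0)) (hφm : Measurable φ) (hhm : Measurable h)
    (hdecay : ∀ t, 0 < t → φ t ^ m ≤ C * (t ^ 3)⁻¹)
    (hM : ∀ t, 0 < t → |h t| ≤ M)
    (hh : Tendsto h (nhdsWithin 0 (Set.Ioi 0)) (nhds h0)) :
    Tendsto (fun n : ℕ => ((n : ℝ) * Real.log n) ^ (k + 1) *
      ∫ t in Set.Ioi (0:ℝ), t ^ k * h t * φ t ^ (n - 1)) atTop
      (nhds (h0 * (Real.Gamma (k + 1) / L ^ (k + 1)))) := by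
  have hlog : Tendsto (fun n : ℕ => Real.log n) atTop atTop :=
    Real.tendsto_log_atTop.comp tendsto_natCast_atTop_atTop
  have hs : Tendsto (fun n : ℕ => (n : ℝ) * Real.log n) atTop atTop :=
    tendsto_natCast_atTop_atTop.atTop_mul_atTop₀ hlog
  have hC : 0 ≤ C := by
    have := hdecay 1 one_pos
    have h2 := pow_nonneg (hφ0 1 one_pos) m
    simp at this; linarith
  have hMn : 0 ≤ M := (abs_nonneg _).trans (hM 1 one_pos)
  have key : Tendsto (fun n : ℕ => ∫ u in Set.Ioi (0:ℝ),
      u ^ k * h (u / (n * Real.log n)) * φ (u / (n * Real.log n)) ^ (n - 1)) atTop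
      (nhds (∫ u in Set.Ioi (0:ℝ), u ^ k * h0 * Real.exp (-(L * u)))) := by
    refine tendsto_integral_filter_of_dominated_convergence
      (fun u => M * (u ^ k * Real.exp (-(L / 8 * u))) + 2 * M * C * (1 + u ^ 2)⁻¹) ?_ ?_ ?_ ?_
    · refine Eventually.of_forall fun n => Measurable.aestronglyMeasurable ?_
      have := hhm.comp (measurable_id.div_const ((n:ℝ) * Real.log n))
      have h2 := hφm.comp (measurable_id.div_const ((n:ℝ) * Real.log n))
      exact ((measurable_id.pow_const k).mul this).mul (h2.pow_const _)
    · filter_upwards [aux_bound hL hφL hφ0, aux_small L hL, hs.eventually_gt_atTop 0,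
        eventually_ge_atTop (2 * m + 2)] with n hb hsm hspos hnm
      refine (ae_restrict_iff' measurableSet_Ioi).2 (Eventually.of_forall fun u hu => ?_)
      have hu : 0 < u := hu
      have hnm' : (2 * m + 2 : ℝ) ≤ n := by exact_mod_cast hnm
      have hc1 : ((n - 1 : ℕ) : ℝ) = n - 1 := by
        rw [Nat.cast_sub (by omega)]; simp
      have hc2 : ((n - 1 - m : ℕ) : ℝ) = n - 1 - m := by
        rw [Nat.cast_sub (by omega), hc1]
      have hm0 : (0:ℝ) ≤ m := m.cast_nonneg
      set v := u / (n * Real.log n) with hv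
      have hvpos : 0 < v := by positivity
      have hpow : 0 ≤ φ v ^ (n-1) := pow_nonneg (hφ0 v hvpos) _
      rw [Real.norm_eq_abs, abs_mul, abs_mul, abs_of_nonneg (Real.rpow_nonneg hu.le k),
        abs_of_nonneg hpow]
      have hA : 0 ≤ M * (u ^ k * Real.exp (-(L / 8 * u))) := by positivity
      have hB : 0 ≤ 2 * M * C * (1 + u ^ 2)⁻¹ := by positivity
      rcases le_or_gt u (√n) with hun | hun
      · have := hb u hu hun (n - 1) (by rw [hc1]; linarith)
        calc u ^ k * |h v| * φ v ^ (n - 1) ≤ u ^ k * M * Real.exp (-(L / 8 * u)) := by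
              gcongr
              exact hM v hvpos
          _ = M * (u ^ k * Real.exp (-(L / 8 * u))) := by ring
          _ ≤ _ := by linarith
      · have hn1 : (1:ℝ) ≤ n := by linarith
        have hsq1 : 1 ≤ √(n:ℝ) := Real.one_le_sqrt.2 hn1
        have hu1 : 1 ≤ u := by linarith
        have hb' := hb (√n) (by linarith) le_rfl (n - 1 - m) (by rw [hc2]; linarith)
        have hle : φ v ≤ φ (√n / (n * Real.log n)) := by
          apply hanti
          · exact div_pos (by linarith) hspos
          · exact hvpos
          · rw [hv]; gcongr
        have hsplit : φ v ^ (n-1) = φ v ^ m * φ v ^ (n - 1 - m) := by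
          rw [← pow_add]; congr 1; omega
        have hp1 : φ v ^ (n-1) ≤ C * (v ^ 3)⁻¹ * Real.exp (-(L / 8 * √n)) := by
          rw [hsplit]
          have : φ v ^ (n-1-m) ≤ Real.exp (-(L / 8 * √n)) :=
            (pow_le_pow_left₀ (hφ0 v hvpos) hle _).trans hb'
          exact mul_le_mul (hdecay v hvpos) this (pow_nonneg (hφ0 v hvpos) _) (by positivity)
        have huk : u ^ k ≤ u := by
          simpa using Real.rpow_le_rpow_of_exponent_le hu1 hk1
        have e : C * (v ^ 3)⁻¹ * Real.exp (-(L / 8 * √n)) =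
            C * (u ^ 3)⁻¹ * (((n : ℝ) * Real.log n) ^ 3 * Real.exp (-(L / 8 * √n))) := by
          rw [hv, div_pow, inv_div]; ring
        calc u ^ k * |h v| * φ v ^ (n - 1) ≤ u * M * (C * (u ^ 3)⁻¹ * 1) := by
              gcongr
              · exact hM v hvpos
              · refine hp1.trans ?_
                rw [e]; gcongr
          _ = M * C * (u ^ 2)⁻¹ := by field_simp
          _ ≤ M * C * (2 * (1 + u ^ 2)⁻¹) := by
              gcongr
              rw [← div_eq_mul_inv, le_div_iff₀ (by positivity), inv_mul_le_iff₀ (by positivity)]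
              nlinarith
          _ ≤ _ := by linarith
    · refine Integrable.add ?_ ?_
      · have := integrableOn_rpow_mul_exp_neg_mul_rpow (p := 1) (s := k) (b := L / 8)
          (by linarith) one_pos (by linarith)
        simp only [Real.rpow_one, neg_mul] at this
        exact this.const_mul M
      · exact (integrable_inv_one_add_sq.const_mul _).integrableOn
    · refine (ae_restrict_iff' measurableSet_Ioi).2 (Eventually.of_forall fun u hu => ?_)
      have hu : 0 < u := hu
      have hv : Tendsto (fun n : ℕ => u / ((n : ℝ) * Real.log n)) atTop
          (nhdsWithin 0 (Set.Ioi 0)) := by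
        refine tendsto_nhdsWithin_iff.2 ⟨hs.const_div_atTop u, ?_⟩
        filter_upwards [hs.eventually_gt_atTop 0] with n hn
        exact div_pos hu hn
      have hsc := aux_scale hφL hu
      refine ((hh.comp hv).const_mul (u ^ k)).mul ?_
      have h1 : Tendsto (fun n : ℕ => (1 + -(1 - φ (u / (n * Real.log n)))) ^ n) atTop
          (nhds (Real.exp (-(L * u)))) := by
        apply Real.tendsto_one_add_pow_exp_of_tendsto
        simp only [mul_neg]
        exact hsc.neg
      have h2 : Tendsto (fun n : ℕ => φ (u / (n * Real.log n))) atTop (nhds 1) := by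
        have h3 := hsc.div_atTop tendsto_natCast_atTop_atTop
        have h4 := (h3.const_sub 1)
        rw [sub_zero] at h4
        refine h4.congr' ?_
        filter_upwards [eventually_gt_atTop 0] with n hn
        have : (0:ℝ) < n := by exact_mod_cast hn
        field_simp
        ring
      have h5 := h1.div h2 one_ne_zero
      rw [div_one] at h5
      refine h5.congr' ?_
      filter_upwards [h2.eventually (lt_mem_nhds zero_lt_one), eventually_gt_atTop 0] with n hn hn0
      simp only [Pi.div_apply]
      rw [show (1 + -(1 - φ (u / (n * Real.log n)))) = φ (u / (n * Real.log n)) by ring]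
      obtain ⟨j, rfl⟩ : ∃ j, n = j + 1 := ⟨n - 1, by omega⟩
      rw [pow_succ, mul_div_assoc, div_self hn.ne']; simp
  have hval : (∫ u in Set.Ioi (0:ℝ), u ^ k * h0 * Real.exp (-(L * u))) =
      h0 * (Real.Gamma (k + 1) / L ^ (k + 1)) := by
    have := Real.integral_rpow_mul_exp_neg_mul_Ioi (a := k + 1) (r := L) (by linarith) hL
    rw [add_sub_cancel_right] at this
    calc _ = ∫ u in Set.Ioi (0:ℝ), h0 * (u ^ k * Real.exp (-(L * u))) := by
          congr 1; ext u; ring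
      _ = _ := by
          rw [integral_const_mul, this, Real.div_rpow zero_le_one hL.le, Real.one_rpow]; ring
  rw [← hval]
  refine key.congr' ?_
  filter_upwards [hs.eventually_gt_atTop 0] with n hn
  set s := (n:ℝ) * Real.log n
  have := integral_comp_mul_left_Ioi (fun t => (s * t) ^ k * h t * φ t ^ (n-1)) 0
    (inv_pos.2 hn)
  rw [mul_zero, inv_inv, smul_eq_mul] at this
  calc _ = ∫ u in Set.Ioi (0:ℝ), (s * (s⁻¹ * u)) ^ k * h (s⁻¹ * u) * φ (s⁻¹ * u) ^ (n-1) := by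
        congr 1; ext u
        rw [mul_inv_cancel_left₀ hn.ne', div_eq_inv_mul]
    _ = s * ∫ t in Set.Ioi (0:ℝ), (s * t) ^ k * h t * φ t ^ (n-1) := this
    _ = _ := by
        rw [Real.rpow_add hn, Real.rpow_one, mul_comm (s ^ k), mul_assoc s]
        congr 1
        rw [← integral_const_mul]
        refine setIntegral_congr_fun measurableSet_Ioi fun t ht => ?_
        have ht : 0 < t := ht
        rw [Real.mul_rpow hn.le ht.le]; ring

lemma aux_J {A t : ℝ} (hA : 0 < A) (ht : 0 < t) (htA : t * A < 1) :
    IntegrableOn (fun s => Real.exp (-(t * s)) / s) (Set.Ioi A) ∧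
    (∫ s in Set.Ioi A, Real.exp (-(t * s)) / s) ≤ Real.log (1 / t) - Real.log A + 1 ∧
    Real.log (1 / t) - Real.log A - 1 ≤ ∫ s in Set.Ioi A, Real.exp (-(t * s)) / s := by
  have hAt : A < 1 / t := by rw [lt_div_iff₀ ht]; linarith
  have hexp : ∀ a, IntegrableOn (fun s => Real.exp (-(t * s))) (Set.Ioi a) := fun a => by
    simpa [neg_mul] using integrableOn_exp_mul_Ioi (a := -t) (by linarith) a
  have hcont : ContinuousOn (fun s : ℝ => Real.exp (-(t * s)) / s) (Set.Ioi 0) := by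
    apply ContinuousOn.div (by fun_prop) (by fun_prop)
    intro s hs; exact (ne_of_gt hs)
  have hint : IntegrableOn (fun s => Real.exp (-(t * s)) / s) (Set.Ioi A) := by
    refine Integrable.mono' ((hexp A).div_const A)
      ((hcont.mono (Set.Ioi_subset_Ioi hA.le)).aestronglyMeasurable measurableSet_Ioi) ?_
    refine (ae_restrict_iff' measurableSet_Ioi).2 (Eventually.of_forall fun s hs => ?_)
    have hs : A < s := hs
    have : 0 < s := hA.trans hs
    rw [Real.norm_of_nonneg (by positivity)]
    gcongr
  have hsplit : (∫ s in Set.Ioi A, Real.exp (-(t * s)) / s) =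
      (∫ s in Set.Ioc A (1/t), Real.exp (-(t * s)) / s) +
      ∫ s in Set.Ioi (1/t), Real.exp (-(t * s)) / s := by
    rw [← setIntegral_union (Set.Ioc_disjoint_Ioi le_rfl) measurableSet_Ioi
      (hint.mono_set Set.Ioc_subset_Ioi_self) (hint.mono_set (Set.Ioi_subset_Ioi hAt.le)),
      Set.Ioc_union_Ioi_eq_Ioi hAt.le]
  have hone : IntegrableOn (fun s : ℝ => 1 / s) (Set.Ioc A (1/t)) := by
    have : ContinuousOn (fun s : ℝ => 1 / s) (Set.Icc A (1/t)) := by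
      apply ContinuousOn.div (by fun_prop) (by fun_prop)
      intro s hs; exact (ne_of_gt (hA.trans_le hs.1))
    exact this.integrableOn_Icc.mono_set Set.Ioc_subset_Icc_self
  have hlogv : (∫ s in Set.Ioc A (1/t), 1 / s) = Real.log (1 / t) - Real.log A := by
    rw [← intervalIntegral.integral_of_le hAt.le, integral_one_div_of_pos hA (by positivity),
      Real.log_div (by positivity) hA.ne']
  refine ⟨hint, ?_, ?_⟩
  · rw [hsplit, ← hlogv]
    refine add_le_add ?_ ?_
    · refine setIntegral_mono_on (hint.mono_set Set.Ioc_subset_Ioi_self) hone measurableSet_Ioc ?_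
      intro s hs
      have : 0 < s := hA.trans hs.1
      gcongr
      exact Real.exp_le_one_iff.2 (by nlinarith)
    · calc (∫ s in Set.Ioi (1/t), Real.exp (-(t * s)) / s)
          ≤ ∫ s in Set.Ioi (1/t), t * Real.exp (-(t * s)) := by
            refine setIntegral_mono_on (hint.mono_set (Set.Ioi_subset_Ioi hAt.le))
              ((hexp _).const_mul t) measurableSet_Ioi ?_
            intro s hs
            have hs' : 1 / t < s := hs
            have h1 : 0 < s := lt_trans (by positivity) hs'
            rw [div_lt_iff₀ ht] at hs'
            rw [div_le_iff₀ h1]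
            nlinarith [Real.exp_pos (-(t * s))]
        _ = Real.exp (-1) := by
            rw [integral_const_mul]
            have := integral_exp_mul_Ioi (a := -t) (by linarith) (1/t)
            simp only [neg_mul] at this
            rw [this]; field_simp
        _ ≤ 1 := Real.exp_le_one_iff.2 (by norm_num)
  · rw [hsplit]
    have h2 : 0 ≤ ∫ s in Set.Ioi (1/t), Real.exp (-(t * s)) / s := by
      refine setIntegral_nonneg measurableSet_Ioi fun s hs => ?_
      have hs' : 1 / t < s := hs
      have h1 : 0 < s := lt_trans (by positivity) hs'
      positivity
    have h3 : (∫ s in Set.Ioc A (1/t), (1 / s - t)) ≤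
        ∫ s in Set.Ioc A (1/t), Real.exp (-(t * s)) / s := by
      refine setIntegral_mono_on (hone.sub (by simp [IntegrableOn]))
        (hint.mono_set Set.Ioc_subset_Ioi_self) measurableSet_Ioc ?_
      intro s hs
      have : 0 < s := hA.trans hs.1
      have h4 := Real.add_one_le_exp (-(t * s))
      rw [le_div_iff₀ this]
      have : (1 / s - t) * s = 1 - t * s := by field_simp
      linarith
    have h5 : (∫ s in Set.Ioc A (1/t), (1 / s - t)) = Real.log (1 / t) - Real.log A - (1/t - A) * t := by
      rw [integral_sub hone (by simp), hlogv]
      simp [measureReal_def]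
      left; simpa using hAt.le
    have h6 : (1/t - A) * t ≤ 1 := by
      have : 1 / t * t = 1 := by field_simp
      nlinarith
    linarith

/-- Abelian theorem -/
lemma aux_abel {G : ℝ → ℝ} {L : ℝ} (hG : Measurable G) (hG0 : ∀ s, 0 ≤ G s) (hG1 : ∀ s, G s ≤ 1)
    (hGL : Tendsto (fun s => s * G s) atTop (nhds L)) :
    Tendsto (fun t => (∫ s in Set.Ioi (0:ℝ), G s * Real.exp (-(t * s))) / Real.log (1 / t))
      (nhdsWithin 0 (Set.Ioi 0)) (nhds L) := by
  have hlog : Tendsto (fun t : ℝ => Real.log (1 / t)) (nhdsWithin 0 (Set.Ioi 0)) atTop := by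
    simp only [one_div]
    exact Real.tendsto_log_atTop.comp tendsto_inv_nhdsGT_zero
  rw [Metric.tendsto_nhds]
  intro ε hε
  have hev := (Metric.tendsto_nhds.1 hGL) (ε/2) (by linarith)
  obtain ⟨A, hA⟩ := (hev.and (eventually_ge_atTop 1)).exists_forall_of_atTop
  have hA0 : 0 < A := by have := (hA A le_rfl).2; linarith
  -- constants
  set K := A + (|L| + ε) * (|Real.log A| + 1) with hK
  have hsm : Tendsto (fun t : ℝ => K / Real.log (1 / t)) (nhdsWithin 0 (Set.Ioi 0)) (nhds 0) :=
    hlog.const_div_atTop K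
  have htA : ∀ᶠ t in nhdsWithin (0:ℝ) (Set.Ioi 0), t * A < 1 := by
    have : Tendsto (fun t : ℝ => t * A) (nhdsWithin 0 (Set.Ioi 0)) (nhds (0 * A)) :=
      (tendsto_id.mono_left nhdsWithin_le_nhds).mul_const A
    rw [zero_mul] at this
    exact this.eventually (gt_mem_nhds one_pos)
  filter_upwards [hsm.eventually (gt_mem_nhds (show 0 < ε/2 by linarith)), htA,
    hlog.eventually_gt_atTop 0, self_mem_nhdsWithin] with t h1 h2 h3 ht
  have ht : 0 < t := ht
  obtain ⟨hJi, hJu, hJl⟩ := aux_J hA0 ht h2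
  set J := ∫ s in Set.Ioi A, Real.exp (-(t * s)) / s
  have hexp : IntegrableOn (fun s => Real.exp (-(t * s))) (Set.Ioi 0) := by
    simpa [neg_mul] using integrableOn_exp_mul_Ioi (a := -t) (by linarith) 0
  have hint : IntegrableOn (fun s => G s * Real.exp (-(t * s))) (Set.Ioi 0) := by
    refine Integrable.mono' hexp (by fun_prop) (Eventually.of_forall fun s => ?_)
    rw [Real.norm_of_nonneg (mul_nonneg (hG0 s) (Real.exp_pos _).le)]
    nlinarith [hG1 s, Real.exp_pos (-(t * s))]
  have hsplit : (∫ s in Set.Ioi 0, G s * Real.exp (-(t * s))) =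
      (∫ s in Set.Ioc 0 A, G s * Real.exp (-(t * s))) +
      ∫ s in Set.Ioi A, G s * Real.exp (-(t * s)) := by
    rw [← setIntegral_union (Set.Ioc_disjoint_Ioi le_rfl) measurableSet_Ioi
      (hint.mono_set Set.Ioc_subset_Ioi_self) (hint.mono_set (Set.Ioi_subset_Ioi hA0.le)),
      Set.Ioc_union_Ioi_eq_Ioi hA0.le]
  have hi0 : 0 ≤ ∫ s in Set.Ioc 0 A, G s * Real.exp (-(t * s)) :=
    setIntegral_nonneg measurableSet_Ioc fun s _ => mul_nonneg (hG0 s) (Real.exp_pos _).le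
  have hi1 : (∫ s in Set.Ioc 0 A, G s * Real.exp (-(t * s))) ≤ A := by
    calc _ ≤ ∫ s in Set.Ioc 0 A, (1:ℝ) := by
          refine setIntegral_mono_on (hint.mono_set Set.Ioc_subset_Ioi_self)
            (by simp [IntegrableOn]) measurableSet_Ioc fun s hs => ?_
          have : Real.exp (-(t * s)) ≤ 1 := Real.exp_le_one_iff.2 (by nlinarith [hs.1])
          nlinarith [hG1 s, Real.exp_pos (-(t * s)), hG0 s]
      _ = A := by simp [hA0.le]
  have hdiff : |(∫ s in Set.Ioi A, G s * Real.exp (-(t * s))) - L * J| ≤ ε / 2 * J := by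
    rw [← integral_const_mul, ← integral_const_mul,
      ← integral_sub (hint.mono_set (Set.Ioi_subset_Ioi hA0.le)) (hJi.const_mul L)]
    rw [← Real.norm_eq_abs]
    refine norm_integral_le_of_norm_le (hJi.const_mul _) ?_
    refine (ae_restrict_iff' measurableSet_Ioi).2 (Eventually.of_forall fun s hs => ?_)
    have hs : A < s := hs
    have hs0 : 0 < s := hA0.trans hs
    have h7 := (hA s hs.le).1
    rw [Real.dist_eq] at h7
    have : G s * Real.exp (-(t * s)) - L * (Real.exp (-(t * s)) / s) =
      (s * G s - L) * (Real.exp (-(t * s)) / s) := by field_simp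
    rw [this, norm_mul, Real.norm_eq_abs, Real.norm_of_nonneg (by positivity)]
    gcongr
  have hJd : |J - Real.log (1 / t)| ≤ |Real.log A| + 1 := by
    rw [abs_le]
    have := neg_abs_le (Real.log A)
    have := le_abs_self (Real.log A)
    constructor <;> linarith
  rw [Real.dist_eq, hsplit]
  set P := ∫ s in Set.Ioc 0 A, G s * Real.exp (-(t * s))
  set Q := ∫ s in Set.Ioi A, G s * Real.exp (-(t * s))
  set ℓ := Real.log (1 / t)
  have : (P + Q) / ℓ - L = (P + Q - L * ℓ) / ℓ := by field_simp
  rw [this, abs_div, abs_of_pos h3, div_lt_iff₀ h3]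
  rw [div_lt_iff₀ h3] at h1
  have e : P + Q - L * ℓ = P + (Q - L * J) + L * (J - ℓ) := by ring
  have hLJ : |L * (J - ℓ)| ≤ |L| * (|Real.log A| + 1) := by
    rw [abs_mul]; gcongr
  have hJu' : J ≤ ℓ + (|Real.log A| + 1) := by
    have := (abs_le.1 hJd).2; linarith
  have ha : 0 ≤ |Real.log A| := abs_nonneg _
  calc |P + Q - L * ℓ| ≤ |P| + |Q - L * J| + |L * (J - ℓ)| := by
        rw [e]; exact abs_add_three _ _ _
    _ ≤ A + ε / 2 * J + |L| * (|Real.log A| + 1) := by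
        rw [abs_of_nonneg hi0]; gcongr
    _ ≤ A + ε / 2 * (ℓ + (|Real.log A| + 1)) + |L| * (|Real.log A| + 1) := by gcongr
    _ ≤ K + ε / 2 * ℓ := by rw [hK]; nlinarith
    _ < ε * ℓ := by linarith

/-- the kernel `T y = ‖x-y‖^{-d}` -/
def hT (d : ℕ) (x y : Euc d) : ℝ := ‖x - y‖ ^ (-(d : ℝ))

lemma hT_nonneg (d : ℕ) (x y : Euc d) : 0 ≤ hT d x y := Real.rpow_nonneg (norm_nonneg _) _

lemma hT_meas (d : ℕ) (x : Euc d) : Measurable (hT d x) := by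
  unfold hT; fun_prop

lemma hT_pos (d : ℕ) {x y : Euc d} (h : y ≠ x) : 0 < hT d x y :=
  Real.rpow_pos_of_pos (norm_pos_iff.2 (sub_ne_zero.2 h.symm)) _

lemma unitBallVol_pos (d : ℕ) : 0 < unitBallVol d := by
  unfold unitBallVol
  have : 0 < Real.Gamma ((d : ℝ) / 2 + 1) := Real.Gamma_pos_of_pos (by positivity)
  positivity

lemma aux_vol (d : ℕ) (hd : 1 ≤ d) (x : Euc d) {r : ℝ} (hr : 0 ≤ r) :
    (volume (Metric.ball x r)) = ENNReal.ofReal (r ^ d * unitBallVol d) := by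
  have : Nonempty (Fin d) := ⟨⟨0, hd⟩⟩
  rw [EuclideanSpace.volume_ball, ENNReal.ofReal_mul (by positivity), ENNReal.ofReal_pow hr]
  simp only [Fintype.card_fin]
  have : √Real.pi ^ d / Real.Gamma ((d:ℝ) / 2 + 1) = unitBallVol d := by
    rw [unitBallVol, Real.sqrt_eq_rpow, ← Real.rpow_natCast, ← Real.rpow_mul Real.pi_pos.le]
    congr 2; ring
  rw [this]

lemma aux_level (d : ℕ) (hd : 1 ≤ d) (x : Euc d) {s : ℝ} (hs : 0 < s) :
    {y | s < hT d x y} = Metric.ball x (s ^ (-(1 / (d:ℝ)))) \ {x} := by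
  have hd' : (0:ℝ) < d := by exact_mod_cast hd
  ext y
  simp only [Set.mem_ofPred_eq, Set.mem_sdiff, Metric.mem_ball, Set.mem_singleton_iff]
  by_cases hy : y = x
  · subst hy
    simp [hT, Real.zero_rpow (neg_ne_zero.2 hd'.ne'), hs.le]
  · have hn : 0 < ‖x - y‖ := norm_pos_iff.2 (sub_ne_zero.2 (Ne.symm hy))
    simp only [hy, not_false_eq_true, and_true, hT]
    rw [dist_comm, dist_eq_norm]
    have e : s = (s ^ (-(1 / (d:ℝ)))) ^ (-(d:ℝ)) := by
      rw [← Real.rpow_mul hs.le]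
      have : -(1 / (d:ℝ)) * -(d:ℝ) = 1 := by field_simp
      rw [this, Real.rpow_one]
    have hr : 0 < s ^ (-(1 / (d:ℝ))) := Real.rpow_pos_of_pos hs _
    conv_lhs => rw [e]
    rw [Real.rpow_lt_rpow_iff_of_neg hr hn (by linarith)]

/-- the tail function -/
def hG (d : ℕ) (x : Euc d) (ρ : Euc d → ℝ) (s : ℝ) : ℝ := ∫ y in {y | s < hT d x y}, ρ y

/-- Laplace transform of `T`. -/
def hphi (d : ℕ) (x : Euc d) (ρ : Euc d → ℝ) (t : ℝ) : ℝ := ∫ y, Real.exp (-(t * hT d x y)) * ρ y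

lemma aux_tail (d : ℕ) (hd : 1 ≤ d) (x : Euc d) (ρ : Euc d → ℝ) (hρi : Integrable ρ)
    (hρc : ContinuousAt ρ x) :
    Tendsto (fun s => s * hG d x ρ s) atTop (nhds (unitBallVol d * ρ x)) := by
  have hd' : (0:ℝ) < d := by exact_mod_cast hd
  have hV := unitBallVol_pos d
  have : Nonempty (Fin d) := ⟨⟨0, hd⟩⟩
  have : Nontrivial (Euc d) := inferInstance
  rw [Metric.tendsto_nhds]
  intro ε hε
  obtain ⟨δ, hδ, hδc⟩ := Metric.continuousAt_iff.1 hρc (ε / (2 * unitBallVol d)) (by positivity)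
  have hr0 : Tendsto (fun s : ℝ => s ^ (-(1 / (d:ℝ)))) atTop (nhds 0) :=
    tendsto_rpow_neg_atTop (by positivity)
  filter_upwards [hr0.eventually (gt_mem_nhds hδ), eventually_gt_atTop 0] with s hs hs0
  set r := s ^ (-(1 / (d:ℝ))) with hr
  have hrpos : 0 < r := Real.rpow_pos_of_pos hs0 _
  have hrd : r ^ d = s⁻¹ := by
    rw [hr, ← Real.rpow_natCast, ← Real.rpow_mul hs0.le]
    have : -(1 / (d:ℝ)) * (d:ℝ) = -1 := by field_simp
    rw [this, Real.rpow_neg_one]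
  have e1 : hG d x ρ s = ∫ y in Metric.ball x r, ρ y := by
    rw [hG, aux_level d hd x hs0]
    exact setIntegral_congr_set (sdiff_null_ae_eq_self (by simp))
  have hvol : volume.real (Metric.ball x r) = s⁻¹ * unitBallVol d := by
    rw [measureReal_def, aux_vol d hd x hrpos.le, hrd, ENNReal.toReal_ofReal (by positivity)]
  have hfin : volume (Metric.ball x r) < ⊤ := by
    rw [aux_vol d hd x hrpos.le]; exact ENNReal.ofReal_lt_top
  have hb : ‖∫ y in Metric.ball x r, (ρ y - ρ x)‖ ≤ ε / (2 * unitBallVol d) * volume.real (Metric.ball x r) := by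
    refine norm_setIntegral_le_of_norm_le_const hfin fun y hy => ?_
    have := hδc (lt_trans (Metric.mem_ball.1 hy) hs)
    rw [dist_eq_norm] at this
    exact this.le
  rw [integral_sub hρi.integrableOn (integrableOn_const hfin.ne), setIntegral_const, hvol,
    ← e1, smul_eq_mul] at hb
  have e2 : s * hG d x ρ s - unitBallVol d * ρ x = s * (hG d x ρ s - s⁻¹ * unitBallVol d * ρ x) := by
    field_simp
  rw [Real.dist_eq, e2, abs_mul, abs_of_pos hs0]
  calc s * |hG d x ρ s - s⁻¹ * unitBallVol d * ρ x|
      ≤ s * (ε / (2 * unitBallVol d) * (s⁻¹ * unitBallVol d)) := by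
        gcongr; exact hb
    _ = ε / 2 := by field_simp
    _ < ε := by linarith

lemma hG_anti (d : ℕ) (x : Euc d) (ρ : Euc d → ℝ) (hρ0 : ∀ y, 0 ≤ ρ y) (hρi : Integrable ρ) :
    Antitone (hG d x ρ) := by
  intro a b hab
  refine setIntegral_mono_set hρi.integrableOn (Eventually.of_forall hρ0) ?_
  exact LE.le.eventuallyLE fun y (hy : b < _) => lt_of_le_of_lt hab hy

lemma hG_nonneg (d : ℕ) (x : Euc d) (ρ : Euc d → ℝ) (hρ0 : ∀ y, 0 ≤ ρ y) (s : ℝ) :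
    0 ≤ hG d x ρ s := integral_nonneg hρ0

lemma hG_le (d : ℕ) (x : Euc d) (ρ : Euc d → ℝ) (hρ0 : ∀ y, 0 ≤ ρ y) (hρi : Integrable ρ)
    (hρ1 : ∫ y, ρ y = 1) (s : ℝ) : hG d x ρ s ≤ 1 := by
  rw [← hρ1]; exact setIntegral_le_integral hρi (Eventually.of_forall hρ0)

lemma aux_phi_int (d : ℕ) (x : Euc d) (ρ : Euc d → ℝ) (hρi : Integrable ρ) {t : ℝ} (ht : 0 ≤ t) :
    Integrable (fun y => Real.exp (-(t * hT d x y)) * ρ y) := by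
  refine hρi.bdd_mul (c := 1) ?_ (Eventually.of_forall fun y => ?_)
  · have := hT_meas d x; exact (by fun_prop : Measurable _).aestronglyMeasurable
  · rw [Real.norm_of_nonneg (Real.exp_pos _).le]
    exact Real.exp_le_one_iff.2 (by nlinarith [hT_nonneg d x y])

lemma aux_layer (d : ℕ) (x : Euc d) (ρ : Euc d → ℝ) (hρm : Measurable ρ) (hρ0 : ∀ y, 0 ≤ ρ y)
    (hρi : Integrable ρ)
    (hρ1 : ∫ y, ρ y = 1) {t : ℝ} (ht : 0 < t) :
    1 - hphi d x ρ t = t * ∫ s in Set.Ioi (0:ℝ), hG d x ρ s * Real.exp (-(t * s)) := by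
  set μ : Measure (Euc d) := volume.withDensity (fun y => ENNReal.ofReal (ρ y)) with hμ
  have hTm := hT_meas d x
  have hlc := lintegral_comp_eq_lintegral_meas_lt_mul μ (f := hT d x)
    (g := fun s => t * Real.exp (-(t * s))) (Eventually.of_forall (hT_nonneg d x))
    hTm.aemeasurable (fun _ _ => by apply Continuous.intervalIntegrable; fun_prop)
    (Eventually.of_forall fun s => by positivity)
  have hin : ∀ y, (∫ s in (0:ℝ)..hT d x y, t * Real.exp (-(t * s))) = 1 - Real.exp (-(t * hT d x y)) := by
    intro y
    have : ∀ s ∈ Set.uIcc 0 (hT d x y), HasDerivAt (fun s => - Real.exp (-(t * s)))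
        (t * Real.exp (-(t * s))) s := by
      intro s _
      have h1 : HasDerivAt (fun s : ℝ => -(t * s)) (-(t * 1)) s := ((hasDerivAt_id s).const_mul t).neg
      have := h1.exp.neg
      exact this.congr_deriv (by ring)
    rw [intervalIntegral.integral_eq_sub_of_hasDerivAt this (by apply Continuous.intervalIntegrable; fun_prop)]
    simp only [mul_zero, neg_zero, Real.exp_zero]; ring
  simp only [hin] at hlc
  have hE := aux_phi_int d x ρ hρi ht.le
  have hL : ∫⁻ y, ENNReal.ofReal (1 - Real.exp (-(t * hT d x y))) ∂μ =
      ENNReal.ofReal (1 - hphi d x ρ t) := by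
    rw [hμ, lintegral_withDensity_eq_lintegral_mul _ (by fun_prop) (by fun_prop)]
    have : 1 - hphi d x ρ t = ∫ y, ρ y * (1 - Real.exp (-(t * hT d x y))) := by
      have h := integral_sub hρi hE
      rw [hρ1] at h
      rw [hphi, ← h]; congr 1; ext y; ring
    rw [this, ofReal_integral_eq_lintegral_ofReal]
    · refine lintegral_congr fun y => ?_
      simp only [Pi.mul_apply]
      rw [ENNReal.ofReal_mul (hρ0 y)]
    · refine (hρi.sub hE).congr (Eventually.of_forall fun y => ?_)
      simp only [Pi.sub_apply]; ring
    · refine Eventually.of_forall fun y => mul_nonneg (hρ0 y) ?_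
      have : Real.exp (-(t * hT d x y)) ≤ 1 := Real.exp_le_one_iff.2 (by nlinarith [hT_nonneg d x y])
      linarith
  have hms : ∀ s, MeasurableSet {y | s < hT d x y} := fun s => measurableSet_lt measurable_const hTm
  have hR : ∫⁻ s in Set.Ioi (0:ℝ), μ {a | s < hT d x a} * ENNReal.ofReal (t * Real.exp (-(t * s))) =
      ENNReal.ofReal (t * ∫ s in Set.Ioi (0:ℝ), hG d x ρ s * Real.exp (-(t * s))) := by
    have hexp : IntegrableOn (fun s => Real.exp (-(t * s))) (Set.Ioi 0) := by
      simpa [neg_mul] using integrableOn_exp_mul_Ioi (a := -t) (by linarith) 0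
    have hGm := (hG_anti d x ρ hρ0 hρi).measurable
    have hint : IntegrableOn (fun s => hG d x ρ s * Real.exp (-(t * s))) (Set.Ioi 0) := by
      refine Integrable.mono' hexp (by fun_prop) (Eventually.of_forall fun s => ?_)
      rw [Real.norm_of_nonneg (mul_nonneg (hG_nonneg d x ρ hρ0 s) (Real.exp_pos _).le)]
      nlinarith [hG_le d x ρ hρ0 hρi hρ1 s, Real.exp_pos (-(t * s))]
    rw [← integral_const_mul, ofReal_integral_eq_lintegral_ofReal (hint.const_mul t)]
    · refine lintegral_congr fun s => ?_
      rw [hμ, withDensity_apply _ (hms s), ← ofReal_integral_eq_lintegral_ofReal hρi.integrableOn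
        (Eventually.of_forall hρ0), ← ENNReal.ofReal_mul (integral_nonneg hρ0)]
      congr 1; rw [hG]; ring
    · refine Eventually.of_forall fun s => ?_
      have := hG_nonneg d x ρ hρ0 s
      simp only [Pi.zero_apply]; positivity
  rw [hL, hR] at hlc
  have hn1 : 0 ≤ 1 - hphi d x ρ t := by
    have : hphi d x ρ t ≤ 1 := by
      rw [hphi, ← hρ1]
      refine integral_mono hE hρi fun y => ?_
      have : Real.exp (-(t * hT d x y)) ≤ 1 := Real.exp_le_one_iff.2 (by nlinarith [hT_nonneg d x y])
      nlinarith [hρ0 y]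
    linarith
  have hn2 : 0 ≤ t * ∫ s in Set.Ioi (0:ℝ), hG d x ρ s * Real.exp (-(t * s)) :=
    mul_nonneg ht.le (integral_nonneg fun s => mul_nonneg (hG_nonneg d x ρ hρ0 s) (Real.exp_pos _).le)
  rwa [ENNReal.ofReal_eq_ofReal_iff hn1 hn2] at hlc

lemma aux_phi_asymp (d : ℕ) (hd : 1 ≤ d) (x : Euc d) (ρ : Euc d → ℝ) (hρm : Measurable ρ)
    (hρ0 : ∀ y, 0 ≤ ρ y) (hρi : Integrable ρ)
    (hρ1 : ∫ y, ρ y = 1) (hρc : ContinuousAt ρ x) :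
    Tendsto (fun t => (1 - hphi d x ρ t) / (t * Real.log (1 / t))) (nhdsWithin 0 (Set.Ioi 0))
      (nhds (unitBallVol d * ρ x)) := by
  refine (aux_abel (hG_anti d x ρ hρ0 hρi).measurable (hG_nonneg d x ρ hρ0)
    (hG_le d x ρ hρ0 hρi hρ1) (aux_tail d hd x ρ hρi hρc)).congr' ?_
  filter_upwards [self_mem_nhdsWithin] with t ht
  have ht : 0 < t := ht
  rw [aux_layer d x ρ hρm hρ0 hρi hρ1 ht, mul_div_mul_left _ _ ht.ne']

lemma hphi_nonneg (d : ℕ) (x : Euc d) (ρ : Euc d → ℝ) (hρ0 : ∀ y, 0 ≤ ρ y) (t : ℝ) :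
    0 ≤ hphi d x ρ t := integral_nonneg fun y => mul_nonneg (Real.exp_pos _).le (hρ0 y)

lemma hphi_anti (d : ℕ) (x : Euc d) (ρ : Euc d → ℝ) (hρ0 : ∀ y, 0 ≤ ρ y) (hρi : Integrable ρ) :
    AntitoneOn (hphi d x ρ) (Set.Ioi 0) := by
  intro a ha b hb hab
  refine integral_mono (aux_phi_int d x ρ hρi (le_of_lt hb)) (aux_phi_int d x ρ hρi (le_of_lt ha))
    fun y => ?_
  have := hρ0 y
  have := hT_nonneg d x y
  dsimp only
  gcongr

lemma hphi_meas (d : ℕ) (x : Euc d) (ρ : Euc d → ℝ) (hρm : Measurable ρ) :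
    Measurable (hphi d x ρ) := by
  have := hT_meas d x
  exact (StronglyMeasurable.integral_prod_right
    (f := fun t y => Real.exp (-(t * hT d x y)) * ρ y)
    (by apply Measurable.stronglyMeasurable; unfold Function.uncurry; fun_prop)).measurable

lemma aux_exp_rpow {u q : ℝ} (hu : 0 ≤ u) (hq0 : 0 ≤ q) (hq1 : q ≤ 1) :
    u ^ q * Real.exp (-u) ≤ 1 := by
  rw [Real.exp_neg, ← div_eq_mul_inv, div_le_one (Real.exp_pos _)]
  have h1 := Real.add_one_le_exp u
  refine le_trans ?_ h1
  rcases le_total u 1 with h | h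
  · have := Real.rpow_le_one hu h hq0; linarith
  · have : u ^ q ≤ u := by simpa using Real.rpow_le_rpow_of_exponent_le h hq1
    linarith

lemma hphi_decay (d : ℕ) (hd : 1 ≤ d) (x : Euc d) (ρ : Euc d → ℝ)
    (hρ0 : ∀ y, 0 ≤ ρ y) (hρi : Integrable ρ) (hρm : Measurable ρ)
    (hρ_var : Integrable (fun y => ρ y * ‖y‖ ^ 2)) :
    ∃ C, ∀ t, 0 < t → hphi d x ρ t ^ (3 * d) ≤ C * (t ^ 3)⁻¹ := by
  have hd' : (1:ℝ) ≤ d := by exact_mod_cast hd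
  have hint : Integrable (fun y => ‖x - y‖ * ρ y) := by
    refine Integrable.mono' (((hρi.const_mul (‖x‖ + 1))).add hρ_var)
      (by fun_prop) (Eventually.of_forall fun y => ?_)
    have := hρ0 y
    rw [Real.norm_of_nonneg (by positivity)]
    simp only [Pi.add_apply]
    have h1 := norm_sub_le x y
    have h2 : ‖y‖ ≤ 1 + ‖y‖ ^ 2 := by nlinarith [sq_nonneg (‖y‖ - 1), norm_nonneg y]
    nlinarith
  refine ⟨(∫ y, ‖x - y‖ * ρ y) ^ (3 * d), fun t ht => ?_⟩
  have hb : hphi d x ρ t ≤ t ^ (-(1 / (d:ℝ))) * ∫ y, ‖x - y‖ * ρ y := by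
    rw [hphi, ← integral_const_mul]
    refine integral_mono_ae (aux_phi_int d x ρ hρi ht.le) (hint.const_mul _) ?_
    have : Nonempty (Fin d) := ⟨⟨0, hd⟩⟩
    have : Nontrivial (Euc d) := inferInstance
    have hne : ∀ᵐ y : Euc d, y ≠ x := by
      rw [ae_iff]; simp
    filter_upwards [hne] with y hy
    have hTp := hT_pos d hy
    have hn : 0 < ‖x - y‖ := norm_pos_iff.2 (sub_ne_zero.2 (Ne.symm hy))
    have h1 := aux_exp_rpow (u := t * hT d x y) (q := 1 / (d:ℝ)) (by positivity) (by positivity)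
      (by rw [div_le_one (by linarith)]; exact hd')
    have h2 : (t * hT d x y) ^ (1 / (d:ℝ)) = t ^ (1 / (d:ℝ)) * ‖x - y‖⁻¹ := by
      rw [Real.mul_rpow ht.le hTp.le, hT, ← Real.rpow_mul hn.le]
      have : -(d:ℝ) * (1 / (d:ℝ)) = -1 := by field_simp
      rw [this, Real.rpow_neg_one]
    rw [h2] at h1
    have htp : 0 < t ^ (1 / (d:ℝ)) := Real.rpow_pos_of_pos ht _
    rw [Real.rpow_neg ht.le, ← mul_assoc]
    refine mul_le_mul_of_nonneg_right ?_ (hρ0 y)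
    rw [inv_mul_eq_div, le_div_iff₀ htp]
    rw [mul_assoc, mul_comm, mul_assoc, inv_mul_le_iff₀ hn] at h1
    linarith
  calc hphi d x ρ t ^ (3 * d) ≤ (t ^ (-(1 / (d:ℝ))) * ∫ y, ‖x - y‖ * ρ y) ^ (3 * d) :=
        pow_le_pow_left₀ (hphi_nonneg d x ρ hρ0 t) hb _
    _ = _ := by
        rw [mul_pow, mul_comm]; congr 1
        rw [← Real.rpow_natCast, ← Real.rpow_mul ht.le]
        have : -(1 / (d:ℝ)) * ((3 * d : ℕ) : ℝ) = -((3:ℕ):ℝ) := by push_cast; field_simp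
        rw [this, Real.rpow_neg ht.le, Real.rpow_natCast]

lemma aux_near (d : ℕ) (hd : 1 ≤ d) (x : Euc d) (R a : ℝ) (ha : a < d) :
    Integrable ((Metric.ball x R).indicator (fun y => ‖x - y‖ ^ (-a))) := by
  have h : IntegrableOn (fun y : Euc d => ‖y‖ ^ (-a)) (Metric.ball 0 R) := by
    refine integrableOn_ball_of_norm_le_rpow (C := 1) (α := a) (by simpa using hd)
      (by simpa using ha) ?_ (Measurable.aestronglyMeasurable (by fun_prop))
    refine Eventually.of_forall fun y => ?_
    rw [one_mul, Real.norm_of_nonneg (Real.rpow_nonneg (norm_nonneg _) _)]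
  have h2 := (h.integrable_indicator measurableSet_ball).comp_sub_left x
  refine h2.congr (Eventually.of_forall fun y => ?_)
  simp only [Set.indicator, Metric.mem_ball, dist_zero_right]
  rw [dist_comm, dist_eq_norm]

lemma aux_f (d : ℕ) (hd : 1 ≤ d)
    (ρ : Euc d → ℝ) (hρ_meas : Measurable ρ) (hρ_nonneg : ∀ y, 0 ≤ ρ y)
    (hρi : Integrable ρ)
    (x : Euc d) (hx : x ∈ interior {y | 0 < ρ y}) (hρ_cont : ContinuousAt ρ x)
    (f : Euc d → ℝ) (hf_meas : Measurable f)
    (hf_growth : Integrable (fun y => ρ y * f y ^ 2 / (1 + ‖y‖ ^ (2 * (d : ℝ)))))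
    (αx Kx δx : ℝ) (hαx : 0 < αx) (hKx : 0 < Kx) (hδx : 0 < δx)
    (hf_holder : ∀ x', 0 < ρ x' → ‖x - x'‖ ≤ δx → |f x - f x'| ≤ Kx * ‖x - x'‖ ^ αx) :
    Integrable (fun y => hT d x y * (f y - f x) * ρ y) ∧
    ∃ (β : ℝ) (N F : Euc d → ℝ), 0 < β ∧ β ≤ 1 ∧ Integrable N ∧ Integrable F ∧
      ∀ t, 0 < t → ∀ y,
        t * (hT d x y ^ 2 * (f y - f x) ^ 2 * Real.exp (-(t * hT d x y)) * ρ y) ≤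
          t ^ β * N y + t * F y := by
  have hd' : (1:ℝ) ≤ d := by exact_mod_cast hd
  have hTm := hT_meas d x
  -- the radius
  obtain ⟨R1, hR1, hR1s⟩ := Metric.isOpen_iff.1 isOpen_interior x hx
  obtain ⟨R2, hR2, hR2s⟩ := Metric.continuousAt_iff.1 hρ_cont 1 one_pos
  obtain ⟨R, hR, hRR1, hRR2, hRδ⟩ : ∃ R, 0 < R ∧ R ≤ R1 ∧ R ≤ R2 ∧ R ≤ δx :=
    ⟨min R1 (min R2 δx), by positivity, min_le_left _ _,
      (min_le_right _ _).trans (min_le_left _ _), (min_le_right _ _).trans (min_le_right _ _)⟩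
  have hnear : ∀ y ∈ Metric.ball x R, ρ y ≤ ρ x + 1 ∧ |f y - f x| ≤ Kx * ‖x - y‖ ^ αx := by
    intro y hy
    have hy' : dist y x < R := hy
    have h1 : 0 < ρ y := by
      have := interior_subset (hR1s (Metric.ball_subset_ball hRR1 hy)); exact this
    have h2 := hR2s (hy'.trans_le hRR2)
    rw [Real.dist_eq] at h2
    refine ⟨by linarith [(abs_lt.1 h2).2], ?_⟩
    rw [abs_sub_comm]
    refine hf_holder y h1 ?_
    rw [← dist_eq_norm, dist_comm]; linarith
  -- far part
  set c : ℝ := R ^ (-(2 * (d:ℝ))) + (‖x‖ / R + 1) ^ (2 * (d:ℝ)) with hc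
  have hfar : ∀ y ∈ (Metric.ball x R)ᶜ, hT d x y ^ 2 * (f y - f x) ^ 2 * ρ y ≤
      2 * c * (ρ y * f y ^ 2 / (1 + ‖y‖ ^ (2 * (d : ℝ)))) +
        2 * R ^ (-(2 * (d:ℝ))) * f x ^ 2 * ρ y := by
    intro y hy
    have hr : R ≤ ‖x - y‖ := by
      rw [← dist_eq_norm, dist_comm]; simpa using hy
    have hrpos : 0 < ‖x - y‖ := hR.trans_le hr
    have hT2 : hT d x y ^ 2 = ‖x - y‖ ^ (-(2 * (d:ℝ))) := by
      rw [hT, ← Real.rpow_natCast, ← Real.rpow_mul hrpos.le]; congr 1; push_cast; ring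
    have hTR : hT d x y ^ 2 ≤ R ^ (-(2 * (d:ℝ))) := by
      rw [hT2]; exact Real.rpow_le_rpow_of_nonpos hR hr (by linarith)
    have hTc : hT d x y ^ 2 * (1 + ‖y‖ ^ (2 * (d : ℝ))) ≤ c := by
      rw [mul_add, mul_one, hc]
      refine add_le_add hTR ?_
      have hy1 : ‖y‖ ≤ (‖x‖ / R + 1) * ‖x - y‖ := by
        have h1 : ‖y‖ ≤ ‖x‖ + ‖x - y‖ := by
          have := norm_sub_le x (x - y); simpa using this
        have h2 : ‖x‖ ≤ ‖x‖ / R * ‖x - y‖ := by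
          rw [div_mul_eq_mul_div, le_div_iff₀ hR]
          exact mul_le_mul_of_nonneg_left hr (norm_nonneg _)
        linarith
      calc hT d x y ^ 2 * ‖y‖ ^ (2 * (d : ℝ)) ≤
          hT d x y ^ 2 * ((‖x‖ / R + 1) * ‖x - y‖) ^ (2 * (d : ℝ)) := by
            gcongr
        _ = (‖x‖ / R + 1) ^ (2 * (d:ℝ)) := by
            rw [Real.mul_rpow (by positivity) hrpos.le, hT2, mul_left_comm, ← Real.rpow_add hrpos]
            simp
    have hden : 0 < 1 + ‖y‖ ^ (2 * (d : ℝ)) := by positivity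
    have hg : (f y - f x) ^ 2 ≤ 2 * f y ^ 2 + 2 * f x ^ 2 := by nlinarith [sq_nonneg (f y + f x)]
    have hT2n : 0 ≤ hT d x y ^ 2 := sq_nonneg _
    have hρy := hρ_nonneg y
    have hA : hT d x y ^ 2 * (f y ^ 2 * ρ y) ≤ c * (ρ y * f y ^ 2 / (1 + ‖y‖ ^ (2 * (d : ℝ)))) := by
      rw [mul_div_assoc', le_div_iff₀ hden]
      calc _ = (hT d x y ^ 2 * (1 + ‖y‖ ^ (2 * (d : ℝ)))) * (ρ y * f y ^ 2) := by ring
        _ ≤ c * (ρ y * f y ^ 2) := by gcongr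
    have hB : hT d x y ^ 2 * (f x ^ 2 * ρ y) ≤ R ^ (-(2 * (d:ℝ))) * (f x ^ 2 * ρ y) := by gcongr
    calc hT d x y ^ 2 * (f y - f x) ^ 2 * ρ y ≤ hT d x y ^ 2 * (2 * f y ^ 2 + 2 * f x ^ 2) * ρ y := by
          gcongr
      _ = 2 * (hT d x y ^ 2 * (f y ^ 2 * ρ y)) + 2 * (hT d x y ^ 2 * (f x ^ 2 * ρ y)) := by ring
      _ ≤ _ := by linarith
  have hFint : Integrable ((Metric.ball x R)ᶜ.indicator
      (fun y => hT d x y ^ 2 * (f y - f x) ^ 2 * ρ y)) := by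
    rw [integrable_indicator_iff measurableSet_ball.compl]
    refine Integrable.mono' ((hf_growth.const_mul (2 * c)).add
      (hρi.const_mul (2 * R ^ (-(2 * (d:ℝ))) * f x ^ 2))).integrableOn (by fun_prop) ?_
    refine (ae_restrict_iff' measurableSet_ball.compl).2 (Eventually.of_forall fun y hy => ?_)
    have := hρ_nonneg y
    rw [Real.norm_of_nonneg (by positivity)]
    exact hfar y hy
  have hTpow : ∀ y, y ≠ x → ∀ a b : ℝ, hT d x y ^ a * ‖x - y‖ ^ b = ‖x - y‖ ^ (-(d * a - b)) := by
    intro y hy a b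
    have hn : 0 < ‖x - y‖ := norm_pos_iff.2 (sub_ne_zero.2 (Ne.symm hy))
    rw [hT, ← Real.rpow_mul hn.le, ← Real.rpow_add hn]; congr 1; ring
  have hT0 : hT d x x = 0 := by
    simp [hT, Real.zero_rpow (show (-(d:ℝ)) ≠ 0 by linarith)]
  have hρx : 0 ≤ ρ x := hρ_nonneg x
  refine ⟨?_, ?_⟩
  · -- integrability of T g ρ
    have hN := aux_near d hd x R (d * 1 - αx) (by linarith)
    refine Integrable.mono' ((hN.const_mul (Kx * (ρ x + 1))).add (hρi.add hFint)) (by fun_prop) ?_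
    refine Eventually.of_forall fun y => ?_
    have hρy := hρ_nonneg y
    have hTy := hT_nonneg d x y
    rw [norm_mul, norm_mul, Real.norm_of_nonneg hTy, Real.norm_of_nonneg hρy, Real.norm_eq_abs]
    simp only [Pi.add_apply]
    by_cases hyx : y = x
    · subst hyx
      rw [hT0]
      simp only [zero_mul]
      refine add_nonneg (mul_nonneg (by positivity) (Set.indicator_nonneg (fun z _ => by positivity) _))
        (add_nonneg hρy (Set.indicator_nonneg (fun z _ => ?_) _))
      have := hρ_nonneg z
      positivity
    by_cases hy : y ∈ Metric.ball x R
    · rw [Set.indicator_of_mem hy, Set.indicator_of_notMem (by simpa using hy)]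
      obtain ⟨h1, h2⟩ := hnear y hy
      rw [← hTpow y hyx 1 αx, Real.rpow_one]
      calc hT d x y * |f y - f x| * ρ y ≤ hT d x y * (Kx * ‖x - y‖ ^ αx) * (ρ x + 1) := by gcongr
        _ = Kx * (ρ x + 1) * (hT d x y * ‖x - y‖ ^ αx) := by ring
        _ ≤ _ := by linarith
    · rw [Set.indicator_of_notMem hy, Set.indicator_of_mem (by simpa using hy)]
      have : hT d x y * |f y - f x| ≤ 1 + hT d x y ^ 2 * (f y - f x) ^ 2 := by
        rw [← sq_abs (f y - f x)]
        nlinarith [sq_nonneg (hT d x y * |f y - f x| - 1), mul_nonneg hTy (abs_nonneg (f y - f x))]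
      nlinarith
  · refine ⟨min 1 (αx / d), fun y => Kx ^ 2 * (ρ x + 1) * (Metric.ball x R).indicator
      (fun y => ‖x - y‖ ^ (-(d * (1 + min 1 (αx / d)) - 2 * αx))) y, _, by positivity,
      min_le_left _ _, ?_, hFint, ?_⟩
    · refine (aux_near d hd x R _ ?_).const_mul _
      have : min 1 (αx / d) ≤ αx / d := min_le_right _ _
      have h2 : d * min 1 (αx / d) ≤ d * (αx / d) := by gcongr
      rw [mul_div_cancel₀ _ (by linarith)] at h2
      linarith
    · intro t ht y
      set β := min 1 (αx / d)
      have hβ0 : 0 < β := by positivity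
      have hβ1 : β ≤ 1 := min_le_left _ _
      have hρy := hρ_nonneg y
      by_cases hyx : y = x
      · subst hyx
        rw [hT0]
        simp only [ne_eq, OfNat.ofNat_ne_zero, not_false_eq_true, zero_pow, zero_mul, mul_zero]
        refine add_nonneg (mul_nonneg (by positivity) (mul_nonneg (by positivity)
          (Set.indicator_nonneg (fun z _ => by positivity) _)))
          (mul_nonneg ht.le (Set.indicator_nonneg (fun z _ => ?_) _))
        have := hρ_nonneg z
        positivity
      have hTy := hT_pos d hyx
      beta_reduce
      by_cases hy : y ∈ Metric.ball x R
      · rw [Set.indicator_of_mem hy, Set.indicator_of_notMem (by simpa using hy)]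
        obtain ⟨h1, h2⟩ := hnear y hy
        rw [← hTpow y hyx]
        have hg2 : (f y - f x) ^ 2 ≤ Kx ^ 2 * ‖x - y‖ ^ (2 * αx) := by
          rw [← sq_abs, mul_comm 2 αx, Real.rpow_mul (norm_nonneg _)]
          rw [show ((2:ℝ)) = ((2:ℕ):ℝ) by norm_num, Real.rpow_natCast, ← mul_pow]
          gcongr
        have hu := aux_exp_rpow (u := t * hT d x y) (q := 1 - β) (by positivity) (by linarith)
          (by linarith)
        have e1 : t * hT d x y ^ 2 = t ^ β * hT d x y ^ (1 + β) * (t * hT d x y) ^ (1 - β) := by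
          rw [Real.mul_rpow ht.le hTy.le]
          have a1 : t ^ β * t ^ (1 - β) = t := by rw [← Real.rpow_add ht]; simp
          have a2 : hT d x y ^ (1 + β) * hT d x y ^ (1 - β) = hT d x y ^ 2 := by
            rw [← Real.rpow_add hTy, ← Real.rpow_natCast]; congr 1; push_cast; ring
          calc _ = (t ^ β * t ^ (1 - β)) * (hT d x y ^ (1 + β) * hT d x y ^ (1 - β)) := by rw [a1, a2]
            _ = _ := by ring
        calc t * (hT d x y ^ 2 * (f y - f x) ^ 2 * Real.exp (-(t * hT d x y)) * ρ y)
            = t ^ β * hT d x y ^ (1 + β) * ((t * hT d x y) ^ (1 - β) * Real.exp (-(t * hT d x y)))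
                * (f y - f x) ^ 2 * ρ y := by
              calc _ = (t * hT d x y ^ 2) * ((f y - f x) ^ 2 * Real.exp (-(t * hT d x y)) * ρ y) := by
                    ring
                _ = _ := by rw [e1]; ring
          _ ≤ t ^ β * hT d x y ^ (1 + β) * 1 * (Kx ^ 2 * ‖x - y‖ ^ (2 * αx)) * (ρ x + 1) := by
              gcongr
          _ = _ := by ring
      · rw [Set.indicator_of_notMem hy, Set.indicator_of_mem (by simpa using hy)]
        have : Real.exp (-(t * hT d x y)) ≤ 1 := Real.exp_le_one_iff.2 (by nlinarith)
        rw [mul_zero, mul_zero, zero_add]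
        refine mul_le_mul_of_nonneg_left ?_ ht.le
        calc hT d x y ^ 2 * (f y - f x) ^ 2 * Real.exp (-(t * hT d x y)) * ρ y
            ≤ hT d x y ^ 2 * (f y - f x) ^ 2 * 1 * ρ y := by gcongr
          _ = _ := by ring

lemma aux_kappa (d : ℕ) (ρ : Euc d → ℝ) (hρm : Measurable ρ) (x : Euc d)
    (g : Euc d → ℝ) (hg : Measurable g)
    (hi : Integrable (fun y => hT d x y * g y * ρ y)) :
    Measurable (fun t : ℝ => ∫ y, hT d x y * g y * Real.exp (-(t * hT d x y)) * ρ y) ∧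
    (∀ t, 0 < t → Integrable (fun y => hT d x y * g y * Real.exp (-(t * hT d x y)) * ρ y)) ∧
    (∀ t, 0 < t → |∫ y, hT d x y * g y * Real.exp (-(t * hT d x y)) * ρ y| ≤
      ∫ y, |hT d x y * g y * ρ y|) ∧
    Tendsto (fun t : ℝ => ∫ y, hT d x y * g y * Real.exp (-(t * hT d x y)) * ρ y)
      (nhdsWithin 0 (Set.Ioi 0)) (nhds (∫ y, hT d x y * g y * ρ y)) := by
  have hTm := hT_meas d x
  have hb : ∀ t, 0 < t → ∀ y, ‖hT d x y * g y * Real.exp (-(t * hT d x y)) * ρ y‖ ≤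
      |hT d x y * g y * ρ y| := by
    intro t ht y
    have : Real.exp (-(t * hT d x y)) ≤ 1 := Real.exp_le_one_iff.2 (by nlinarith [hT_nonneg d x y])
    rw [show hT d x y * g y * Real.exp (-(t * hT d x y)) * ρ y =
      Real.exp (-(t * hT d x y)) * (hT d x y * g y * ρ y) by ring, norm_mul,
      Real.norm_of_nonneg (Real.exp_pos _).le, Real.norm_eq_abs]
    nlinarith [abs_nonneg (hT d x y * g y * ρ y)]
  refine ⟨?_, ?_, ?_, ?_⟩
  · exact (StronglyMeasurable.integral_prod_right
      (f := fun (t : ℝ) y => hT d x y * g y * Real.exp (-(t * hT d x y)) * ρ y)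
      (by apply Measurable.stronglyMeasurable; unfold Function.uncurry; fun_prop)).measurable
  · intro t ht
    exact Integrable.mono' hi.abs (by fun_prop) (Eventually.of_forall (hb t ht))
  · intro t ht
    rw [← Real.norm_eq_abs]
    exact norm_integral_le_of_norm_le hi.abs (Eventually.of_forall (hb t ht))
  · refine tendsto_integral_filter_of_dominated_convergence (fun y => |hT d x y * g y * ρ y|)
      (Eventually.of_forall fun t => by fun_prop) ?_ hi.abs (Eventually.of_forall fun y => ?_)
    · filter_upwards [self_mem_nhdsWithin] with t ht
      exact Eventually.of_forall (hb t ht)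
    · have : Continuous (fun t : ℝ => hT d x y * g y * Real.exp (-(t * hT d x y)) * ρ y) := by
        fun_prop
      have h2 := (this.tendsto 0).mono_left (nhdsWithin_le_nhds (s := Set.Ioi 0))
      simpa using h2

lemma aux_prod1 {n : ℕ} (P : Fin (n+1) → ℝ) (i : Fin (n+1)) {a b : ℝ} (hi : P i = a)
    (h : ∀ l, l ≠ i → P l = b) : ∏ l, P l = a * b ^ n := by
  rw [← Finset.mul_prod_erase Finset.univ P (Finset.mem_univ i), hi,
    Finset.prod_congr rfl (fun l hl => h l (Finset.ne_of_mem_erase hl))]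
  simp

lemma aux_prod2 {n : ℕ} (P : Fin (n+1) → ℝ) {i j : Fin (n+1)} (hij : i ≠ j) {a b : ℝ}
    (hi : P i = a) (hj : P j = a)
    (h : ∀ l, l ≠ i → l ≠ j → P l = b) : ∏ l, P l = a ^ 2 * b ^ (n - 1) := by
  rw [← Finset.mul_prod_erase Finset.univ P (Finset.mem_univ i), hi,
    ← Finset.mul_prod_erase _ P (show j ∈ Finset.univ.erase i by simp [hij.symm]), hj,
    Finset.prod_congr rfl (fun l hl => h l
      (Finset.ne_of_mem_erase (Finset.mem_of_mem_erase hl)) (Finset.ne_of_mem_erase hl)),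
    Finset.prod_const, Finset.card_erase_of_mem (by simp [hij.symm]),
    Finset.card_erase_of_mem (by simp), Finset.card_univ, Fintype.card_fin, ← mul_assoc, pow_two]
  rfl

lemma aux_fub (d n k : ℕ) (x : Euc d) (ρ : Euc d → ℝ) (hρm : Measurable ρ) (hρ0 : ∀ y, 0 ≤ ρ y)
    (A : Fin (n+1) → Euc d → ℝ) (hA : ∀ j, Measurable (A j))
    (hAi : ∀ j, ∀ t, 0 < t → Integrable (fun y => A j y * Real.exp (-(t * hT d x y)) * ρ y))
    (hint : IntegrableOn (fun t : ℝ => t ^ k * ∏ j, ∫ y, |A j y| * Real.exp (-(t * hT d x y)) * ρ y)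
      (Set.Ioi 0)) :
    Integrable (fun xs : Fin (n+1) → Euc d => ∫ t in Set.Ioi (0:ℝ),
      t ^ k * ∏ j, (A j (xs j) * Real.exp (-(t * hT d x (xs j))) * ρ (xs j))) ∧
    (∫ xs : Fin (n+1) → Euc d, ∫ t in Set.Ioi (0:ℝ),
      t ^ k * ∏ j, (A j (xs j) * Real.exp (-(t * hT d x (xs j))) * ρ (xs j))) =
    ∫ t in Set.Ioi (0:ℝ), t ^ k * ∏ j, ∫ y, A j y * Real.exp (-(t * hT d x y)) * ρ y := by
  have hTm := hT_meas d x
  have hm : AEStronglyMeasurable (Function.uncurry (fun (xs : Fin (n+1) → Euc d) (t : ℝ) =>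
      t ^ k * ∏ j, (A j (xs j) * Real.exp (-(t * hT d x (xs j))) * ρ (xs j))))
      ((volume : Measure (Fin (n+1) → Euc d)).prod (volume.restrict (Set.Ioi (0:ℝ)))) := by
    apply Measurable.aestronglyMeasurable
    unfold Function.uncurry
    fun_prop
  have hI : Integrable (Function.uncurry (fun (xs : Fin (n+1) → Euc d) (t : ℝ) =>
      t ^ k * ∏ j, (A j (xs j) * Real.exp (-(t * hT d x (xs j))) * ρ (xs j))))
      ((volume : Measure (Fin (n+1) → Euc d)).prod (volume.restrict (Set.Ioi (0:ℝ)))) := by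
    rw [integrable_prod_iff' hm]
    refine ⟨?_, ?_⟩
    · refine (ae_restrict_iff' measurableSet_Ioi).2 (Eventually.of_forall fun t ht => ?_)
      simp only [Function.uncurry]
      exact (Integrable.fintype_prod (f := fun j y => A j y * Real.exp (-(t * hT d x y)) * ρ y)
        (fun j => hAi j t ht)).const_mul _
    · refine hint.congr ?_
      refine (ae_restrict_iff' measurableSet_Ioi).2 (Eventually.of_forall fun t ht => ?_)
      have ht : 0 < t := ht
      simp only [Function.uncurry]
      rw [← integral_fintype_prod_volume_eq_prod (fun j y => |A j y| * Real.exp (-(t * hT d x y)) * ρ y),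
        ← integral_const_mul]
      congr 1; ext xs
      rw [norm_mul, Real.norm_of_nonneg (by positivity), norm_prod]
      congr 1
      refine Finset.prod_congr rfl fun j _ => ?_
      rw [norm_mul, norm_mul, Real.norm_of_nonneg (hρ0 _), Real.norm_of_nonneg (Real.exp_pos _).le,
        Real.norm_eq_abs]
  refine ⟨hI.integral_prod_left, ?_⟩
  rw [integral_integral_swap hI]
  congr 1; ext t
  rw [integral_const_mul,
    integral_fintype_prod_volume_eq_prod (fun j y => A j y * Real.exp (-(t * hT d x y)) * ρ y)]

lemma aux_Spos (d n : ℕ) (hd : 1 ≤ d) (x : Euc d) :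
    ∀ᵐ xs : Fin (n+1) → Euc d, 0 < ∑ j, hT d x (xs j) := by
  have : Nonempty (Fin d) := ⟨⟨0, hd⟩⟩
  have : Nontrivial (Euc d) := inferInstance
  have hne : ∀ᵐ y : Euc d, y ≠ x := by
    rw [ae_iff]; simp
  have h2 : ∀ᵐ xs : Fin (n+1) → Euc d, xs 0 ≠ x :=
    (Measure.quasiMeasurePreserving_eval (fun _ : Fin (n+1) => (volume : Measure (Euc d))) 0).ae hne
  filter_upwards [h2] with xs hxs
  exact Finset.sum_pos' (fun j _ => hT_nonneg d x _) ⟨0, Finset.mem_univ _, hT_pos d hxs⟩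

lemma aux_fub2 (d n k : ℕ) (hd : 1 ≤ d) (x : Euc d) (ρ : Euc d → ℝ) (hρm : Measurable ρ)
    (hρ0 : ∀ y, 0 ≤ ρ y)
    (A : Fin (n+1) → Euc d → ℝ) (hA : ∀ j, Measurable (A j))
    (hAi : ∀ j, ∀ t, 0 < t → Integrable (fun y => A j y * Real.exp (-(t * hT d x y)) * ρ y))
    (hint : IntegrableOn (fun t : ℝ => t ^ k * ∏ j, ∫ y, |A j y| * Real.exp (-(t * hT d x y)) * ρ y)
      (Set.Ioi 0)) (hk : k.factorial = 1) :
    Integrable (fun xs : Fin (n+1) → Euc d =>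
      (∏ j, A j (xs j)) / (∑ j, hT d x (xs j)) ^ (k + 1) * ∏ j, ρ (xs j)) ∧
    (∫ xs : Fin (n+1) → Euc d,
      (∏ j, A j (xs j)) / (∑ j, hT d x (xs j)) ^ (k + 1) * ∏ j, ρ (xs j)) =
    ∫ t in Set.Ioi (0:ℝ), t ^ k * ∏ j, ∫ y, A j y * Real.exp (-(t * hT d x y)) * ρ y := by
  obtain ⟨h1, h2⟩ := aux_fub d n k x ρ hρm hρ0 A hA hAi hint
  have hae : (fun xs : Fin (n+1) → Euc d => ∫ t in Set.Ioi (0:ℝ),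
      t ^ k * ∏ j, (A j (xs j) * Real.exp (-(t * hT d x (xs j))) * ρ (xs j))) =ᵐ[volume]
      (fun xs : Fin (n+1) → Euc d =>
      (∏ j, A j (xs j)) / (∑ j, hT d x (xs j)) ^ (k + 1) * ∏ j, ρ (xs j)) := by
    filter_upwards [aux_Spos d n hd x] with xs hS
    set S := ∑ j, hT d x (xs j) with hSd
    have hG := Real.integral_rpow_mul_exp_neg_mul_Ioi (a := (k:ℝ) + 1) (r := S) (by positivity) hS
    rw [Real.Gamma_nat_eq_factorial, hk, add_sub_cancel_right] at hG
    simp only [Real.rpow_natCast] at hG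
    have e : ∀ t : ℝ, t ^ k * ∏ j, (A j (xs j) * Real.exp (-(t * hT d x (xs j))) * ρ (xs j)) =
        ((∏ j, A j (xs j)) * ∏ j, ρ (xs j)) * (t ^ k * Real.exp (-(S * t))) := by
      intro t
      rw [Finset.prod_mul_distrib, Finset.prod_mul_distrib, ← Real.exp_sum, Finset.sum_neg_distrib,
        ← Finset.mul_sum, ← hSd, mul_comm S t]
      ring
    simp only [e]
    rw [integral_const_mul, hG]
    have : (1 / S) ^ ((k:ℝ) + 1) = 1 / S ^ (k + 1) := by
      rw [← Nat.cast_succ, Real.rpow_natCast, one_div_pow]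
    rw [this]; simp; ring
  exact ⟨h1.congr hae, by rw [← h2]; exact (integral_congr_ae hae).symm⟩

lemma aux_intphi {φ : ℝ → ℝ} {C k : ℝ} {m : ℕ} (hk0 : 0 ≤ k) (hk1 : k ≤ 1)
    (hφ0 : ∀ t, 0 < t → 0 ≤ φ t) (hφ1 : ∀ t, 0 < t → φ t ≤ 1) (hφm : Measurable φ)
    (hdecay : ∀ t, 0 < t → φ t ^ m ≤ C * (t ^ 3)⁻¹) {N : ℕ} (hN : m ≤ N) :
    IntegrableOn (fun t => t ^ k * φ t ^ N) (Set.Ioi 0) := by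
  have hC : 0 ≤ C := by
    have := hdecay 1 one_pos
    have h2 := pow_nonneg (hφ0 1 one_pos) m
    simp at this; linarith
  refine Integrable.mono' (integrable_inv_one_add_sq.const_mul (2 * (1 + C))).integrableOn
    (by fun_prop) ?_
  refine (ae_restrict_iff' measurableSet_Ioi).2 (Eventually.of_forall fun t ht => ?_)
  have ht : 0 < t := ht
  have h0 := hφ0 t ht
  rw [Real.norm_of_nonneg (by positivity), ← div_eq_mul_inv, le_div_iff₀ (by positivity)]
  rcases le_total t 1 with h | h
  · have h1 : t ^ k ≤ 1 := Real.rpow_le_one ht.le h hk0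
    have h2 : φ t ^ N ≤ 1 := pow_le_one₀ h0 (hφ1 t ht)
    calc t ^ k * φ t ^ N * (1 + t ^ 2) ≤ 1 * 1 * (1 + 1 ^ 2) := by gcongr
      _ ≤ _ := by nlinarith
  · have h1 : t ^ k ≤ t := by simpa using Real.rpow_le_rpow_of_exponent_le h hk1
    have h2 : φ t ^ N ≤ C * (t ^ 3)⁻¹ :=
      (pow_le_pow_of_le_one h0 (hφ1 t ht) hN).trans (hdecay t ht)
    calc t ^ k * φ t ^ N * (1 + t ^ 2) ≤ t * (C * (t ^ 3)⁻¹) * (t ^ 2 + t ^ 2) := by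
          gcongr
          nlinarith
      _ = 2 * C := by field_simp; ring
      _ ≤ _ := by nlinarith

/-- Laplace-type transform of `T g`. -/
def hK (d : ℕ) (x : Euc d) (ρ g : Euc d → ℝ) (t : ℝ) : ℝ :=
  ∫ y, hT d x y * g y * Real.exp (-(t * hT d x y)) * ρ y

/-- Laplace-type transform of `(T g)^2`. -/
def hH (d : ℕ) (x : Euc d) (ρ g : Euc d → ℝ) (t : ℝ) : ℝ :=
  ∫ y, hT d x y ^ 2 * g y ^ 2 * Real.exp (-(t * hT d x y)) * ρ y

lemma hphi_le_one (d : ℕ) (x : Euc d) (ρ : Euc d → ℝ) (hρ0 : ∀ y, 0 ≤ ρ y) (hρi : Integrable ρ)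
    (hρ1 : ∫ y, ρ y = 1) {t : ℝ} (ht : 0 < t) : hphi d x ρ t ≤ 1 := by
  calc hphi d x ρ t ≤ ∫ y, ρ y := by
        refine integral_mono (aux_phi_int d x ρ hρi ht.le) hρi fun y => ?_
        have : Real.exp (-(t * hT d x y)) ≤ 1 :=
          Real.exp_le_one_iff.2 (by nlinarith [hT_nonneg d x y])
        exact mul_le_of_le_one_left (hρ0 y) this
    _ = 1 := hρ1

lemma hphi_tendsto (d : ℕ) (x : Euc d) (ρ : Euc d → ℝ) (hρm : Measurable ρ) (hρi : Integrable ρ)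
    (hρ1 : ∫ y, ρ y = 1) :
    Tendsto (hphi d x ρ) (nhdsWithin 0 (Set.Ioi 0)) (nhds 1) := by
  have hTm := hT_meas d x
  rw [← hρ1]
  unfold hphi
  refine tendsto_integral_filter_of_dominated_convergence (fun y => ‖ρ y‖) ?_ ?_ hρi.norm ?_
  · exact Eventually.of_forall fun t => Measurable.aestronglyMeasurable (by fun_prop)
  · filter_upwards [self_mem_nhdsWithin] with t ht
    have ht : 0 < t := ht
    refine Eventually.of_forall fun y => ?_
    have : Real.exp (-(t * hT d x y)) ≤ 1 :=
      Real.exp_le_one_iff.2 (by nlinarith [hT_nonneg d x y])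
    rw [norm_mul, Real.norm_of_nonneg (Real.exp_pos _).le]
    exact mul_le_of_le_one_left (norm_nonneg _) this
  · refine Eventually.of_forall fun y => ?_
    have hc : Continuous (fun t : ℝ => Real.exp (-(t * hT d x y)) * ρ y) := by fun_prop
    have := hc.tendsto 0
    simp only [zero_mul, neg_zero, Real.exp_zero, one_mul] at this
    exact this.mono_left nhdsWithin_le_nhds

lemma hH_meas (d : ℕ) (x : Euc d) (ρ g : Euc d → ℝ) (hρm : Measurable ρ) (hg : Measurable g) :
    Measurable (hH d x ρ g) := by
  have := hT_meas d x
  exact (StronglyMeasurable.integral_prod_right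
    (f := fun t y => hT d x y ^ 2 * g y ^ 2 * Real.exp (-(t * hT d x y)) * ρ y)
    (by apply Measurable.stronglyMeasurable; unfold Function.uncurry; fun_prop)).measurable

lemma hH_nonneg (d : ℕ) (x : Euc d) (ρ g : Euc d → ℝ) (hρ0 : ∀ y, 0 ≤ ρ y) (t : ℝ) :
    0 ≤ hH d x ρ g t := integral_nonneg fun y => by
      have := hρ0 y
      positivity

lemma hH_int (d : ℕ) (x : Euc d) (ρ g : Euc d → ℝ) (hρm : Measurable ρ) (hg : Measurable g)
    (hρ0 : ∀ y, 0 ≤ ρ y)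
    {β : ℝ} {N F : Euc d → ℝ} (hN : Integrable N) (hF : Integrable F)
    (hb : ∀ t, 0 < t → ∀ y,
        t * (hT d x y ^ 2 * g y ^ 2 * Real.exp (-(t * hT d x y)) * ρ y) ≤
          t ^ β * N y + t * F y) {t : ℝ} (ht : 0 < t) :
    Integrable (fun y => hT d x y ^ 2 * g y ^ 2 * Real.exp (-(t * hT d x y)) * ρ y) ∧
    t * hH d x ρ g t ≤ t ^ β * (∫ y, N y) + t * ∫ y, F y := by
  have hTm := hT_meas d x
  have hI : Integrable (fun y => t * (hT d x y ^ 2 * g y ^ 2 * Real.exp (-(t * hT d x y)) * ρ y)) := by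
    refine Integrable.mono' ((hN.const_mul (t ^ β)).add (hF.const_mul t))
      (Measurable.aestronglyMeasurable (by fun_prop)) (Eventually.of_forall fun y => ?_)
    have := hρ0 y
    rw [Real.norm_of_nonneg (by positivity)]
    exact hb t ht y
  refine ⟨?_, ?_⟩
  · refine (hI.const_mul t⁻¹).congr (Eventually.of_forall fun y => ?_)
    field_simp
  · rw [hH, ← integral_const_mul, ← integral_const_mul, ← integral_const_mul,
      ← integral_add (hN.const_mul _) (hF.const_mul _)]
    exact integral_mono hI ((hN.const_mul (t ^ β)).add (hF.const_mul t)) (hb t ht)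

lemma hK_abs (d : ℕ) (x : Euc d) (ρ g : Euc d → ℝ) (hρm : Measurable ρ) (hg : Measurable g)
    (hρ0 : ∀ y, 0 ≤ ρ y)
    (hi : Integrable (fun y => hT d x y * g y * ρ y)) :
    ∃ M, 0 ≤ M ∧ Measurable (fun t => ∫ y, |hT d x y * g y| * Real.exp (-(t * hT d x y)) * ρ y) ∧
     ∀ t, 0 < t → |∫ y, |hT d x y * g y| * Real.exp (-(t * hT d x y)) * ρ y| ≤ M := by
  have e : ∀ y, |hT d x y * g y| = hT d x y * |g y| := fun y => by
    rw [abs_mul, abs_of_nonneg (hT_nonneg d x y)]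
  obtain ⟨h1, h2, h3, h4⟩ := aux_kappa d ρ hρm x (fun y => |g y|) hg.abs (by
    refine hi.abs.congr (Eventually.of_forall fun y => ?_)
    simp only
    rw [abs_mul, e, abs_of_nonneg (hρ0 y)])
  simp only [e]
  exact ⟨_, integral_nonneg fun y => abs_nonneg _, h1, h3⟩

lemma aux_mean_term (d n : ℕ) (hd : 1 ≤ d) (x : Euc d) (ρ g : Euc d → ℝ) (hρm : Measurable ρ)
    (hg : Measurable g) (hρ0 : ∀ y, 0 ≤ ρ y) (hρi : Integrable ρ) (hρ1 : ∫ y, ρ y = 1)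
    (hi : Integrable (fun y => hT d x y * g y * ρ y)) {C : ℝ} {m : ℕ}
    (hdecay : ∀ t, 0 < t → hphi d x ρ t ^ m ≤ C * (t ^ 3)⁻¹) (hmn : m ≤ n) (i : Fin (n+1)) :
    Integrable (fun xs : Fin (n+1) → Euc d =>
      (hT d x (xs i) * g (xs i)) / (∑ j, hT d x (xs j)) * ∏ j, ρ (xs j)) ∧
    (∫ xs : Fin (n+1) → Euc d,
      (hT d x (xs i) * g (xs i)) / (∑ j, hT d x (xs j)) * ∏ j, ρ (xs j)) =
    ∫ t in Set.Ioi (0:ℝ), hK d x ρ g t * hphi d x ρ t ^ n := by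
  have hTm := hT_meas d x
  obtain ⟨M, hM0, hMm, hM⟩ := hK_abs d x ρ g hρm hg hρ0 hi
  obtain ⟨k1, k2, k3, k4⟩ := aux_kappa d ρ hρm x g hg hi
  have hφ0 := hphi_nonneg d x ρ hρ0
  have key := aux_fub2 d n 0 hd x ρ hρm hρ0
    (fun l y => if l = i then hT d x y * g y else 1)
    (fun j => by by_cases h : j = i <;> simp only [h, if_true, if_false] <;> fun_prop)
    (fun j t ht => by
      by_cases h : j = i
      · simp only [h, if_true]; exact k2 t ht
      · simp only [h, if_false, one_mul]; exact aux_phi_int d x ρ hρi ht.le) ?_ rfl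
  · have e1 : ∀ xs : Fin (n+1) → Euc d,
        (∏ l, if l = i then hT d x (xs l) * g (xs l) else 1) = hT d x (xs i) * g (xs i) := by
      intro xs
      rw [aux_prod1 _ i (a := hT d x (xs i) * g (xs i)) (b := 1) (by simp)
        (fun l hl => by simp [hl])]
      simp
    have e2 : ∀ t, (∏ l, ∫ y, (if l = i then hT d x y * g y else 1) *
        Real.exp (-(t * hT d x y)) * ρ y) = hK d x ρ g t * hphi d x ρ t ^ n := by
      intro t
      exact aux_prod1 _ i (by simp [hK]) (fun l hl => by simp [hl, hphi])
    simpa only [e1, e2, zero_add, pow_one, pow_zero, one_mul] using key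
  · have e2 : ∀ t, (∏ l, ∫ y, |if l = i then hT d x y * g y else 1| *
        Real.exp (-(t * hT d x y)) * ρ y) =
        (∫ y, |hT d x y * g y| * Real.exp (-(t * hT d x y)) * ρ y) * hphi d x ρ t ^ n := by
      intro t
      exact aux_prod1 _ i (by simp) (fun l hl => by simp [hl, hphi])
    simp only [e2]
    have hφm := hphi_meas d x ρ hρm
    refine Integrable.mono' ((aux_intphi (k := 0) le_rfl zero_le_one (fun t _ => hφ0 t)
      (fun t ht => hphi_le_one d x ρ hρ0 hρi hρ1 ht) hφm hdecay hmn).const_mul M)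
      (Measurable.aestronglyMeasurable (by fun_prop)) ?_
    refine (ae_restrict_iff' measurableSet_Ioi).2 (Eventually.of_forall fun t ht => ?_)
    have := hM t ht
    have h0 := hφ0 t
    rw [pow_zero, one_mul, Real.rpow_zero, one_mul, norm_mul, Real.norm_eq_abs,
      Real.norm_of_nonneg (by positivity)]
    gcongr

lemma aux_diag_term (d n : ℕ) (hd : 1 ≤ d) (x : Euc d) (ρ g : Euc d → ℝ) (hρm : Measurable ρ)
    (hg : Measurable g) (hρ0 : ∀ y, 0 ≤ ρ y) (hρi : Integrable ρ) (hρ1 : ∫ y, ρ y = 1)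
    {β : ℝ} (hβ0 : 0 < β) (hβ1 : β ≤ 1) {N F : Euc d → ℝ} (hN : Integrable N) (hF : Integrable F)
    (hb : ∀ t, 0 < t → ∀ y,
        t * (hT d x y ^ 2 * g y ^ 2 * Real.exp (-(t * hT d x y)) * ρ y) ≤
          t ^ β * N y + t * F y) {C : ℝ} {m : ℕ}
    (hdecay : ∀ t, 0 < t → hphi d x ρ t ^ m ≤ C * (t ^ 3)⁻¹) (hmn : m ≤ n) (i : Fin (n+1)) :
    Integrable (fun xs : Fin (n+1) → Euc d =>
      (hT d x (xs i) ^ 2 * g (xs i) ^ 2) / (∑ j, hT d x (xs j)) ^ 2 * ∏ j, ρ (xs j)) ∧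
    (∫ xs : Fin (n+1) → Euc d,
      (hT d x (xs i) ^ 2 * g (xs i) ^ 2) / (∑ j, hT d x (xs j)) ^ 2 * ∏ j, ρ (xs j)) =
    ∫ t in Set.Ioi (0:ℝ), t * (hH d x ρ g t * hphi d x ρ t ^ n) := by
  have hTm := hT_meas d x
  have hφ0 := hphi_nonneg d x ρ hρ0
  have key := aux_fub2 d n 1 hd x ρ hρm hρ0
    (fun l y => if l = i then hT d x y ^ 2 * g y ^ 2 else 1)
    (fun j => by by_cases h : j = i <;> simp only [h, if_true, if_false] <;> fun_prop)
    (fun j t ht => by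
      by_cases h : j = i
      · simp only [h, if_true]; exact (hH_int d x ρ g hρm hg hρ0 hN hF hb ht).1
      · simp only [h, if_false, one_mul]; exact aux_phi_int d x ρ hρi ht.le) ?_ rfl
  · have e1 : ∀ xs : Fin (n+1) → Euc d,
        (∏ l, if l = i then hT d x (xs l) ^ 2 * g (xs l) ^ 2 else 1) =
          hT d x (xs i) ^ 2 * g (xs i) ^ 2 := by
      intro xs
      rw [aux_prod1 _ i (a := hT d x (xs i) ^ 2 * g (xs i) ^ 2) (b := 1) (by simp)
        (fun l hl => by simp [hl])]
      simp
    have e2 : ∀ t, (∏ l, ∫ y, (if l = i then hT d x y ^ 2 * g y ^ 2 else 1) *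
        Real.exp (-(t * hT d x y)) * ρ y) = hH d x ρ g t * hphi d x ρ t ^ n := by
      intro t
      exact aux_prod1 _ i (by simp [hH]) (fun l hl => by simp [hl, hphi])
    simpa only [e1, e2, one_add_one_eq_two, pow_one] using key
  · have e2 : ∀ t, (∏ l, ∫ y, |if l = i then hT d x y ^ 2 * g y ^ 2 else 1| *
        Real.exp (-(t * hT d x y)) * ρ y) = hH d x ρ g t * hphi d x ρ t ^ n := by
      intro t
      exact aux_prod1 _ i (by simp [hH]) (fun l hl => by simp [hl, hphi])
    simp only [e2]
    have hφm := hphi_meas d x ρ hρm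
    have hHm := hH_meas d x ρ g hρm hg
    have i1 : ∀ k : ℝ, 0 ≤ k → k ≤ 1 → IntegrableOn (fun t => t ^ k * hphi d x ρ t ^ n) (Set.Ioi 0) :=
      fun k h0 h1 => aux_intphi h0 h1 (fun t _ => hφ0 t)
      (fun t ht => hphi_le_one d x ρ hρ0 hρi hρ1 ht) hφm hdecay hmn
    refine Integrable.mono' (((i1 β hβ0.le hβ1).const_mul (∫ y, N y)).add
      ((i1 1 zero_le_one le_rfl).const_mul (∫ y, F y)))
      (Measurable.aestronglyMeasurable (by fun_prop)) ?_
    refine (ae_restrict_iff' measurableSet_Ioi).2 (Eventually.of_forall fun t ht => ?_)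
    have ht : 0 < t := ht
    have h1 := (hH_int d x ρ g hρm hg hρ0 hN hF hb ht).2
    have h0 := hφ0 t
    have h2 := hH_nonneg d x ρ g hρ0 t
    rw [Real.norm_of_nonneg (by positivity)]
    simp only [Pi.add_apply, Real.rpow_one, pow_one]
    calc t * (hH d x ρ g t * hphi d x ρ t ^ n) = (t * hH d x ρ g t) * hphi d x ρ t ^ n := by ring
      _ ≤ (t ^ β * (∫ y, N y) + t * ∫ y, F y) * hphi d x ρ t ^ n := by gcongr
      _ = _ := by ring

lemma aux_off_term (d n : ℕ) (hd : 1 ≤ d) (x : Euc d) (ρ g : Euc d → ℝ) (hρm : Measurable ρ)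
    (hg : Measurable g) (hρ0 : ∀ y, 0 ≤ ρ y) (hρi : Integrable ρ) (hρ1 : ∫ y, ρ y = 1)
    (hi : Integrable (fun y => hT d x y * g y * ρ y)) {C : ℝ} {m : ℕ}
    (hdecay : ∀ t, 0 < t → hphi d x ρ t ^ m ≤ C * (t ^ 3)⁻¹) (hmn : m ≤ n - 1)
    {i j : Fin (n+1)} (hij : i ≠ j) :
    Integrable (fun xs : Fin (n+1) → Euc d =>
      ((hT d x (xs i) * g (xs i)) * (hT d x (xs j) * g (xs j))) / (∑ j, hT d x (xs j)) ^ 2 *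
        ∏ j, ρ (xs j)) ∧
    (∫ xs : Fin (n+1) → Euc d,
      ((hT d x (xs i) * g (xs i)) * (hT d x (xs j) * g (xs j))) / (∑ j, hT d x (xs j)) ^ 2 *
        ∏ j, ρ (xs j)) =
    ∫ t in Set.Ioi (0:ℝ), t * (hK d x ρ g t ^ 2 * hphi d x ρ t ^ (n - 1)) := by
  have hTm := hT_meas d x
  obtain ⟨M, hM0, hMm, hM⟩ := hK_abs d x ρ g hρm hg hρ0 hi
  obtain ⟨k1, k2, k3, k4⟩ := aux_kappa d ρ hρm x g hg hi
  have hφ0 := hphi_nonneg d x ρ hρ0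
  have key := aux_fub2 d n 1 hd x ρ hρm hρ0
    (fun l y => if l = i ∨ l = j then hT d x y * g y else 1)
    (fun l => by
      by_cases h : l = i ∨ l = j
      · simp only [h, if_true]; fun_prop
      · simp only [h, if_false]; fun_prop)
    (fun l t ht => by
      by_cases h : l = i ∨ l = j
      · simp only [h, if_true]; exact k2 t ht
      · simp only [h, if_false, one_mul]; exact aux_phi_int d x ρ hρi ht.le) ?_ rfl
  · have e1 : ∀ xs : Fin (n+1) → Euc d,
        (∏ l, if l = i ∨ l = j then hT d x (xs l) * g (xs l) else 1) =
          (hT d x (xs i) * g (xs i)) * (hT d x (xs j) * g (xs j)) := by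
      intro xs
      rw [← Finset.mul_prod_erase Finset.univ _ (Finset.mem_univ i),
        ← Finset.mul_prod_erase _ _ (show j ∈ Finset.univ.erase i by simp [hij.symm]),
        Finset.prod_eq_one (fun l hl => ?_)]
      · simp
      · simp only [Finset.mem_erase] at hl
        simp [hl.1, hl.2.1]
    have e2 : ∀ t, (∏ l, ∫ y, (if l = i ∨ l = j then hT d x y * g y else 1) *
        Real.exp (-(t * hT d x y)) * ρ y) = hK d x ρ g t ^ 2 * hphi d x ρ t ^ (n - 1) := by
      intro t
      exact aux_prod2 _ hij (by simp [hK]) (by simp [hK]) (fun l hl hl' => by simp [hl, hl', hphi])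
    simpa only [e1, e2, one_add_one_eq_two, pow_one] using key
  · have e2 : ∀ t, (∏ l, ∫ y, |if l = i ∨ l = j then hT d x y * g y else 1| *
        Real.exp (-(t * hT d x y)) * ρ y) =
        (∫ y, |hT d x y * g y| * Real.exp (-(t * hT d x y)) * ρ y) ^ 2 * hphi d x ρ t ^ (n - 1) := by
      intro t
      exact aux_prod2 _ hij (by simp) (by simp) (fun l hl hl' => by simp [hl, hl', hphi])
    simp only [e2]
    have hφm := hphi_meas d x ρ hρm
    refine Integrable.mono' ((aux_intphi (k := 1) zero_le_one le_rfl (fun t _ => hφ0 t)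
      (fun t ht => hphi_le_one d x ρ hρ0 hρi hρ1 ht) hφm hdecay hmn).const_mul (M ^ 2))
      (Measurable.aestronglyMeasurable (by fun_prop)) ?_
    refine (ae_restrict_iff' measurableSet_Ioi).2 (Eventually.of_forall fun t ht => ?_)
    have ht : 0 < t := ht
    have := hM t ht
    have h0 := hφ0 t
    rw [Real.norm_of_nonneg (by positivity), ← sq_abs, pow_one, Real.rpow_one, mul_left_comm]
    gcongr

lemma aux_mean (d n : ℕ) (hd : 1 ≤ d) (x : Euc d) (ρ f : Euc d → ℝ) (hρm : Measurable ρ)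
    (hf : Measurable f) (hρ0 : ∀ y, 0 ≤ ρ y) (hρi : Integrable ρ) (hρ1 : ∫ y, ρ y = 1)
    (hi : Integrable (fun y => hT d x y * (f y - f x) * ρ y)) {C : ℝ} {m : ℕ}
    (hdecay : ∀ t, 0 < t → hphi d x ρ t ^ m ≤ C * (t ^ 3)⁻¹) (hmn : m ≤ n) :
    hilbertEstExp d n x ρ f - f x =
      ((n:ℝ) + 1) * ∫ t in Set.Ioi (0:ℝ), hK d x ρ (fun y => f y - f x) t * hphi d x ρ t ^ n := by
  have hg : Measurable (fun y => f y - f x) := by fun_prop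
  have key := aux_mean_term d n hd x ρ (fun y => f y - f x) hρm hg hρ0 hρi hρ1 hi hdecay hmn
  have hpi : Integrable (fun xs : Fin (n+1) → Euc d => ∏ j, ρ (xs j)) :=
    Integrable.fintype_prod (f := fun _ => ρ) (fun _ => hρi)
  have hp1 : ∫ xs : Fin (n+1) → Euc d, ∏ j, ρ (xs j) = 1 := by
    rw [integral_fintype_prod_volume_eq_prod (fun _ : Fin (n+1) => ρ)]
    simp [hρ1]
  have e : (fun xs : Fin (n+1) → Euc d => (∑ i : Fin (n + 1), hilbertWeight d n x xs i * f (xs i)) *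
      ∏ i : Fin (n + 1), ρ (xs i)) =ᵐ[volume] (fun xs => (∑ i : Fin (n+1),
        (hT d x (xs i) * (f (xs i) - f x)) / (∑ j, hT d x (xs j)) * ∏ j, ρ (xs j)) +
        f x * ∏ j, ρ (xs j)) := by
    filter_upwards [aux_Spos d n hd x] with xs hS
    rw [← Finset.sum_mul, ← add_mul]
    congr 1
    rw [← Finset.sum_div]
    simp only [hilbertWeight]
    simp only [← hT.eq_1 d x]
    rw [eq_comm, div_add' _ _ _ hS.ne', div_eq_iff hS.ne', Finset.sum_mul, Finset.mul_sum,
      ← Finset.sum_add_distrib]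
    refine Finset.sum_congr rfl fun i _ => ?_
    field_simp
    ring
  rw [hilbertEstExp, integral_congr_ae e, integral_add
    (integrable_finsetSum _ fun i _ => (key i).1) (hpi.const_mul _), integral_const_mul, hp1,
    integral_finsetSum _ fun i _ => (key i).1, Finset.sum_congr rfl fun i _ => (key i).2]
  simp

lemma aux_bias (d n : ℕ) (hd : 1 ≤ d) (x : Euc d) (ρ f : Euc d → ℝ) (hρm : Measurable ρ)
    (hf : Measurable f) (hρ0 : ∀ y, 0 ≤ ρ y) (hρi : Integrable ρ) (hρ1 : ∫ y, ρ y = 1)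
    (hi : Integrable (fun y => hT d x y * (f y - f x) * ρ y))
    {β : ℝ} (hβ0 : 0 < β) (hβ1 : β ≤ 1) {N F : Euc d → ℝ} (hN : Integrable N) (hF : Integrable F)
    (hb : ∀ t, 0 < t → ∀ y,
        t * (hT d x y ^ 2 * (f y - f x) ^ 2 * Real.exp (-(t * hT d x y)) * ρ y) ≤
          t ^ β * N y + t * F y) {C : ℝ} {m : ℕ}
    (hdecay : ∀ t, 0 < t → hphi d x ρ t ^ m ≤ C * (t ^ 3)⁻¹) (hmn : m ≤ n - 1) :
    hilbertBias d n x ρ f =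
      ((n:ℝ) + 1) * (∫ t in Set.Ioi (0:ℝ),
        t * (hH d x ρ (fun y => f y - f x) t * hphi d x ρ t ^ n)) +
      ((n:ℝ) + 1) * n * ∫ t in Set.Ioi (0:ℝ),
        t * (hK d x ρ (fun y => f y - f x) t ^ 2 * hphi d x ρ t ^ (n-1)) := by
  have hg : Measurable (fun y => f y - f x) := by fun_prop
  have kd := aux_diag_term d n hd x ρ (fun y => f y - f x) hρm hg hρ0 hρi hρ1 hβ0 hβ1 hN hF hb
    hdecay (hmn.trans (Nat.sub_le n 1))
  have ko := fun (i j : Fin (n+1)) (hij : i ≠ j) =>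
    aux_off_term d n hd x ρ (fun y => f y - f x) hρm hg hρ0 hρi hρ1 hi hdecay hmn hij
  set D := ∫ t in Set.Ioi (0:ℝ), t * (hH d x ρ (fun y => f y - f x) t * hphi d x ρ t ^ n)
  set O := ∫ t in Set.Ioi (0:ℝ),
        t * (hK d x ρ (fun y => f y - f x) t ^ 2 * hphi d x ρ t ^ (n-1))
  have key : ∀ i j : Fin (n+1), Integrable (fun xs : Fin (n+1) → Euc d =>
      ((hT d x (xs i) * (f (xs i) - f x)) * (hT d x (xs j) * (f (xs j) - f x))) /
        (∑ j, hT d x (xs j)) ^ 2 * ∏ j, ρ (xs j)) ∧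
      (∫ xs : Fin (n+1) → Euc d,
      ((hT d x (xs i) * (f (xs i) - f x)) * (hT d x (xs j) * (f (xs j) - f x))) /
        (∑ j, hT d x (xs j)) ^ 2 * ∏ j, ρ (xs j)) = O + if i = j then D - O else 0 := by
    intro i j
    by_cases hij : i = j
    · subst hij
      have e : ∀ y : Euc d, (hT d x y * (f y - f x)) * (hT d x y * (f y - f x)) =
        hT d x y ^ 2 * (f y - f x) ^ 2 := fun y => by ring
      simp only [e, if_true]
      refine ⟨(kd i).1, (kd i).2.trans (by ring)⟩
    · simp only [hij, if_false, add_zero]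
      exact ko i j hij
  have e : (fun xs : Fin (n+1) → Euc d =>
      (∑ i : Fin (n + 1), hilbertWeight d n x xs i * (f (xs i) - f x)) ^ 2 *
      ∏ i : Fin (n + 1), ρ (xs i)) = (fun xs => ∑ i : Fin (n+1), ∑ j : Fin (n+1),
       ((hT d x (xs i) * (f (xs i) - f x)) * (hT d x (xs j) * (f (xs j) - f x))) /
        (∑ j, hT d x (xs j)) ^ 2 * ∏ j, ρ (xs j)) := by
    ext xs
    simp only [← Finset.sum_mul]
    congr 1
    rw [pow_two, Finset.sum_mul_sum]
    refine Finset.sum_congr rfl fun i _ => Finset.sum_congr rfl fun j _ => ?_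
    simp only [hilbertWeight]
    simp only [← hT.eq_1 d x]
    ring
  rw [hilbertBias, e, integral_finsetSum _ fun i _ => integrable_finsetSum _ fun j _ => (key i j).1]
  rw [Finset.sum_congr rfl fun i _ => (integral_finsetSum _ fun j _ => (key i j).1).trans
    (Finset.sum_congr rfl fun j _ => (key i j).2)]
  simp [Finset.sum_add_distrib]
  ring

lemma aux_rate {k : ℝ} (hk : 0 < k) :
    Tendsto (fun n : ℕ => (Real.log n) ^ 2 * ((n:ℝ) + 1) / ((n:ℝ) * Real.log n) ^ (k + 1)) atTop
      (nhds 0) := by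
  have h1 : Tendsto (fun t : ℝ => Real.log t ^ (2:ℝ) / t ^ k) atTop (nhds 0) :=
    (isLittleO_log_rpow_rpow_atTop 2 hk).tendsto_div_nhds_zero
  have h2 := (h1.comp tendsto_natCast_atTop_atTop).const_mul 2
  rw [mul_zero] at h2
  refine squeeze_zero' ?_ ?_ h2
  · filter_upwards [eventually_ge_atTop 1] with n hn
    have : 0 ≤ Real.log n := Real.log_natCast_nonneg n
    positivity
  · filter_upwards [eventually_ge_atTop 3] with n hn
    have hn' : (3:ℝ) ≤ n := by exact_mod_cast hn
    have hl : 1 ≤ Real.log n := by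
      rw [Real.le_log_iff_exp_le (by linarith)]
      exact Real.exp_one_lt_d9.le.trans (by norm_num; linarith)
    have hn0 : (0:ℝ) < n := by linarith
    simp only [Function.comp]
    rw [Real.rpow_two]
    calc (Real.log n) ^ 2 * ((n:ℝ) + 1) / ((n:ℝ) * Real.log n) ^ (k + 1)
        ≤ (Real.log n) ^ 2 * (2 * n) / (n:ℝ) ^ (k + 1) := by
          gcongr
          · linarith
          · nlinarith
      _ = _ := by
          rw [Real.rpow_add hn0, Real.rpow_one]
          field_simp

lemma aux_np1 : Tendsto (fun n : ℕ => ((n:ℝ) + 1) / n) atTop (nhds 1) := by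
  have h := tendsto_one_div_atTop_nhds_zero_nat (𝕜 := ℝ)
  have h2 := h.const_add 1
  rw [add_zero] at h2
  refine h2.congr' ?_
  filter_upwards [eventually_ge_atTop 1] with n hn
  have : (0:ℝ) < n := by exact_mod_cast hn
  field_simp

lemma aux_ev_log : ∀ᶠ n : ℕ in atTop, (0:ℝ) < n ∧ 0 < Real.log n := by
  filter_upwards [eventually_ge_atTop 2] with n hn
  have : (2:ℝ) ≤ n := by exact_mod_cast hn
  exact ⟨by linarith, Real.log_pos (by linarith)⟩

lemma aux_main (d : ℕ) (hd : 1 ≤ d)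
    (ρ : Euc d → ℝ) (hρm : Measurable ρ) (hρ0 : ∀ y, 0 ≤ ρ y)
    (hρi : Integrable ρ) (hρ1 : (∫ y, ρ y) = 1)
    (hρ_var : Integrable (fun y => ρ y * ‖y‖ ^ 2))
    (x : Euc d) (hx : 0 < ρ x) (hρ_cont : ContinuousAt ρ x)
    (f : Euc d → ℝ) (hf : Measurable f)
    (hi : Integrable (fun y => hT d x y * (f y - f x) * ρ y))
    {β : ℝ} (hβ0 : 0 < β) (hβ1 : β ≤ 1) {N F : Euc d → ℝ} (hN : Integrable N) (hF : Integrable F)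
    (hb : ∀ t, 0 < t → ∀ y,
        t * (hT d x y ^ 2 * (f y - f x) ^ 2 * Real.exp (-(t * hT d x y)) * ρ y) ≤
          t ^ β * N y + t * F y) :
    Tendsto (fun n : ℕ => Real.log n * (hilbertEstExp d n x ρ f - f x)) atTop
      (nhds ((∫ y, hT d x y * (f y - f x) * ρ y) / (unitBallVol d * ρ x))) ∧
    Tendsto (fun n : ℕ => Real.log n ^ 2 * hilbertBias d n x ρ f) atTop
      (nhds (((∫ y, hT d x y * (f y - f x) * ρ y) / (unitBallVol d * ρ x)) ^ 2)) := by
  obtain ⟨C, hdecay⟩ := hphi_decay d hd x ρ hρ0 hρi hρm hρ_var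
  have hL : 0 < unitBallVol d * ρ x := mul_pos (unitBallVol_pos d) hx
  have hφL := aux_phi_asymp d hd x ρ hρm hρ0 hρi hρ1 hρ_cont
  have hφ0 := hphi_nonneg d x ρ hρ0
  have hφ1 : ∀ t, 0 < t → hphi d x ρ t ≤ 1 := fun t ht => hphi_le_one d x ρ hρ0 hρi hρ1 ht
  have hφa := hphi_anti d x ρ hρ0 hρi
  have hφm := hphi_meas d x ρ hρm
  have hφt := hphi_tendsto d x ρ hρm hρi hρ1
  have hg : Measurable (fun y => f y - f x) := by fun_prop
  obtain ⟨k1, k2, k3, k4⟩ := aux_kappa d ρ hρm x (fun y => f y - f x) hg hi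
  have hHm := hH_meas d x ρ (fun y => f y - f x) hρm hg
  have hH0 := hH_nonneg d x ρ (fun y => f y - f x) hρ0
  have hHb := fun (t : ℝ) (ht : 0 < t) =>
    (hH_int d x ρ (fun y => f y - f x) hρm hg hρ0 hN hF hb ht).2
  have hmean := fun (n : ℕ) (hn : 3 * d ≤ n) =>
    aux_mean d n hd x ρ f hρm hf hρ0 hρi hρ1 hi hdecay hn
  have hbias := fun (n : ℕ) (hn : 3 * d ≤ n - 1) =>
    aux_bias d n hd x ρ f hρm hf hρ0 hρi hρ1 hi hβ0 hβ1 hN hF hb hdecay hn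
  set L := unitBallVol d * ρ x with hLd
  set κ := ∫ y, hT d x y * (f y - f x) * ρ y with hκd
  set M := ∫ y, |hT d x y * (f y - f x) * ρ y| with hMd
  have k1 : Measurable (hK d x ρ (fun y => f y - f x)) := k1
  have k3 : ∀ t, 0 < t → |hK d x ρ (fun y => f y - f x) t| ≤ M := k3
  have k4 : Tendsto (hK d x ρ (fun y => f y - f x)) (nhdsWithin 0 (Set.Ioi 0)) (nhds κ) := k4
  set K := hK d x ρ (fun y => f y - f x) with hKd
  set H := hH d x ρ (fun y => f y - f x) with hHd
  set φ := hphi d x ρ with hφd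
  have hM0 : 0 ≤ M := (abs_nonneg _).trans (k3 1 one_pos)
  have lap : ∀ {h : ℝ → ℝ} {k M h0 : ℝ}, 0 ≤ k → k ≤ 1 → Measurable h →
      (∀ t, 0 < t → |h t| ≤ M) → Tendsto h (nhdsWithin 0 (Set.Ioi 0)) (nhds h0) →
      Tendsto (fun n : ℕ => ((n:ℝ) * Real.log n) ^ (k + 1) *
        ∫ t in Set.Ioi (0:ℝ), t ^ k * h t * φ t ^ (n - 1)) atTop
        (nhds (h0 * (Real.Gamma (k + 1) / L ^ (k + 1)))) := fun a b c e g =>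
    aux_laplace hL a b hφL (fun t _ => hφ0 t) hφa hφm c hdecay e g
  have hpw : ∀ (n : ℕ) (t : ℝ), 1 ≤ n → φ t * φ t ^ (n - 1) = φ t ^ n := fun n t hn => by
    rw [← pow_succ', Nat.sub_add_cancel hn]
  constructor
  · have h1 := lap (h := fun t => K t * φ t) (k := 0) (M := M * 1) (h0 := κ * 1) le_rfl zero_le_one
      (by fun_prop) (fun t ht => by
        rw [abs_mul, abs_of_nonneg (hφ0 t)]
        exact mul_le_mul (k3 t ht) (hφ1 t ht) (hφ0 t) hM0) (k4.mul hφt)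
    have h2 := aux_np1.mul h1
    simp only [zero_add, Real.Gamma_one, Real.rpow_one, mul_one, one_mul, Real.rpow_zero,
      mul_one_div] at h2
    refine h2.congr' ?_
    filter_upwards [aux_ev_log, eventually_ge_atTop (3 * d)] with n hn hn2
    rw [hmean n hn2]
    have hn1 : 1 ≤ n := by omega
    simp only [mul_assoc, hpw n _ hn1]
    have := hn.1
    field_simp
  · have h1 := lap (h := fun t => K t ^ 2) (k := 1) (M := M ^ 2) (h0 := κ ^ 2) zero_le_one le_rfl
      (by fun_prop) (fun t ht => by
        rw [abs_pow]
        exact pow_le_pow_left₀ (abs_nonneg _) (k3 t ht) 2) (k4.pow 2)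
    have h2 := aux_np1.mul h1
    have hlow : ∀ k : ℝ, 0 < k → k ≤ 1 → Tendsto (fun n : ℕ => Real.log n ^ 2 * ((n:ℝ) + 1) *
        ∫ t in Set.Ioi (0:ℝ), t ^ k * φ t ^ n) atTop (nhds 0) := by
      intro k hk0 hk1
      have h3 := (aux_rate hk0).mul (lap (h := φ) (k := k) (M := 1) hk0.le hk1 hφm
        (fun t ht => by rw [abs_of_nonneg (hφ0 t)]; exact hφ1 t ht) hφt)
      rw [zero_mul] at h3
      refine h3.congr' ?_
      filter_upwards [aux_ev_log, eventually_ge_atTop 1] with n hn hn1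
      simp only [mul_assoc, hpw n _ hn1]
      have : 0 < ((n:ℝ) * Real.log n) ^ (k + 1) := Real.rpow_pos_of_pos (mul_pos hn.1 hn.2) _
      generalize ((n:ℝ) * Real.log n) ^ (k + 1) = c at this ⊢
      field_simp
    have hD : Tendsto (fun n : ℕ => Real.log n ^ 2 * ((n:ℝ) + 1) *
        ∫ t in Set.Ioi (0:ℝ), t * (H t * φ t ^ n)) atTop (nhds 0) := by
      have h4 := ((hlow β hβ0 hβ1).mul_const (∫ y, N y)).add
        ((hlow 1 one_pos le_rfl).mul_const (∫ y, F y))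
      rw [zero_mul, zero_mul, add_zero] at h4
      refine squeeze_zero' ?_ ?_ h4
      · refine Eventually.of_forall fun n => ?_
        refine mul_nonneg (by positivity) (setIntegral_nonneg measurableSet_Ioi fun t ht => ?_)
        have ht : 0 < t := ht
        have := hφ0 t
        have := hH0 t
        positivity
      · filter_upwards [eventually_ge_atTop (3 * d)] with n hn
        have i1 : ∀ k : ℝ, 0 ≤ k → k ≤ 1 → IntegrableOn (fun t => t ^ k * φ t ^ n) (Set.Ioi 0) :=
          fun k h0 h1 => aux_intphi h0 h1 (fun t _ => hφ0 t) hφ1 hφm hdecay hn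
        have i2 := ((i1 β hβ0.le hβ1).mul_const (∫ y, N y))
        have i3 := ((i1 1 zero_le_one le_rfl).mul_const (∫ y, F y))
        have hle : ∀ t, 0 < t → t * (H t * φ t ^ n) ≤
            t ^ β * φ t ^ n * (∫ y, N y) + t ^ (1:ℝ) * φ t ^ n * (∫ y, F y) := by
          intro t ht
          have h0 := hφ0 t
          rw [Real.rpow_one]
          calc t * (H t * φ t ^ n) = (t * H t) * φ t ^ n := by ring
            _ ≤ (t ^ β * (∫ y, N y) + t * ∫ y, F y) * φ t ^ n := by
              gcongr
              exact hHb t ht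
            _ = _ := by ring
        rw [mul_assoc _ _ (∫ y, N y), mul_assoc _ _ (∫ y, F y), ← mul_add]
        refine mul_le_mul_of_nonneg_left ?_ (by positivity)
        rw [← integral_mul_const, ← integral_mul_const, ← integral_add i2 i3]
        refine integral_mono_of_nonneg ?_ (i2.add i3) ?_
        · refine (ae_restrict_iff' measurableSet_Ioi).2 (Eventually.of_forall fun t ht => ?_)
          have ht : 0 < t := ht
          have := hφ0 t
          have := hH0 t
          simp only [Pi.zero_apply]
          positivity
        · exact (ae_restrict_iff' measurableSet_Ioi).2 (Eventually.of_forall fun t ht => hle t ht)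
    have h5 := hD.add h2
    have hG2 : Real.Gamma (1 + 1) = 1 := by rw [one_add_one_eq_two, Real.Gamma_two]
    rw [hG2, zero_add, one_mul, one_add_one_eq_two, Real.rpow_two, mul_one_div, ← div_pow] at h5
    refine h5.congr' ?_
    filter_upwards [aux_ev_log, eventually_ge_atTop (3 * d + 1)] with n hn hn2
    rw [hbias n (by omega)]
    simp only [Real.rpow_one, Real.rpow_two, mul_assoc]
    have := hn.1
    field_simp

/-- under the growth condition and local Hölder condition for `f`, with
`κ(x) = ∫ ρ(x+y)·(f(x+y)−f(x))/‖y‖^d dy` finite and nonzero, the bias term satisfies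
`B(x) ~ (κ(x)/(V_d·ρ(x)·ln n))²` and `B(x) ~ (E[f̂(x)]−f(x))²` as `n → ∞`. -/
theorem hilbert_bias_asymptotic
    (d : ℕ) (hd : 1 ≤ d)
    (ρ : Euc d → ℝ) (hρ_meas : Measurable ρ) (hρ_nonneg : ∀ y, 0 ≤ ρ y)
    (hρ_prob : (∫ y, ρ y) = 1)
    (hρ_var : Integrable (fun y => ρ y * ‖y‖ ^ 2))
    (x : Euc d) (hx : x ∈ interior {y | 0 < ρ y}) (hρ_cont : ContinuousAt ρ x)
    (f : Euc d → ℝ) (hf_meas : Measurable f)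
    (hf_growth : Integrable (fun y => ρ y * f y ^ 2 / (1 + ‖y‖ ^ (2 * (d : ℝ)))))
    (αx Kx δx : ℝ) (hαx : 0 < αx) (hKx : 0 < Kx) (hδx : 0 < δx)
    (hf_holder : ∀ x', 0 < ρ x' → ‖x - x'‖ ≤ δx → |f x - f x'| ≤ Kx * ‖x - x'‖ ^ αx)
    (hκ : (∫ y : Euc d, ρ (x + y) * (f (x + y) - f x) / ‖y‖ ^ (d : ℝ)) ≠ 0) :
    Integrable (fun y : Euc d => ρ (x + y) * (f (x + y) - f x) / ‖y‖ ^ (d : ℝ)) ∧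
    Tendsto (fun n : ℕ => hilbertBias d n x ρ f /
        ((∫ y : Euc d, ρ (x + y) * (f (x + y) - f x) / ‖y‖ ^ (d : ℝ)) /
          (unitBallVol d * ρ x * Real.log n)) ^ 2)
      atTop (nhds 1) ∧
    Tendsto (fun n : ℕ => hilbertBias d n x ρ f / (hilbertEstExp d n x ρ f - f x) ^ 2)
      atTop (nhds 1) := by

  have hρi : Integrable ρ := by
    by_contra h
    rw [integral_undef h] at hρ_prob
    exact zero_ne_one hρ_prob
  have hρx : 0 < ρ x := (interior_subset hx : x ∈ {y | 0 < ρ y})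
  obtain ⟨hi, β, N, F, hβ0, hβ1, hN, hF, hb⟩ := aux_f d hd ρ hρ_meas hρ_nonneg hρi x hx hρ_cont f
    hf_meas hf_growth αx Kx δx hαx hKx hδx hf_holder
  obtain ⟨h1, h2⟩ := aux_main d hd ρ hρ_meas hρ_nonneg hρi hρ_prob hρ_var x hρx hρ_cont f hf_meas
    hi hβ0 hβ1 hN hF hb
  have e : (fun y : Euc d => ρ (x + y) * (f (x + y) - f x) / ‖y‖ ^ (d : ℝ)) =
      fun y => (fun z => hT d x z * (f z - f x) * ρ z) (x + y) := by
    ext y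
    simp only [hT]
    rw [sub_add_cancel_left, norm_neg, Real.rpow_neg (norm_nonneg _)]
    ring
  have hL : 0 < unitBallVol d * ρ x := mul_pos (unitBallVol_pos d) hρx
  rw [e, integral_add_left_eq_self (fun z => hT d x z * (f z - f x) * ρ z) x] at hκ
  rw [e, integral_add_left_eq_self (fun z => hT d x z * (f z - f x) * ρ z) x]
  set κ := ∫ z, hT d x z * (f z - f x) * ρ z
  refine ⟨hi.comp_add_left x, ?_, ?_⟩
  · have h3 := h2.mul_const (((κ / (unitBallVol d * ρ x)) ^ 2)⁻¹)
    rw [mul_inv_cancel₀ (by positivity)] at h3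
    refine h3.congr' ?_
    filter_upwards [aux_ev_log] with n hn
    have := hn.2
    rw [← div_div]
    generalize κ / (unitBallVol d * ρ x) = c
    field_simp
  · have h3 := h2.div (h1.pow 2) (by positivity)
    rw [div_self (by positivity)] at h3
    refine h3.congr' ?_
    filter_upwards [aux_ev_log] with n hn
    have := hn.2
    simp only [Pi.div_apply]
    rw [mul_pow, mul_div_mul_left _ _ (by positivity)]

end
end

section
/- Let d ≥ 1, let ρ be a probability density on ℝ^d with finite variance, fix x in the interior of the support of ρ with ρ continuous at x. Assume ∫ ρ(y)·f²(y)/(1+‖y‖^{2d}) d^d y < ∞ and the local Hölder condition: there exist α_x > 0, K_x > 0, δ_x > 0 such that x' ∈ Ω and ‖x−x'‖ ≤ δ_x imply |f(x)−f(x')| ≤ K_x·‖x−x'‖^{α_x}. Define κ(x) = ∫ ρ(x+y)·(f(x+y)−f(x))/‖y‖^d d^d y. If κ(x) ≠ 0, then the expectation of the Hilbert kernel estimator satisfies E[f̂(x)] − f(x) ~ κ(x)/(V_d·ρ(x)·ln n) as n → ∞. -/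
open MeasureTheory Filter

noncomputable section

lemma oneD_dom (ψ : ℝ → ℝ) (L C : ℝ) (m : ℕ) (hL : 0 < L) (hC : 0 ≤ C)
    (h0 : ∀ t, 0 ≤ ψ t) (h1 : ∀ t, 0 < t → ψ t ≤ 1)
    (hanti : ∀ t u, 0 < t → t ≤ u → ψ u ≤ ψ t)
    (hasym : Tendsto (fun t => (1 - ψ t) / (t * Real.log (1 / t))) (nhdsWithin 0 (Set.Ioi 0)) (nhds L))
    (hdecay : ∀ t, 0 < t → ψ t ^ m ≤ C / t ^ 2) :
    ∃ K, ∀ᶠ n : ℕ in atTop, ∀ s, 0 < s → ψ (s / (n * Real.log n)) ^ n ≤ K * (1 + s ^ 2)⁻¹ := by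
  have hev := hasym.eventually (lt_mem_nhds (show L / 2 < L by linarith))
  rw [eventually_nhdsWithin_iff, Metric.eventually_nhds_iff] at hev
  obtain ⟨t1, ht1, hev⟩ := hev
  obtain ⟨t0, ht0, ht01, ht0e⟩ : ∃ t0 : ℝ, 0 < t0 ∧ t0 < t1 ∧ t0 ≤ Real.exp (-1) :=
    ⟨min (t1 / 2) (Real.exp (-1)), lt_min (by linarith) (Real.exp_pos _),
      (min_le_left _ _).trans_lt (by linarith), min_le_right _ _⟩
  have hlog : ∀ t, 0 < t → t ≤ t0 → 1 ≤ Real.log (1 / t) := by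
    intro t ht htt
    rw [one_div, Real.log_inv]
    have := Real.log_le_log ht (htt.trans ht0e)
    rw [Real.log_exp] at this
    linarith
  have hsm : ∀ t, 0 < t → t ≤ t0 → ψ t ≤ 1 - L / 2 * (t * Real.log (1 / t)) := by
    intro t ht htt
    have h := hev (y := t) (by simp [abs_of_pos ht]; linarith) ht
    have hp : 0 < t * Real.log (1 / t) := mul_pos ht (by linarith [hlog t ht htt])
    rw [lt_div_iff₀ hp] at h
    linarith
  have hq : ψ t0 < 1 := by
    have := hsm t0 ht0 le_rfl
    have hp : 0 < t0 * Real.log (1 / t0) := mul_pos ht0 (by linarith [hlog t0 ht0 le_rfl])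
    have : 0 < L / 2 * (t0 * Real.log (1 / t0)) := by positivity
    linarith
  set q := max (ψ t0) (1 / 2) with hqdef
  have hq1 : q < 1 := max_lt hq (by norm_num)
  have hq0 : 0 < q := lt_of_lt_of_le (by norm_num) (le_max_right _ _)
  have hlim := tendsto_pow_const_mul_const_pow_of_abs_lt_one 4 (r := q) (by rwa [abs_of_pos hq0])
  have hev2 := hlim.eventually (gt_mem_nhds (show 0 < q ^ m by positivity))
  set c := L / 2 with hc
  have hc0 : 0 < c := by positivity
  set D := C + 1 + 384 / c ^ 4 with hD
  have hD' : 0 < 384 / c ^ 4 := by positivity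
  refine ⟨1 + D, ?_⟩
  filter_upwards [hev2, eventually_ge_atTop m, eventually_ge_atTop 3] with n hn hnm hn3 s hs
  have hn3' : (3 : ℝ) ≤ n := by exact_mod_cast hn3
  have hln : 1 ≤ Real.log n := by
    rw [Real.le_log_iff_exp_le (by linarith)]
    linarith [Real.exp_one_lt_d9]
  have hlnn : Real.log n ≤ n := (Real.log_le_sub_one_of_pos (by linarith)).trans (by linarith)
  set a := (n : ℝ) * Real.log n with ha
  have ha0 : 0 < a := by positivity
  have ht : 0 < s / a := by positivity
  set t := s / a with htdef
  have hX1 : ψ t ^ n ≤ 1 := pow_le_one₀ (h0 _) (h1 _ ht)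
  suffices hX2 : ψ t ^ n * s ^ 2 ≤ D by
    rw [← div_eq_mul_inv, le_div_iff₀ (by positivity)]
    nlinarith
  rcases le_or_gt t t0 with htt | htt
  · rcases le_or_gt s 1 with hs1 | hs1
    · have : ψ t ^ n * s ^ 2 ≤ 1 * 1 := by
        apply mul_le_mul hX1 _ (by positivity) (by norm_num)
        nlinarith
      linarith
    · have hψ : ψ t ≤ Real.exp (-(c * (t * Real.log (1 / t)))) := by
        refine (hsm t ht htt).trans ?_
        linarith [Real.add_one_le_exp (-(c * (t * Real.log (1 / t))))]
      set u := Real.log (1 / t) with hu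
      have hu1 : 1 ≤ u := hlog t ht htt
      have hls : 0 < Real.log s := Real.log_pos hs1
      have hlna : Real.log n ≤ u + Real.log s := by
        rw [hu, ← Real.log_mul (by positivity) (by positivity)]
        apply Real.log_le_log (by linarith)
        rw [htdef]
        field_simp
        rw [ha]
        nlinarith
      have hsq : 1 + Real.log s ≤ 2 * √s := by
        have := Real.log_le_sub_one_of_pos (Real.sqrt_pos.mpr hs)
        rw [Real.log_sqrt hs.le] at this
        linarith
      have hss := Real.sq_sqrt hs.le
      have hsp := Real.sqrt_pos.mpr hs
      have key : √s / 2 ≤ n * (t * u) := by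
        have e : n * (t * u) = s * u / Real.log n := by
          rw [htdef, ha]; field_simp
        rw [e, le_div_iff₀ (by linarith)]
        calc √s / 2 * Real.log n ≤ √s / 2 * (u * (2 * √s)) := by
              gcongr
              nlinarith
          _ = s * u := by linear_combination u * hss
      have hX : ψ t ^ n ≤ Real.exp (-(c * √s / 2)) := by
        calc ψ t ^ n ≤ (Real.exp (-(c * (t * u)))) ^ n := pow_le_pow_left₀ (h0 _) hψ _
          _ = Real.exp (-(c * (n * (t * u)))) := by rw [← Real.exp_nat_mul]; ring_nf
          _ ≤ _ := by
            apply Real.exp_le_exp.mpr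
            nlinarith
      have h4 := Real.pow_div_factorial_le_exp (c * √s / 2) (by positivity) 4
      have e4 : (c * √s / 2) ^ 4 / (Nat.factorial 4 : ℝ) = s ^ 2 / (384 / c ^ 4) := by
        have : √s ^ 4 = s ^ 2 := by
          rw [show √s ^ 4 = (√s ^ 2) ^ 2 by ring, hss]
        rw [div_pow, mul_pow, this]
        simp [Nat.factorial]
        field_simp
        norm_num
      rw [e4, div_le_iff₀ hD'] at h4
      calc ψ t ^ n * s ^ 2 ≤ Real.exp (-(c * √s / 2)) * (Real.exp (c * √s / 2) * (384 / c ^ 4)) := by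
            gcongr
        _ = 384 / c ^ 4 := by
            rw [← mul_assoc, ← Real.exp_add]; simp
        _ ≤ D := by linarith
  · have hqt : ψ t ≤ q := (hanti t0 t ht0 htt.le).trans (le_max_left _ _)
    have e : ψ t ^ n = ψ t ^ (n - m) * ψ t ^ m := by rw [← pow_add]; congr 1; omega
    have h3 : (n:ℝ) ^ 4 * q ^ (n - m) ≤ 1 := by
      have : q ^ n = q ^ (n - m) * q ^ m := by rw [← pow_add]; congr 1; omega
      rw [this, ← mul_assoc] at hn
      have := lt_of_mul_lt_mul_right (a := q ^ m) (b := (n:ℝ) ^ 4 * q ^ (n - m)) (c := 1) (by linarith) (by positivity)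
      exact this.le
    have h5 : a ^ 2 ≤ (n:ℝ) ^ 4 := by
      have : a ≤ (n:ℝ) ^ 2 := by rw [ha]; nlinarith
      nlinarith
    calc ψ t ^ n * s ^ 2 ≤ q ^ (n - m) * (C / t ^ 2) * s ^ 2 := by
          rw [e]
          gcongr
          · exact pow_nonneg (h0 _) _
          · exact h0 _
          · exact hdecay t ht
      _ = C * (a ^ 2 * q ^ (n - m)) := by rw [htdef]; field_simp
      _ ≤ C * ((n:ℝ) ^ 4 * q ^ (n - m)) := by gcongr
      _ ≤ C * 1 := by gcongr
      _ ≤ D := by linarith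

lemma oneD (ψ h : ℝ → ℝ) (L C H κ : ℝ) (m : ℕ) (hL : 0 < L) (hC : 0 ≤ C)
    (hψm : Measurable ψ) (hhm : Measurable h)
    (h0 : ∀ t, 0 ≤ ψ t) (h1 : ∀ t, 0 < t → ψ t ≤ 1)
    (hanti : ∀ t u, 0 < t → t ≤ u → ψ u ≤ ψ t)
    (hasym : Tendsto (fun t => (1 - ψ t) / (t * Real.log (1 / t))) (nhdsWithin 0 (Set.Ioi 0)) (nhds L))
    (hdecay : ∀ t, 0 < t → ψ t ^ m ≤ C / t ^ 2)
    (hH : ∀ t, 0 < t → |h t| ≤ H) 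
    (hκ : Tendsto h (nhdsWithin 0 (Set.Ioi 0)) (nhds κ)) :
    Tendsto (fun n : ℕ => n * Real.log n * ∫ t in Set.Ioi 0, h t * ψ t ^ n) atTop (nhds (κ / L)) := by
  obtain ⟨K, hK⟩ := oneD_dom ψ L C m hL hC h0 h1 hanti hasym hdecay
  have hlogn : Tendsto (fun n : ℕ => Real.log n) atTop atTop :=
    Real.tendsto_log_atTop.comp tendsto_natCast_atTop_atTop
  have haT : Tendsto (fun n : ℕ => n * Real.log n) atTop atTop :=
    tendsto_natCast_atTop_atTop.atTop_mul_atTop₀ hlogn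
  have hval : ∫ s in Set.Ioi (0:ℝ), κ * Real.exp (-L * s) = κ / L := by
    rw [integral_const_mul, integral_exp_mul_Ioi (by linarith)]
    simp
    field_simp
  rw [← hval]
  have hev : (fun n : ℕ => ∫ s in Set.Ioi (0:ℝ), h (s / (n * Real.log n)) * ψ (s / (n * Real.log n)) ^ n)
      =ᶠ[atTop] (fun n : ℕ => n * Real.log n * ∫ t in Set.Ioi 0, h t * ψ t ^ n) := by
    filter_upwards [haT.eventually_gt_atTop 0] with n hn
    have := integral_comp_mul_left_Ioi (fun t => h t * ψ t ^ n) 0 (inv_pos.mpr hn)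
    simp only [inv_inv, mul_zero, smul_eq_mul] at this
    rw [← this]
    simp only [div_eq_inv_mul]
  refine Tendsto.congr' hev ?_
  have hts : ∀ s : ℝ, 0 < s → Tendsto (fun n : ℕ => s / (n * Real.log n)) atTop (nhdsWithin 0 (Set.Ioi 0)) := by
    intro s hs
    refine tendsto_nhdsWithin_iff.mpr ⟨haT.const_div_atTop s, ?_⟩
    filter_upwards [haT.eventually_gt_atTop 0] with n hn
    exact div_pos hs hn
  refine tendsto_integral_filter_of_dominated_convergence (fun s => H * (K * (1 + s ^ 2)⁻¹)) ?_ ?_ ?_ ?_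
  · refine Eventually.of_forall fun n => Measurable.aestronglyMeasurable ?_
    fun_prop
  · filter_upwards [hK, haT.eventually_gt_atTop 0] with n hn hn0
    refine (ae_restrict_iff' measurableSet_Ioi).mpr (Eventually.of_forall fun s hs => ?_)
    rw [norm_mul, norm_pow, Real.norm_eq_abs, Real.norm_eq_abs, abs_of_nonneg (h0 _)]
    have hs' : 0 < s / (n * Real.log n) := div_pos hs hn0
    exact mul_le_mul (hH _ hs') (hn s hs) (pow_nonneg (h0 _) _) ((abs_nonneg _).trans (hH _ hs'))
  · exact ((integrable_inv_one_add_sq.const_mul K).const_mul H).integrableOn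
  · refine (ae_restrict_iff' measurableSet_Ioi).mpr (Eventually.of_forall fun s hs => ?_)
    have hs : 0 < s := hs
    refine (hκ.comp (hts s hs)).mul ?_
    have hg : Tendsto (fun n : ℕ => (n:ℝ) * (ψ (s / (n * Real.log n)) - 1)) atTop (nhds (-L * s)) := by
      have A := hasym.comp (hts s hs)
      -- n t log(1/t) → s
      have B : Tendsto (fun n : ℕ => s * (1 + Real.log (Real.log n) / Real.log n - Real.log s / Real.log n)) atTop (nhds (s * (1 + 0 - 0))) := by
        refine Tendsto.const_mul _ ((Tendsto.const_add _ ?_).sub (hlogn.const_div_atTop _))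
        have := Real.isLittleO_log_id_atTop.tendsto_div_nhds_zero
        exact this.comp hlogn
      have P := (A.mul B).neg
      rw [show -(L * (s * (1 + 0 - 0))) = -L * s by ring] at P
      refine Tendsto.congr' ?_ P
      filter_upwards [hlogn.eventually_gt_atTop 1, eventually_gt_atTop 0,
        (hts s hs).eventually (Ioo_mem_nhdsGT (show (0:ℝ) < 1 by norm_num))] with n hn hn0 htn
      have hn0' : (0:ℝ) < n := by exact_mod_cast hn0
      have hl : Real.log (1 / (s / (n * Real.log n))) = Real.log n + Real.log (Real.log n) - Real.log s := by
        rw [one_div_div, Real.log_div (by positivity) hs.ne', Real.log_mul (by positivity) (by positivity)]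
      have hl0 : 0 < Real.log (1 / (s / (n * Real.log n))) := Real.log_pos (by
        rw [one_div]; exact (one_lt_inv₀ htn.1).mpr htn.2)
      simp only [Function.comp]
      have e2 : s * (1 + Real.log (Real.log n) / Real.log n - Real.log s / Real.log n)
        = n * (s / (n * Real.log n) * Real.log (1 / (s / (n * Real.log n)))) := by
        rw [hl]; field_simp
      rw [e2]
      have : s / (n * Real.log n) * Real.log (1 / (s / (n * Real.log n))) ≠ 0 := (mul_pos htn.1 hl0).ne'
      generalize s / (n * Real.log n) * Real.log (1 / (s / (n * Real.log n))) = z at this ⊢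
      field_simp
      ring
    have := Real.tendsto_one_add_pow_exp_of_tendsto hg
    simpa using this

lemma abel_int (p : ℝ → ℝ) (hpm : Measurable p) (hp0 : ∀ s, 0 ≤ p s) (hp1 : ∀ s, p s ≤ 1) (t : ℝ) (ht : 0 < t) :
    IntegrableOn (fun s => Real.exp (-t * s) * p s) (Set.Ioi 0) := by
  refine Integrable.mono' (exp_neg_integrableOn_Ioi 0 ht) (by fun_prop) (Eventually.of_forall fun s => ?_)
  rw [Real.norm_eq_abs, abs_of_nonneg (mul_nonneg (Real.exp_pos _).le (hp0 s))]
  exact mul_le_of_le_one_right (Real.exp_pos _).le (hp1 s)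

lemma abel_bd (p : ℝ → ℝ) (hpm : Measurable p) (hp0 : ∀ s, 0 ≤ p s) (hp1 : ∀ s, p s ≤ 1)
    (A B s0 : ℝ) (hs0 : 0 < s0) (hA : 0 ≤ A) (hB : 0 ≤ B)
    (hlo : ∀ s, s0 < s → A / s ≤ p s) (hhi : ∀ s, s0 < s → p s ≤ B / s) (t : ℝ) (ht : 0 < t) (hts : t < 1 / s0) :
    A * (Real.log (1 / t) - Real.log s0 - 1) ≤ ∫ s in Set.Ioi 0, Real.exp (-t * s) * p s ∧
    ∫ s in Set.Ioi 0, Real.exp (-t * s) * p s ≤ s0 + B * (Real.log (1 / t) - Real.log s0 + 1) := by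
  have hI := abel_int p hpm hp0 hp1 t ht
  have hst : s0 < 1 / t := by
    rw [lt_div_iff₀ hs0] at hts
    rw [lt_div_iff₀ ht]; linarith
  have h0t : 0 < 1 / t := by positivity
  have hsplit : ∫ s in Set.Ioi 0, Real.exp (-t * s) * p s = (∫ s in Set.Ioc 0 s0, Real.exp (-t * s) * p s)
      + ((∫ s in Set.Ioc s0 (1 / t), Real.exp (-t * s) * p s) + ∫ s in Set.Ioi (1 / t), Real.exp (-t * s) * p s) := by
    rw [← setIntegral_union (Set.Ioc_disjoint_Ioi le_rfl) measurableSet_Ioi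
      (hI.mono_set (fun s hs => lt_trans hs0 hs.1)) (hI.mono_set (fun s hs => lt_trans h0t hs)),
      Set.Ioc_union_Ioi_eq_Ioi hst.le,
      ← setIntegral_union (Set.Ioc_disjoint_Ioi le_rfl) measurableSet_Ioi
      (hI.mono_set (fun s hs => hs.1)) (hI.mono_set (fun s hs => lt_trans hs0 hs)),
      Set.Ioc_union_Ioi_eq_Ioi hs0.le]
  have hI1 : IntegrableOn (fun s => Real.exp (-t * s) * p s) (Set.Ioc 0 s0) := hI.mono_set (fun s hs => hs.1)
  have hI2 : IntegrableOn (fun s => Real.exp (-t * s) * p s) (Set.Ioc s0 (1 / t)) :=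
    hI.mono_set (fun s hs => lt_trans hs0 hs.1)
  have hI3 : IntegrableOn (fun s => Real.exp (-t * s) * p s) (Set.Ioi (1 / t)) :=
    hI.mono_set (fun s hs => lt_trans h0t hs)
  have hnn : ∀ s, 0 ≤ Real.exp (-t * s) * p s := fun s => mul_nonneg (Real.exp_pos _).le (hp0 s)
  have hexp1 : ∀ s, 0 < s → Real.exp (-t * s) ≤ 1 := fun s hs => Real.exp_le_one_iff.mpr (by nlinarith)
  have hinv : IntervalIntegrable (fun s : ℝ => s⁻¹) volume s0 (1 / t) := by
    apply intervalIntegral.intervalIntegrable_inv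
    · intro s hs
      rw [Set.uIcc_of_le hst.le] at hs
      exact (lt_of_lt_of_le hs0 hs.1).ne'
    · fun_prop
  have hlogeq : ∫ s in s0..(1/t), s⁻¹ = Real.log (1 / t) - Real.log s0 := by
    rw [integral_inv_of_pos hs0 h0t, Real.log_div h0t.ne' hs0.ne']
  have hinvO : IntegrableOn (fun s : ℝ => s⁻¹) (Set.Ioc s0 (1 / t)) :=
    (intervalIntegrable_iff_integrableOn_Ioc_of_le hst.le).mp hinv
  rw [hsplit]
  constructor
  · have b1 : 0 ≤ ∫ s in Set.Ioc 0 s0, Real.exp (-t * s) * p s := integral_nonneg fun s => hnn s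
    have b3 : 0 ≤ ∫ s in Set.Ioi (1/t), Real.exp (-t * s) * p s := integral_nonneg fun s => hnn s
    have b2 : A * (Real.log (1 / t) - Real.log s0 - 1) ≤ ∫ s in Set.Ioc s0 (1 / t), Real.exp (-t * s) * p s := by
      have : ∫ s in Set.Ioc s0 (1 / t), A * (s⁻¹ - t) = A * (Real.log (1 / t) - Real.log s0 - (1 - t * s0)) := by
        rw [← intervalIntegral.integral_of_le hst.le, intervalIntegral.integral_const_mul,
          intervalIntegral.integral_sub hinv (by simp), hlogeq]
        simp
        left
        field_simp
      have h2 : A * (Real.log (1 / t) - Real.log s0 - 1) ≤ A * (Real.log (1 / t) - Real.log s0 - (1 - t * s0)) := by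
        apply mul_le_mul_of_nonneg_left _ hA
        nlinarith [mul_pos ht hs0]
      refine h2.trans ?_
      rw [← this]
      refine setIntegral_mono_on ?_ hI2 measurableSet_Ioc ?_
      · exact (hinvO.sub (by simp)).const_mul A
      · intro s hs
        have hsp : 0 < s := lt_trans hs0 hs.1
        have h1 : 1 - t * s ≤ Real.exp (-t * s) := by linarith [Real.add_one_le_exp (-t * s)]
        calc A * (s⁻¹ - t) = (1 - t * s) * (A / s) := by field_simp
          _ ≤ Real.exp (-t * s) * (A / s) := by gcongr
          _ ≤ _ := by
            gcongr
            exact hlo s hs.1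
    linarith
  · have b1 : ∫ s in Set.Ioc 0 s0, Real.exp (-t * s) * p s ≤ s0 := by
      have : ∫ s in Set.Ioc 0 s0, (1:ℝ) = s0 := by simp [hs0.le]
      conv_rhs => rw [← this]
      refine setIntegral_mono_on hI1 (by simp) measurableSet_Ioc ?_
      intro s hs
      exact mul_le_one₀ (hexp1 s hs.1) (hp0 s) (hp1 s)
    have b2 : ∫ s in Set.Ioc s0 (1 / t), Real.exp (-t * s) * p s ≤ B * (Real.log (1 / t) - Real.log s0) := by
      rw [← hlogeq, ← intervalIntegral.integral_const_mul, intervalIntegral.integral_of_le hst.le]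
      refine setIntegral_mono_on hI2 (hinvO.const_mul B) measurableSet_Ioc ?_
      intro s hs
      have hsp : 0 < s := lt_trans hs0 hs.1
      calc Real.exp (-t * s) * p s ≤ 1 * (B / s) := 
            mul_le_mul (hexp1 s hsp) (hhi s hs.1) (hp0 s) (by norm_num)
        _ = _ := by rw [one_mul, div_eq_mul_inv]
    have b3 : ∫ s in Set.Ioi (1/t), Real.exp (-t * s) * p s ≤ B := by
      have : ∫ s in Set.Ioi (1/t), B * t * Real.exp (-t * s) = B * Real.exp (-1) := by
        rw [integral_const_mul, integral_exp_mul_Ioi (by linarith)]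
        have : -t * (1 / t) = -1 := by field_simp
        rw [this]
        field_simp
      have h2 : B * Real.exp (-1) ≤ B := mul_le_of_le_one_right hB (Real.exp_le_one_iff.mpr (by norm_num))
      refine le_trans ?_ h2
      rw [← this]
      refine setIntegral_mono_on hI3 ((exp_neg_integrableOn_Ioi _ ht).const_mul _) measurableSet_Ioi ?_
      intro s hs
      have hs : 1 / t < s := hs
      have hsp : 0 < s := lt_trans h0t hs
      have : p s ≤ B * t := by
        refine (hhi s (hst.trans hs)).trans ?_
        rw [div_le_iff₀ hsp]
        rw [div_lt_iff₀ ht] at hs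
        nlinarith
      nlinarith [Real.exp_pos (-t * s)]
    linarith

lemma abel (p : ℝ → ℝ) (hpm : Measurable p) (hp0 : ∀ s, 0 ≤ p s) (hp1 : ∀ s, p s ≤ 1)
    (L : ℝ) (hL : 0 < L) (hlim : Tendsto (fun s => s * p s) atTop (nhds L)) :
    Tendsto (fun t => (∫ s in Set.Ioi 0, Real.exp (-t * s) * p s) / Real.log (1 / t))
      (nhdsWithin 0 (Set.Ioi 0)) (nhds L) := by
  have hlog : Tendsto (fun t : ℝ => Real.log (1 / t)) (nhdsWithin 0 (Set.Ioi 0)) atTop := by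
    simp only [one_div]
    exact Real.tendsto_log_atTop.comp tendsto_inv_nhdsGT_zero
  have key : ∀ A B, 0 ≤ A → A < L → L < B → ∃ s0 : ℝ, 0 < s0 ∧ ∀ t, 0 < t → t < 1 / s0 →
    A * (Real.log (1 / t) - Real.log s0 - 1) ≤ ∫ s in Set.Ioi 0, Real.exp (-t * s) * p s ∧
    ∫ s in Set.Ioi 0, Real.exp (-t * s) * p s ≤ s0 + B * (Real.log (1 / t) - Real.log s0 + 1) := by
    intro A B hA hAL hLB
    have hev := hlim.eventually (Ioo_mem_nhds hAL hLB)
    obtain ⟨s1, hs1⟩ := eventually_atTop.mp hev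
    refine ⟨max s1 1, lt_of_lt_of_le one_pos (le_max_right _ _), fun t ht hts => ?_⟩
    refine abel_bd p hpm hp0 hp1 A B _ (lt_of_lt_of_le one_pos (le_max_right _ _)) hA (by linarith) ?_ ?_ t ht hts
    · intro s hs
      have h1 := hs1 s ((le_max_left _ _).trans hs.le)
      have hs0 : 0 < s := lt_of_lt_of_le one_pos ((le_max_right _ _).trans hs.le)
      rw [div_le_iff₀ hs0]; linarith [h1.1]
    · intro s hs
      have h1 := hs1 s ((le_max_left _ _).trans hs.le)
      have hs0 : 0 < s := lt_of_lt_of_le one_pos ((le_max_right _ _).trans hs.le)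
      rw [le_div_iff₀ hs0]; linarith [h1.2]
  rw [tendsto_order]
  constructor
  · intro a ha
    obtain ⟨A, hA1, hA2⟩ := exists_between (max_lt ha hL)
    have hA0 : 0 < A := (le_max_right _ _).trans_lt hA1
    have haA : a < A := (le_max_left _ _).trans_lt hA1
    obtain ⟨s0, hs0, hk⟩ := key A (L + 1) hA0.le hA2 (by linarith)
    have hT : Tendsto (fun t : ℝ => A - A * (Real.log s0 + 1) / Real.log (1 / t)) (nhdsWithin 0 (Set.Ioi 0)) (nhds (A - 0)) :=
      tendsto_const_nhds.sub (hlog.const_div_atTop _)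
    rw [sub_zero] at hT
    filter_upwards [hT.eventually (lt_mem_nhds haA), Ioo_mem_nhdsGT (show (0:ℝ) < 1 / s0 by positivity),
      hlog.eventually_gt_atTop 0] with t h1 h2 h3
    refine h1.trans_le ?_
    rw [le_div_iff₀ h3]
    refine le_trans (le_of_eq ?_) (hk t h2.1 h2.2).1
    field_simp
    ring
  · intro b hb
    obtain ⟨B, hB1, hB2⟩ := exists_between hb
    obtain ⟨s0, hs0, hk⟩ := key 0 B le_rfl hL hB1
    have hT : Tendsto (fun t : ℝ => B + (s0 + B * (1 - Real.log s0)) / Real.log (1 / t)) (nhdsWithin 0 (Set.Ioi 0)) (nhds (B + 0)) :=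
      tendsto_const_nhds.add (hlog.const_div_atTop _)
    rw [add_zero] at hT
    filter_upwards [hT.eventually (gt_mem_nhds hB2), Ioo_mem_nhdsGT (show (0:ℝ) < 1 / s0 by positivity),
      hlog.eventually_gt_atTop 0] with t h1 h2 h3
    refine lt_of_le_of_lt ?_ h1
    rw [div_le_iff₀ h3]
    refine le_trans (hk t h2.1 h2.2).2 (le_of_eq ?_)
    field_simp
    ring

lemma hk_null (d : ℕ) (hd : 1 ≤ d) : NullSingletonClass (volume : Measure (Euc d)) := by
  obtain ⟨k, rfl⟩ : ∃ k, d = k + 1 := ⟨d - 1, by omega⟩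
  infer_instance

/-- kernel -/
def hkT (d : ℕ) (x y : Euc d) : ℝ := ‖x - y‖ ^ (-(d : ℝ))

lemma hkT_nonneg (d : ℕ) (x y : Euc d) : 0 ≤ hkT d x y := Real.rpow_nonneg (norm_nonneg _) _

lemma hkT_meas (d : ℕ) (x : Euc d) : Measurable (hkT d x) := by
  unfold hkT
  fun_prop

lemma hkT_self (d : ℕ) (hd : 1 ≤ d) (x : Euc d) : hkT d x x = 0 := by
  unfold hkT
  rw [sub_self, norm_zero, Real.zero_rpow]
  have : (1:ℝ) ≤ d := by exact_mod_cast hd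
  linarith

lemma hkT_pos (d : ℕ) (x y : Euc d) (h : y ≠ x) : 0 < hkT d x y :=
  Real.rpow_pos_of_pos (norm_pos_iff.mpr (sub_ne_zero.mpr h.symm)) _

lemma vol_ball (d : ℕ) (hd : 1 ≤ d) (x : Euc d) (r : ℝ) (hr : 0 ≤ r) :
    volume.real (Metric.ball x r) = unitBallVol d * r ^ d := by
  have : Nonempty (Fin d) := ⟨⟨0, hd⟩⟩
  have hG := Real.Gamma_pos_of_pos (show (0:ℝ) < (d:ℝ) / 2 + 1 by positivity)
  rw [measureReal_def, EuclideanSpace.volume_ball, Fintype.card_fin, ENNReal.toReal_mul, ENNReal.toReal_pow,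
    ENNReal.toReal_ofReal hr, ENNReal.toReal_ofReal (by positivity), unitBallVol, mul_comm]
  congr 2
  rw [Real.sqrt_eq_rpow, ← Real.rpow_natCast, ← Real.rpow_mul Real.pi_pos.le]
  congr 1; ring

lemma hkT_lt_iff (d : ℕ) (hd : 1 ≤ d) (x y : Euc d) (h : y ≠ x) (s : ℝ) (hs : 0 < s) :
    s < hkT d x y ↔ y ∈ Metric.ball x (s⁻¹ ^ ((d:ℝ)⁻¹)) := by
  have hN : 0 < ‖x - y‖ := norm_pos_iff.mpr (sub_ne_zero.mpr h.symm)
  rw [Metric.mem_ball, dist_comm, dist_eq_norm, hkT, Real.rpow_neg hN.le, Real.rpow_natCast,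
    lt_inv_comm₀ hs (by positivity)]
  have hσ : (s⁻¹ ^ ((d:ℝ)⁻¹)) ^ d = s⁻¹ := Real.rpow_inv_natCast_pow (by positivity) (by omega)
  conv_lhs => rw [← hσ]
  exact pow_lt_pow_iff_left₀ hN.le (by positivity) (by omega)

lemma hk_tail (d : ℕ) (hd : 1 ≤ d) (ρ : Euc d → ℝ) (hρi : Integrable ρ)
    (x : Euc d) (hpos : 0 < ρ x) (hρ_cont : ContinuousAt ρ x) :
    Tendsto (fun s : ℝ => s * ∫ y in {y | s < hkT d x y}, ρ y) atTop (nhds (unitBallVol d * ρ x)) := by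
  have := hk_null d hd
  have hV := unitBallVol_pos d
  have hσT : Tendsto (fun s : ℝ => s⁻¹ ^ ((d:ℝ)⁻¹)) atTop (nhds 0) := by
    have : Tendsto (fun s : ℝ => s⁻¹ ^ ((d:ℝ)⁻¹)) atTop (nhds (0 ^ ((d:ℝ)⁻¹))) := by
      refine Tendsto.rpow_const tendsto_inv_atTop_zero ?_
      right; positivity
    rwa [Real.zero_rpow] at this
    have : (0:ℝ) < d := by exact_mod_cast hd
    positivity
  have heq : ∀ s : ℝ, 0 < s → ∫ y in {y | s < hkT d x y}, ρ y = ∫ y in Metric.ball x (s⁻¹ ^ ((d:ℝ)⁻¹)), ρ y := by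
    intro s hs
    apply setIntegral_congr_set
    have : ∀ᵐ y : Euc d, y ≠ x := by simp [ae_iff]
    filter_upwards [this] with y hy
    exact propext (hkT_lt_iff d hd x y hy s hs)
  have hvol : ∀ s : ℝ, 0 < s → s * volume.real (Metric.ball x (s⁻¹ ^ ((d:ℝ)⁻¹))) = unitBallVol d := by
    intro s hs
    rw [vol_ball d hd x _ (by positivity), Real.rpow_inv_natCast_pow (by positivity) (by omega)]
    field_simp
  have key : ∀ A B, A < ρ x → ρ x < B → ∀ᶠ s : ℝ in atTop,
      unitBallVol d * A ≤ s * ∫ y in {y | s < hkT d x y}, ρ y ∧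
      s * ∫ y in {y | s < hkT d x y}, ρ y ≤ unitBallVol d * B := by
    intro A B hA hB
    obtain ⟨r, hr, hball⟩ := Metric.mem_nhds_iff.mp (hρ_cont (Ioo_mem_nhds hA hB))
    filter_upwards [hσT.eventually (gt_mem_nhds hr), eventually_gt_atTop 0] with s h1 h2
    rw [heq s h2, ← hvol s h2]
    have hb : ∀ y ∈ Metric.ball x (s⁻¹ ^ ((d:ℝ)⁻¹)), A < ρ y ∧ ρ y < B := fun y hy =>
      hball (Metric.ball_subset_ball h1.le hy)
    have hfin : volume (Metric.ball x (s⁻¹ ^ ((d:ℝ)⁻¹))) ≠ ⊤ := measure_ball_lt_top.ne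
    constructor
    · rw [mul_assoc]
      gcongr
      have := setIntegral_mono_on (μ := volume) (f := fun _ => A) (g := ρ) (integrableOn_const (hs := hfin)) hρi.integrableOn
        measurableSet_ball (fun y hy => (hb y hy).1.le)
      simpa using this
    · rw [mul_assoc]
      gcongr
      have := setIntegral_mono_on (μ := volume) (g := fun _ => B) (f := ρ) hρi.integrableOn (integrableOn_const (hs := hfin)) 
        measurableSet_ball (fun y hy => (hb y hy).2.le)
      simpa using this
  rw [tendsto_order]
  constructor
  · intro a ha
    have : a / unitBallVol d < ρ x := by rw [div_lt_iff₀ hV]; linarith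
    obtain ⟨A, hA1, hA2⟩ := exists_between this
    filter_upwards [key A (ρ x + 1) hA2 (by linarith)] with s hs
    refine lt_of_lt_of_le ?_ hs.1
    rw [div_lt_iff₀ hV] at hA1; linarith
  · intro b hb
    have : ρ x < b / unitBallVol d := by rw [lt_div_iff₀ hV]; linarith
    obtain ⟨B, hB1, hB2⟩ := exists_between this
    filter_upwards [key (ρ x - 1) B (by linarith) hB1] with s hs
    refine lt_of_le_of_lt hs.2 ?_
    rw [lt_div_iff₀ hV] at hB2; linarith

def hkψ (d : ℕ) (ρ : Euc d → ℝ) (x : Euc d) (t : ℝ) : ℝ := ∫ y, ρ y * Real.exp (-t * hkT d x y)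

lemma hk_exp_le (d : ℕ) (x y : Euc d) (t : ℝ) (ht : 0 ≤ t) : Real.exp (-t * hkT d x y) ≤ 1 :=
  Real.exp_le_one_iff.mpr (by nlinarith [hkT_nonneg d x y])

lemma hkψ_int (d : ℕ) (ρ : Euc d → ℝ) (hρi : Integrable ρ) (x : Euc d) (t : ℝ) (ht : 0 ≤ t) :
    Integrable (fun y => ρ y * Real.exp (-t * hkT d x y)) := by
  have := hkT_meas d x
  refine hρi.mul_bdd (c := 1) (by fun_prop) (Eventually.of_forall fun y => ?_)
  rw [Real.norm_eq_abs, Real.abs_exp]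
  exact hk_exp_le d x y t ht

lemma hk_layer (d : ℕ) (ρ : Euc d → ℝ) (hρ_meas : Measurable ρ) (hρ_nonneg : ∀ y, 0 ≤ ρ y)
    (hρi : Integrable ρ) (hρ_prob : (∫ y, ρ y) = 1) (x : Euc d) (t : ℝ) (ht : 0 < t)
    (hpm : Measurable (fun s : ℝ => ∫ y in {y | s < hkT d x y}, ρ y))
    (hp0 : ∀ s : ℝ, 0 ≤ ∫ y in {y | s < hkT d x y}, ρ y) (hp1 : ∀ s : ℝ, ∫ y in {y | s < hkT d x y}, ρ y ≤ 1) :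
    1 - hkψ d ρ x t = t * ∫ s in Set.Ioi 0, Real.exp (-t * s) * ∫ y in {y | s < hkT d x y}, ρ y := by
  have hTm := hkT_meas d x
  set μ : Measure (Euc d) := volume.withDensity (fun y => ENNReal.ofReal (ρ y)) with hμ
  have hlc := lintegral_comp_eq_lintegral_meas_lt_mul (f := hkT d x) (g := fun s => t * Real.exp (-t * s)) μ
    (Eventually.of_forall fun y => hkT_nonneg d x y) hTm.aemeasurable
    (fun u hu => Continuous.intervalIntegrable (by fun_prop) _ _)
    (Eventually.of_forall fun s => by positivity)
  have hint : ∀ T : ℝ, ∫ s in (0:ℝ)..T, t * Real.exp (-t * s) = 1 - Real.exp (-t * T) := by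
    intro T
    rw [intervalIntegral.integral_eq_sub_of_hasDerivAt (f := fun s => - Real.exp (-t * s))]
    · simp; ring
    · intro s _
      have h2 : HasDerivAt (fun s : ℝ => -t * s) (-t) s := by
        simpa using (hasDerivAt_id s).const_mul (-t)
      have h3 : HasDerivAt (fun s : ℝ => - Real.exp (-t * s)) (-(Real.exp (-t * s) * (-t))) s := h2.exp.neg
      rwa [show -(Real.exp (-t * s) * (-t)) = t * Real.exp (-t * s) by ring] at h3
    · exact Continuous.intervalIntegrable (by fun_prop) _ _
  simp only [hint] at hlc
  have hle : ∫⁻ y, ENNReal.ofReal (1 - Real.exp (-t * hkT d x y)) ∂μ = ENNReal.ofReal (1 - hkψ d ρ x t) := by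
    rw [hμ, lintegral_withDensity_eq_lintegral_mul _ (by fun_prop) (by fun_prop)]
    have : 1 - hkψ d ρ x t = ∫ y, (ρ y - ρ y * Real.exp (-t * hkT d x y)) := by
      rw [integral_sub hρi (hkψ_int d ρ hρi x t ht.le), hρ_prob, hkψ]
    rw [this, ofReal_integral_eq_lintegral_ofReal (f := fun y => ρ y - ρ y * Real.exp (-t * hkT d x y)) (hρi.sub (hkψ_int d ρ hρi x t ht.le))]
    · apply lintegral_congr
      intro y
      rw [Pi.mul_apply, ← ENNReal.ofReal_mul (hρ_nonneg y)]
      congr 1; ring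
    · refine Eventually.of_forall fun y => ?_
      have := hk_exp_le d x y t ht.le
      have := hρ_nonneg y
      simp only [Pi.zero_apply]
      nlinarith
  have hmeas : ∀ s : ℝ, μ {y | s < hkT d x y} = ENNReal.ofReal (∫ y in {y | s < hkT d x y}, ρ y) := by
    intro s
    rw [hμ, withDensity_apply _ (measurableSet_lt measurable_const hTm),
      ofReal_integral_eq_lintegral_ofReal hρi.integrableOn (Eventually.of_forall fun y => hρ_nonneg y)]
  have hre : ∫⁻ s in Set.Ioi 0, μ {y | s < hkT d x y} * ENNReal.ofReal (t * Real.exp (-t * s)) =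
      ENNReal.ofReal (t * ∫ s in Set.Ioi 0, Real.exp (-t * s) * ∫ y in {y | s < hkT d x y}, ρ y) := by
    rw [← integral_const_mul, ofReal_integral_eq_lintegral_ofReal]
    · apply lintegral_congr
      intro s
      rw [hmeas, ← ENNReal.ofReal_mul (hp0 s)]
      congr 1; ring
    · exact (abel_int _ hpm hp0 hp1 t ht).const_mul t
    · refine Eventually.of_forall fun s => ?_
      exact mul_nonneg ht.le (mul_nonneg (Real.exp_pos _).le (hp0 s))
  rw [hle, hre] at hlc
  refine (ENNReal.ofReal_eq_ofReal_iff ?_ ?_).mp hlc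
  · rw [sub_nonneg, ← hρ_prob]
    refine integral_mono (hkψ_int d ρ hρi x t ht.le) hρi (fun y => ?_)
    exact mul_le_of_le_one_right (hρ_nonneg y) (hk_exp_le d x y t ht.le)
  · exact mul_nonneg ht.le (integral_nonneg fun s => mul_nonneg (Real.exp_pos _).le (hp0 s))

lemma hkψ_asym (d : ℕ) (hd : 1 ≤ d) (ρ : Euc d → ℝ) (hρ_meas : Measurable ρ) (hρ_nonneg : ∀ y, 0 ≤ ρ y)
    (hρi : Integrable ρ) (hρ_prob : (∫ y, ρ y) = 1) (x : Euc d) (hpos : 0 < ρ x) (hρ_cont : ContinuousAt ρ x) :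
    Tendsto (fun t => (1 - hkψ d ρ x t) / (t * Real.log (1 / t))) (nhdsWithin 0 (Set.Ioi 0))
      (nhds (unitBallVol d * ρ x)) := by
  have hTm := hkT_meas d x
  have hp0 : ∀ s : ℝ, 0 ≤ ∫ y in {y | s < hkT d x y}, ρ y := fun s => integral_nonneg hρ_nonneg
  have hp1 : ∀ s : ℝ, ∫ y in {y | s < hkT d x y}, ρ y ≤ 1 := fun s => by
    rw [← hρ_prob]
    exact setIntegral_le_integral hρi (Eventually.of_forall hρ_nonneg)
  have hpm : Measurable (fun s : ℝ => ∫ y in {y | s < hkT d x y}, ρ y) := by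
    apply Antitone.measurable
    intro s u hsu
    apply setIntegral_mono_set hρi.integrableOn (Eventually.of_forall hρ_nonneg)
    exact Eventually.of_forall fun y hy => lt_of_le_of_lt hsu hy
  have := abel _ hpm hp0 hp1 _ (mul_pos (unitBallVol_pos d) hpos) (hk_tail d hd ρ hρi x hpos hρ_cont)
  refine Tendsto.congr' ?_ this
  filter_upwards [self_mem_nhdsWithin] with t ht
  have ht : 0 < t := ht
  rw [hk_layer d ρ hρ_meas hρ_nonneg hρi hρ_prob x t ht hpm hp0 hp1]
  rw [mul_div_mul_left _ _ ht.ne']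

lemma hkψ_anti (d : ℕ) (ρ : Euc d → ℝ) (hρ_nonneg : ∀ y, 0 ≤ ρ y)
    (hρi : Integrable ρ) (x : Euc d) (t u : ℝ) (ht : 0 ≤ t) (htu : t ≤ u) : hkψ d ρ x u ≤ hkψ d ρ x t := by
  refine integral_mono (hkψ_int d ρ hρi x u (ht.trans htu)) (hkψ_int d ρ hρi x t ht) (fun y => ?_)
  refine mul_le_mul_of_nonneg_left (Real.exp_le_exp.mpr ?_) (hρ_nonneg y)
  nlinarith [hkT_nonneg d x y]

lemma hkψ_decay (d : ℕ) (hd : 1 ≤ d) (ρ : Euc d → ℝ) (hρ_nonneg : ∀ y, 0 ≤ ρ y)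
    (hρi : Integrable ρ) (hρm : Measurable ρ) (hρ_var : Integrable (fun y => ρ y * ‖y‖ ^ 2)) (x : Euc d) :
    ∃ C, 0 ≤ C ∧ ∀ t, 0 < t → hkψ d ρ x t ^ d ≤ C / t ^ 2 := by
  have := hk_null d hd
  have hv : Integrable (fun y => ρ y * ‖x - y‖ ^ 2) := by
    refine Integrable.mono' ((hρi.const_mul (2 * ‖x‖ ^ 2)).add (hρ_var.const_mul 2)) (by fun_prop)
      (Eventually.of_forall fun y => ?_)
    have h1 := hρ_nonneg y
    rw [Real.norm_eq_abs, abs_of_nonneg (by positivity)]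
    simp only [Pi.add_apply]
    have h2 : ‖x - y‖ ≤ ‖x‖ + ‖y‖ := norm_sub_le _ _
    have h3 : ‖x - y‖ ^ 2 ≤ 2 * ‖x‖ ^ 2 + 2 * ‖y‖ ^ 2 := by
      nlinarith [norm_nonneg (x - y), sq_nonneg (‖x‖ - ‖y‖)]
    nlinarith
  set M := ∫ y, ρ y * ‖x - y‖ ^ 2 with hM
  have hM0 : 0 ≤ M := integral_nonneg fun y => mul_nonneg (hρ_nonneg y) (by positivity)
  have hd0 : (0:ℝ) < d := by exact_mod_cast hd
  have hd1 : (1:ℝ) ≤ d := by exact_mod_cast hd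
  have hexp : ∀ v : ℝ, 0 < v → Real.exp (-v) ≤ 3 * v ^ (-(2 / (d:ℝ))) := by
    intro v hv
    rw [Real.rpow_neg hv.le, Real.exp_neg, ← div_eq_mul_inv, inv_eq_one_div, div_le_div_iff₀ (Real.exp_pos _) (by positivity), one_mul]
    have h1 : v ^ (2 / (d:ℝ)) ≤ 1 + v ^ 2 := by
      rcases le_or_gt v 1 with h | h
      · have := Real.rpow_le_one hv.le h (show 0 ≤ 2 / (d:ℝ) by positivity)
        nlinarith
      · have := Real.rpow_le_rpow_of_exponent_le h.le (show 2 / (d:ℝ) ≤ (2:ℕ) by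
          rw [div_le_iff₀ hd0]; push_cast; linarith)
        rw [Real.rpow_natCast] at this
        linarith
    have h2 := Real.quadratic_le_exp_of_nonneg hv.le
    nlinarith
  have hb : ∀ t, 0 < t → hkψ d ρ x t ≤ 3 * t ^ (-(2 / (d:ℝ))) * M := by
    intro t ht
    rw [hM, ← integral_const_mul]
    refine integral_mono_ae (hkψ_int d ρ hρi x t ht.le) (hv.const_mul _) ?_
    have : ∀ᵐ y : Euc d, y ≠ x := by simp [ae_iff]
    filter_upwards [this] with y hy
    have hN : 0 < ‖x - y‖ := norm_pos_iff.mpr (sub_ne_zero.mpr hy.symm)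
    have h1 := hexp (t * hkT d x y) (mul_pos ht (hkT_pos d x y hy))
    have h2 : (t * hkT d x y) ^ (-(2 / (d:ℝ))) = t ^ (-(2 / (d:ℝ))) * ‖x - y‖ ^ 2 := by
      rw [Real.mul_rpow ht.le (hkT_nonneg d x y), hkT, ← Real.rpow_mul hN.le, ← Real.rpow_natCast]
      congr 2
      push_cast
      field_simp
    rw [h2] at h1
    have := mul_le_mul_of_nonneg_left h1 (hρ_nonneg y)
    calc ρ y * Real.exp (-t * hkT d x y) = ρ y * Real.exp (-(t * hkT d x y)) := by rw [neg_mul]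
      _ ≤ _ := this
      _ = _ := by ring
  refine ⟨(3 * M) ^ d, by positivity, fun t ht => ?_⟩
  have h0 : 0 ≤ hkψ d ρ x t := integral_nonneg fun y => mul_nonneg (hρ_nonneg y) (Real.exp_pos _).le
  refine (pow_le_pow_left₀ h0 (hb t ht) d).trans (le_of_eq ?_)
  have : (t ^ (-(2 / (d:ℝ)))) ^ d = (t ^ 2)⁻¹ := by
    rw [← Real.rpow_mul_natCast ht.le, show -(2 / (d:ℝ)) * d = -((2:ℕ):ℝ) by push_cast; field_simp,
      Real.rpow_neg ht.le, Real.rpow_natCast]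
  rw [show 3 * t ^ (-(2 / (d:ℝ))) * M = 3 * M * t ^ (-(2 / (d:ℝ))) by ring, mul_pow, this, div_eq_mul_inv]

/-- integrand of the bias constant -/
def hkG (d : ℕ) (ρ f : Euc d → ℝ) (x y : Euc d) : ℝ := ρ y * ((f y - f x) * hkT d x y)

lemma hkG_int (d : ℕ) (hd : 1 ≤ d)
    (ρ : Euc d → ℝ) (hρ_meas : Measurable ρ) (hρ_nonneg : ∀ y, 0 ≤ ρ y) (hρi : Integrable ρ)
    (x : Euc d) (hρ_cont : ContinuousAt ρ x)
    (f : Euc d → ℝ) (hf_meas : Measurable f)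
    (hf_growth : Integrable (fun y => ρ y * f y ^ 2 / (1 + ‖y‖ ^ (2 * (d : ℝ)))))
    (αx Kx δx : ℝ) (hαx : 0 < αx) (hKx : 0 < Kx) (hδx : 0 < δx)
    (hf_holder : ∀ x', 0 < ρ x' → ‖x - x'‖ ≤ δx → |f x - f x'| ≤ Kx * ‖x - x'‖ ^ αx) :
    Integrable (hkG d ρ f x) := by
  have hTm := hkT_meas d x
  have hGm : Measurable (hkG d ρ f x) := by unfold hkG; fun_prop
  suffices hI : Integrable (fun z => hkG d ρ f x (x + z)) by
    have := hI.comp_add_left (-x)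
    simpa using this
  have hGm' : Measurable (fun z => hkG d ρ f x (x + z)) := by fun_prop
  have hT : ∀ z, hkT d x (x + z) = (‖z‖ ^ d)⁻¹ := by
    intro z
    rw [hkT, show x - (x + z) = -z by abel, norm_neg, Real.rpow_neg (norm_nonneg _), Real.rpow_natCast]
  obtain ⟨r0, hr0, hball⟩ := Metric.mem_nhds_iff.mp (hρ_cont (gt_mem_nhds (show ρ x < ρ x + 1 by linarith)))
  obtain ⟨r, hr, hrr0, hrδ⟩ : ∃ r, 0 < r ∧ r ≤ r0 ∧ r ≤ δx :=
    ⟨min r0 δx, lt_min hr0 hδx, min_le_left _ _, min_le_right _ _⟩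
  set M := ρ x + 1 with hM
  have hM0 : 0 < M := by linarith [hρ_nonneg x]
  rw [← integrableOn_univ, ← Set.union_compl_self (Metric.ball (0 : Euc d) r)]
  refine IntegrableOn.union ?_ ?_
  · refine integrableOn_ball_of_norm_le_rpow (C := M * Kx) (α := (d:ℝ) - αx) (by simpa using hd) (by simpa using hαx) ?_
      hGm'.aestronglyMeasurable
    refine (ae_restrict_iff' measurableSet_ball).mpr (Eventually.of_forall fun z hz => ?_)
    have hzr : ‖z‖ < r := by simpa using hz
    rcases eq_or_ne z 0 with rfl | hz0
    · simp only [hkG, add_zero, sub_self, zero_mul, mul_zero, norm_zero]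
      positivity
    have hzp : 0 < ‖z‖ := norm_pos_iff.mpr hz0
    rw [hkG, hT]
    have hρM : ρ (x + z) ≤ M := by
      have : x + z ∈ Metric.ball x r0 := by simpa using lt_of_lt_of_le hzr hrr0
      exact (show ρ (x + z) < M from hball this).le
    rcases (hρ_nonneg (x + z)).eq_or_lt with h0 | hpos
    · rw [← h0]
      simp only [zero_mul, norm_zero]
      positivity
    have hh := hf_holder (x + z) hpos (by simpa using (hzr.trans_le hrδ).le)
    rw [show x - (x + z) = -z by abel, norm_neg] at hh
    have e : ‖z‖ ^ (-((d:ℝ) - αx)) = ‖z‖ ^ αx * (‖z‖ ^ d)⁻¹ := by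
      rw [show -((d:ℝ) - αx) = αx + -(d:ℝ) by ring, Real.rpow_add hzp, Real.rpow_neg hzp.le, Real.rpow_natCast]
    rw [e, norm_mul, norm_mul, Real.norm_eq_abs, Real.norm_eq_abs, Real.norm_eq_abs, abs_of_pos hpos,
      abs_of_pos (show 0 < (‖z‖ ^ d)⁻¹ by positivity), abs_sub_comm]
    calc ρ (x + z) * (|f x - f (x + z)| * (‖z‖ ^ d)⁻¹) ≤ M * (Kx * ‖z‖ ^ αx * (‖z‖ ^ d)⁻¹) := by gcongr
      _ = _ := by ring
  · set R := (r ^ d)⁻¹ with hR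
    set Cs := R ^ 2 + (‖x‖ / r + 1) ^ (2 * d) with hCs
    have hR0 : 0 < R := by positivity
    have hbd : Integrable (fun z => (|f x| * R + 1 / 2) * ρ (x + z) + Cs / 2 *
        (ρ (x + z) * f (x + z) ^ 2 / (1 + ‖x + z‖ ^ (2 * (d : ℝ))))) :=
      ((hρi.comp_add_left x).const_mul _).add ((hf_growth.comp_add_left x).const_mul _)
    refine Integrable.mono' hbd.integrableOn hGm'.aestronglyMeasurable ?_
    refine (ae_restrict_iff' measurableSet_ball.compl).mpr (Eventually.of_forall fun z hz => ?_)
    have hzr : r ≤ ‖z‖ := by simpa using hz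
    have hzp : 0 < ‖z‖ := lt_of_lt_of_le hr hzr
    rw [hkG, hT]
    set T := (‖z‖ ^ d)⁻¹ with hTdef
    have hT0 : 0 < T := by positivity
    have hTR : T ≤ R := by rw [hTdef, hR]; gcongr
    have hw : ‖x + z‖ ^ (2 * (d:ℝ)) = ‖x + z‖ ^ (2 * d) := by
      rw [← Real.rpow_natCast]; push_cast; rfl
    rw [hw]
    have hT2 : T ^ 2 ≤ Cs / (1 + ‖x + z‖ ^ (2 * d)) := by
      rw [le_div_iff₀ (by positivity), mul_add, mul_one, hCs]
      have h1 : T ^ 2 ≤ R ^ 2 := by gcongr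
      have h2 : T ^ 2 * ‖x + z‖ ^ (2 * d) = (‖x + z‖ / ‖z‖) ^ (2 * d) := by
        rw [hTdef, div_pow, inv_pow, ← pow_mul, mul_comm d 2]; field_simp
      have h3 : ‖x + z‖ / ‖z‖ ≤ ‖x‖ / r + 1 := by
        rw [div_le_iff₀ hzp]
        have h4 : ‖x‖ ≤ ‖x‖ / r * ‖z‖ := by
          rw [div_mul_eq_mul_div, le_div_iff₀ hr]
          gcongr
        linarith [norm_add_le x z]
      rw [h2]
      gcongr
    have hρ0 := hρ_nonneg (x + z)
    rw [norm_mul, norm_mul, Real.norm_eq_abs, Real.norm_eq_abs, Real.norm_eq_abs, abs_of_nonneg hρ0,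
      abs_of_pos hT0]
    have hfT : |f (x + z)| * T ≤ 1 / 2 + Cs / 2 * (f (x + z) ^ 2 / (1 + ‖x + z‖ ^ (2 * d))) := by
      have h1 : |f (x + z)| * T ≤ 1 / 2 + f (x + z) ^ 2 * T ^ 2 / 2 := by
        nlinarith [sq_nonneg (|f (x + z)| * T - 1), sq_abs (f (x + z))]
      have h2 : f (x + z) ^ 2 * T ^ 2 ≤ f (x + z) ^ 2 * (Cs / (1 + ‖x + z‖ ^ (2 * d))) := by gcongr
      calc _ ≤ _ := h1
        _ ≤ 1 / 2 + f (x + z) ^ 2 * (Cs / (1 + ‖x + z‖ ^ (2 * d))) / 2 := by linarith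
        _ = _ := by ring
    have hsum : |f (x + z) - f x| * T ≤ |f x| * R + 1 / 2 + Cs / 2 * (f (x + z) ^ 2 / (1 + ‖x + z‖ ^ (2 * d))) := by
      have h1 : |f (x + z) - f x| ≤ |f (x + z)| + |f x| := abs_sub _ _
      have h2 : |f x| * T ≤ |f x| * R := by gcongr
      nlinarith
    calc ρ (x + z) * (|f (x + z) - f x| * T)
        ≤ ρ (x + z) * (|f x| * R + 1 / 2 + Cs / 2 * (f (x + z) ^ 2 / (1 + ‖x + z‖ ^ (2 * d)))) := by gcongr
      _ = _ := by ring

def hkh (d : ℕ) (ρ f : Euc d → ℝ) (x : Euc d) (t : ℝ) : ℝ := ∫ y, hkG d ρ f x y * Real.exp (-t * hkT d x y)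

lemma hkψ_meas (d : ℕ) (ρ : Euc d → ℝ) (hρ_meas : Measurable ρ) (x : Euc d) : Measurable (hkψ d ρ x) := by
  have hTm := hkT_meas d x
  have : StronglyMeasurable (fun q : ℝ × Euc d => ρ q.2 * Real.exp (-q.1 * hkT d x q.2)) :=
    Measurable.stronglyMeasurable (by fun_prop)
  exact this.integral_prod_right'.measurable

lemma hkh_meas (d : ℕ) (ρ f : Euc d → ℝ) (x : Euc d) (hGm : Measurable (hkG d ρ f x)) : Measurable (hkh d ρ f x) := by
  have hTm := hkT_meas d x
  have : StronglyMeasurable (fun q : ℝ × Euc d => hkG d ρ f x q.2 * Real.exp (-q.1 * hkT d x q.2)) :=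
    Measurable.stronglyMeasurable (by fun_prop)
  exact this.integral_prod_right'.measurable

lemma hkG_exp_int (d : ℕ) (ρ f : Euc d → ℝ) (x : Euc d) (hG : Integrable (hkG d ρ f x)) (t : ℝ) (ht : 0 ≤ t) :
    Integrable (fun y => hkG d ρ f x y * Real.exp (-t * hkT d x y)) := by
  have := hkT_meas d x
  refine hG.mul_bdd (c := 1) (by fun_prop) (Eventually.of_forall fun y => ?_)
  rw [Real.norm_eq_abs, Real.abs_exp]
  exact hk_exp_le d x y t ht

lemma hkh_abs_bd (d : ℕ) (ρ f : Euc d → ℝ) (x : Euc d) (hG : Integrable (hkG d ρ f x)) (t : ℝ) (ht : 0 ≤ t) :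
    ∫ y, ‖hkG d ρ f x y * Real.exp (-t * hkT d x y)‖ ≤ ∫ y, ‖hkG d ρ f x y‖ := by
  refine integral_mono (hkG_exp_int d ρ f x hG t ht).norm hG.norm (fun y => ?_)
  simp only [norm_mul, Real.norm_eq_abs, Real.abs_exp]
  exact mul_le_of_le_one_right (abs_nonneg _) (hk_exp_le d x y t ht)

lemma hkh_lim (d : ℕ) (ρ f : Euc d → ℝ) (x : Euc d) (hG : Integrable (hkG d ρ f x)) :
    Tendsto (hkh d ρ f x) (nhdsWithin 0 (Set.Ioi 0)) (nhds (∫ y, hkG d ρ f x y)) := by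
  refine tendsto_integral_filter_of_dominated_convergence (fun y => ‖hkG d ρ f x y‖) ?_ ?_ hG.norm ?_
  · filter_upwards [self_mem_nhdsWithin] with t ht
    exact (hkG_exp_int d ρ f x hG t (le_of_lt ht)).aestronglyMeasurable
  · filter_upwards [self_mem_nhdsWithin] with t ht
    refine Eventually.of_forall fun y => ?_
    rw [norm_mul, Real.norm_eq_abs (Real.exp _), Real.abs_exp]
    exact mul_le_of_le_one_right (norm_nonneg _) (hk_exp_le d x y t (le_of_lt ht))
  · refine Eventually.of_forall fun y => ?_
    refine Tendsto.mono_left ?_ nhdsWithin_le_nhds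
    have : Continuous (fun t : ℝ => hkG d ρ f x y * Real.exp (-t * hkT d x y)) := by fun_prop
    simpa using this.tendsto 0

lemma hk_prod (n : ℕ) (i : Fin (n + 1)) (a b : ℝ) : ∏ j : Fin (n + 1), (if j = i then a else b) = a * b ^ n := by
  rw [Fin.prod_univ_succAbove _ i]
  simp [Fin.succAbove_ne]

lemma hk_fubini (d n : ℕ)
    (ρ : Euc d → ℝ) (hρ_meas : Measurable ρ) (hρ_nonneg : ∀ y, 0 ≤ ρ y) (hρi : Integrable ρ)
    (x : Euc d) (f : Euc d → ℝ) (hf_meas : Measurable f) (hG : Integrable (hkG d ρ f x))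
    (hψn : IntegrableOn (fun t => hkψ d ρ x t ^ n) (Set.Ioi 0)) (i : Fin (n + 1)) :
    Integrable (fun xs : Fin (n + 1) → Euc d => hilbertWeight d n x xs i * (f (xs i) - f x) * ∏ j, ρ (xs j)) ∧
    ∫ xs : Fin (n + 1) → Euc d, hilbertWeight d n x xs i * (f (xs i) - f x) * ∏ j, ρ (xs j) =
      ∫ t in Set.Ioi 0, hkh d ρ f x t * hkψ d ρ x t ^ n := by
  have hTm := hkT_meas d x
  let F : ℝ → Fin (n + 1) → Euc d → ℝ := fun t j y =>
    if j = i then hkG d ρ f x y * Real.exp (-t * hkT d x y) else ρ y * Real.exp (-t * hkT d x y)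
  let Φ : ℝ × (Fin (n + 1) → Euc d) → ℝ := fun q =>
    ((f (q.2 i) - f x) * hkT d x (q.2 i) * ∏ j, ρ (q.2 j)) * Real.exp (-q.1 * ∑ j, hkT d x (q.2 j))
  have hF : ∀ t xs, ∏ j, F t j (xs j) = Φ (t, xs) := by
    intro t xs
    have : ∀ j, F t j (xs j) = (if j = i then (f (xs j) - f x) * hkT d x (xs j) else 1) *
        (ρ (xs j) * Real.exp (-t * hkT d x (xs j))) := by
      intro j
      simp only [F, hkG]
      split_ifs <;> ring
    simp only [this, Finset.prod_mul_distrib, Finset.prod_ite_eq', Finset.mem_univ, if_true,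
      ← Real.exp_sum, ← Finset.mul_sum, Φ]
    ring
  have hFi : ∀ t, 0 ≤ t → ∀ j, Integrable (F t j) := by
    intro t ht j
    by_cases hj : j = i
    · simp only [F, hj, if_true]; exact hkG_exp_int d ρ f x hG t ht
    · simp only [F, hj, if_false]; exact hkψ_int d ρ hρi x t ht
  have hFint : ∀ t, ∫ xs, Φ (t, xs) = hkh d ρ f x t * hkψ d ρ x t ^ n := by
    intro t
    simp only [← hF]
    rw [integral_fintype_prod_volume_eq_prod, ← hk_prod n i]
    refine Finset.prod_congr rfl fun j _ => ?_
    by_cases hj : j = i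
    · simp only [F, hj, if_true, hkh]
    · simp only [F, hj, if_false, hkψ]
  have hFabs : ∀ t, ∫ xs, ‖Φ (t, xs)‖ =
      (∫ y, ‖hkG d ρ f x y * Real.exp (-t * hkT d x y)‖) * hkψ d ρ x t ^ n := by
    intro t
    simp only [← hF, norm_prod]
    rw [integral_fintype_prod_volume_eq_prod (fun j y => ‖F t j y‖), ← hk_prod n i]
    refine Finset.prod_congr rfl fun j _ => ?_
    by_cases hj : j = i
    · simp only [F, hj, if_true]
    · simp only [F, hj, if_false, hkψ]
      refine integral_congr_ae (Eventually.of_forall fun y => ?_)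
      simp only [norm_mul, Real.norm_eq_abs, Real.abs_exp, abs_of_nonneg (hρ_nonneg y)]
  have hΦm : Measurable Φ := by
    simp only [Φ]
    fun_prop
  have hΦi : Integrable Φ ((volume.restrict (Set.Ioi 0)).prod volume) := by
    rw [integrable_prod_iff hΦm.aestronglyMeasurable]
    constructor
    · refine (ae_restrict_iff' measurableSet_Ioi).mpr (Eventually.of_forall fun t ht => ?_)
      simp only [← hF]
      exact Integrable.fintype_prod (hFi t (le_of_lt ht))
    · refine Integrable.mono' (hψn.const_mul (∫ y, ‖hkG d ρ f x y‖)) ?_ ?_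
      · exact (hΦm.stronglyMeasurable.norm.integral_prod_right').aestronglyMeasurable
      · refine (ae_restrict_iff' measurableSet_Ioi).mpr (Eventually.of_forall fun t ht => ?_)
        have hψ0 : 0 ≤ hkψ d ρ x t := integral_nonneg fun y => mul_nonneg (hρ_nonneg y) (Real.exp_pos _).le
        rw [Real.norm_eq_abs, abs_of_nonneg (integral_nonneg fun _ => norm_nonneg _), hFabs]
        exact mul_le_mul_of_nonneg_right (hkh_abs_bd d ρ f x hG t (le_of_lt ht)) (pow_nonneg hψ0 n)
  have hinner : ∀ xs : Fin (n + 1) → Euc d, ∫ t in Set.Ioi 0, Φ (t, xs) =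
      hilbertWeight d n x xs i * (f (xs i) - f x) * ∏ j, ρ (xs j) := by
    intro xs
    simp only [Φ]
    rw [integral_const_mul]
    have hS0 : 0 ≤ ∑ j, hkT d x (xs j) := Finset.sum_nonneg fun j _ => hkT_nonneg d x _
    have hwt : hilbertWeight d n x xs i = hkT d x (xs i) / ∑ j, hkT d x (xs j) := rfl
    rcases hS0.eq_or_lt with h | h
    · have : hkT d x (xs i) = 0 :=
        (Finset.sum_eq_zero_iff_of_nonneg (fun j _ => hkT_nonneg d x _)).mp h.symm i (Finset.mem_univ i)
      rw [hwt, this]; simp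
    · have : ∫ t in Set.Ioi (0:ℝ), Real.exp (-t * ∑ j, hkT d x (xs j)) = 1 / ∑ j, hkT d x (xs j) := by
        have := integral_exp_mul_Ioi (neg_lt_zero.mpr h) 0
        rw [mul_zero, Real.exp_zero, neg_div_neg_eq] at this
        rw [← this]
        congr 1; ext t; congr 1; ring
      rw [this, hwt]; ring
  constructor
  · have := hΦi.integral_prod_right
    simpa only [hinner] using this
  · have := integral_integral_swap (f := fun t xs => Φ (t, xs)) hΦi
    simp only [hFint, hinner] at this
    exact this.symm

lemma hk_est (d n : ℕ) (hd : 1 ≤ d)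
    (ρ : Euc d → ℝ) (hρ_meas : Measurable ρ) (hρ_nonneg : ∀ y, 0 ≤ ρ y) (hρi : Integrable ρ)
    (hρ_prob : (∫ y, ρ y) = 1)
    (x : Euc d) (f : Euc d → ℝ) (hf_meas : Measurable f) (hG : Integrable (hkG d ρ f x))
    (hψn : IntegrableOn (fun t => hkψ d ρ x t ^ n) (Set.Ioi 0)) :
    hilbertEstExp d n x ρ f - f x = (n + 1) * ∫ t in Set.Ioi 0, hkh d ρ f x t * hkψ d ρ x t ^ n := by
  have hfub := hk_fubini d n ρ hρ_meas hρ_nonneg hρi x f hf_meas hG hψn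
  have hnull := hk_null d hd
  have hae : ∀ᵐ xs : Fin (n + 1) → Euc d, xs 0 ≠ x :=
    Measure.ae_eval_ne (fun _ => (volume : Measure (Euc d))) 0 x
  have hprodi : Integrable (fun xs : Fin (n + 1) → Euc d => ∏ j, ρ (xs j)) :=
    Integrable.fintype_prod (fun _ => hρi)
  have hprod1 : ∫ xs : Fin (n + 1) → Euc d, ∏ j, ρ (xs j) = 1 := by
    rw [integral_fintype_prod_volume_eq_prod (fun _ y => ρ y)]
    simp [hρ_prob]
  have e : hilbertEstExp d n x ρ f = ∫ xs : Fin (n + 1) → Euc d,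
      ((∑ i, hilbertWeight d n x xs i * (f (xs i) - f x) * ∏ j, ρ (xs j)) + f x * ∏ j, ρ (xs j)) := by
    refine integral_congr_ae ?_
    filter_upwards [hae] with xs hxs
    have hS : 0 < ∑ j, hkT d x (xs j) :=
      Finset.sum_pos' (fun j _ => hkT_nonneg d x _) ⟨0, Finset.mem_univ _, hkT_pos d x _ hxs⟩
    have hw1 : ∑ i, hilbertWeight d n x xs i = 1 := by
      have : ∀ i, hilbertWeight d n x xs i = hkT d x (xs i) / ∑ j, hkT d x (xs j) := fun i => rfl
      simp only [this, ← Finset.sum_div]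
      exact div_self hS.ne'
    rw [← Finset.sum_mul, ← add_mul]
    congr 1
    simp only [mul_sub, Finset.sum_sub_distrib, ← Finset.sum_mul, hw1]
    ring
  rw [e, integral_add (integrable_finsetSum _ fun i _ => (hfub i).1) (hprodi.const_mul _),
    integral_finsetSum _ fun i _ => (hfub i).1, integral_const_mul, hprod1]
  simp only [(hfub _).2]
  simp

/-- under the growth condition and local Hölder condition for `f`, with
`κ(x) = ∫ ρ(x+y)·(f(x+y)−f(x))/‖y‖^d dy ≠ 0`, the expectation of the Hilbert kernel
estimator satisfies `E[f̂(x)] − f(x) ~ κ(x)/(V_d·ρ(x)·ln n)` as `n → ∞`. -/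
theorem hilbert_estimator_mean_asymptotic
    (d : ℕ) (hd : 1 ≤ d)
    (ρ : Euc d → ℝ) (hρ_meas : Measurable ρ) (hρ_nonneg : ∀ y, 0 ≤ ρ y)
    (hρ_prob : (∫ y, ρ y) = 1)
    (hρ_var : Integrable (fun y => ρ y * ‖y‖ ^ 2))
    (x : Euc d) (hx : x ∈ interior {y | 0 < ρ y}) (hρ_cont : ContinuousAt ρ x)
    (f : Euc d → ℝ) (hf_meas : Measurable f)
    (hf_growth : Integrable (fun y => ρ y * f y ^ 2 / (1 + ‖y‖ ^ (2 * (d : ℝ)))))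
    (αx Kx δx : ℝ) (hαx : 0 < αx) (hKx : 0 < Kx) (hδx : 0 < δx)
    (hf_holder : ∀ x', 0 < ρ x' → ‖x - x'‖ ≤ δx → |f x - f x'| ≤ Kx * ‖x - x'‖ ^ αx)
    (hκ : (∫ y : Euc d, ρ (x + y) * (f (x + y) - f x) / ‖y‖ ^ (d : ℝ)) ≠ 0) :
    Tendsto (fun n : ℕ => (hilbertEstExp d n x ρ f - f x) /
        ((∫ y : Euc d, ρ (x + y) * (f (x + y) - f x) / ‖y‖ ^ (d : ℝ)) /
          (unitBallVol d * ρ x * Real.log n)))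
      atTop (nhds 1) := by
  have hnull := hk_null d hd
  have hρi : Integrable ρ := by
    by_contra h
    rw [integral_undef h] at hρ_prob
    norm_num at hρ_prob
  have hpos : 0 < ρ x := (interior_subset (s := {y | 0 < ρ y})) hx
  have hG := hkG_int d hd ρ hρ_meas hρ_nonneg hρi x hρ_cont f hf_meas hf_growth αx Kx δx hαx hKx hδx hf_holder
  have hTm := hkT_meas d x
  have hGm : Measurable (hkG d ρ f x) := by unfold hkG; fun_prop
  have hκeq : (∫ y : Euc d, ρ (x + y) * (f (x + y) - f x) / ‖y‖ ^ (d : ℝ)) = ∫ y, hkG d ρ f x y := by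
    rw [← integral_add_left_eq_self (fun y => hkG d ρ f x y) x]
    refine integral_congr_ae (Eventually.of_forall fun z => ?_)
    simp only [hkG, hkT]
    rw [show x - (x + z) = -z by abel, norm_neg, Real.rpow_neg (norm_nonneg _)]
    ring
  rw [hκeq] at hκ ⊢
  set κ := ∫ y, hkG d ρ f x y with hκdef
  have hL : 0 < unitBallVol d * ρ x := mul_pos (unitBallVol_pos d) hpos
  set L := unitBallVol d * ρ x with hLdef
  obtain ⟨C, hC, hdecay⟩ := hkψ_decay d hd ρ hρ_nonneg hρi hρ_meas hρ_var x
  have hψ0 : ∀ t, 0 ≤ hkψ d ρ x t := fun t =>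
    integral_nonneg fun y => mul_nonneg (hρ_nonneg y) (Real.exp_pos _).le
  have hψ1 : ∀ t, 0 < t → hkψ d ρ x t ≤ 1 := by
    intro t ht
    rw [← hρ_prob]
    refine integral_mono (hkψ_int d ρ hρi x t ht.le) hρi (fun y => ?_)
    exact mul_le_of_le_one_right (hρ_nonneg y) (hk_exp_le d x y t ht.le)
  have hψm := hkψ_meas d ρ hρ_meas x
  have main := oneD (hkψ d ρ x) (hkh d ρ f x) L C (∫ y, ‖hkG d ρ f x y‖) κ d hL hC hψm
    (hkh_meas d ρ f x hGm) hψ0 hψ1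
    (fun t u ht htu => hkψ_anti d ρ hρ_nonneg hρi x t u ht.le htu)
    (hkψ_asym d hd ρ hρ_meas hρ_nonneg hρi hρ_prob x hpos hρ_cont) hdecay
    (fun t ht => (norm_integral_le_integral_norm _).trans (hkh_abs_bd d ρ f x hG t ht.le))
    (hkh_lim d ρ f x hG)
  have hψn : ∀ n, d ≤ n → IntegrableOn (fun t => hkψ d ρ x t ^ n) (Set.Ioi 0) := by
    intro n hn
    refine Integrable.mono' (integrable_inv_one_add_sq.const_mul (1 + C)).integrableOn
      (hψm.pow_const n).aestronglyMeasurable ?_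
    refine (ae_restrict_iff' measurableSet_Ioi).mpr (Eventually.of_forall fun t ht => ?_)
    have ht : 0 < t := ht
    rw [Real.norm_eq_abs, abs_of_nonneg (pow_nonneg (hψ0 t) n)]
    have h1 : hkψ d ρ x t ^ n ≤ 1 := pow_le_one₀ (hψ0 t) (hψ1 t ht)
    have h2 : hkψ d ρ x t ^ n ≤ C / t ^ 2 :=
      (pow_le_pow_of_le_one (hψ0 t) (hψ1 t ht) hn).trans (hdecay t ht)
    rw [le_div_iff₀ (by positivity)] at h2
    rw [← div_eq_mul_inv, le_div_iff₀ (by positivity)]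
    linarith
  have hone : Tendsto (fun n : ℕ => 1 + 1 / (n : ℝ)) atTop (nhds (1 + 0)) :=
    tendsto_one_div_atTop_nhds_zero_nat.const_add 1
  have P := ((main.mul hone).mul_const (L / κ))
  rw [show κ / L * (1 + 0) * (L / κ) = 1 by field_simp; ring] at P
  refine Tendsto.congr' ?_ P
  filter_upwards [eventually_ge_atTop d, eventually_gt_atTop 0] with n hn hn0
  have hn0' : (0:ℝ) < n := by exact_mod_cast hn0
  rw [hk_est d n hd ρ hρ_meas hρ_nonneg hρi hρ_prob x f hf_meas hG (hψn n hn), div_div_eq_mul_div]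
  field_simp

end
end
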